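/- Stability of classical LDPC codes under symmetric perturbations (spectral part): Fix integers q, q' ≥ 2, reals c_d > 0 and κ₁ > 2/c_d, a real a ≥ 1, and constants c'_f, c''_f, α > 0. Then there exist positive constants ε₀, c₁, c₂, c₃ depending only on q, q', κ₁, a, c'_f, c''_f, α such that the following holds. Let a classical code on n ≥ c₃ qubits be given by a parity-check matrix H ∈ F₂^{m×n} with nonzero rows h₁, …, h_m, whose checks are the Z-type Pauli operators (0, hⱼ); assume it is (q,q')-LDPC, set k := n − rank_{F₂}(H) and d := the minimum Hamming weight of a nonzero u ∈ F₂ⁿ with H·u = 0, and assume (d_c, f)-check-soundness for an increasing bijection f of [0,∞), with d_s := min(d, d_c) ≥ c_d·log n and the summability condition holding with constants (c'_f, c''_f, α). Let H₀ = Σⱼ λⱼ·(I − P(0, hⱼ))/2 with λⱼ ∈ [1, a]. Let V be a Hermitian 2ⁿ×2ⁿ matrix presented as V = Σ_{S,s} V_{S,s}, each V_{S,s} strongly supported in S with syndrome s and commuting with the X-type symmetry matrix P(u, 0) for every u ∈ F₂ⁿ with H·u = 0, such that ε := ‖V‖_{κ₁} ≤ min(ε₀, 1/(3c₁)). Set ε_*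 := c₂·n·ε·exp(−κ₁·d_s/2). Then there exists a real number c_* such that every eigenvalue of H₀ + V − c_*·I lies in [−ε_*, ε_*] ∪ [1/2 + ε_*, ∞), and exactly 2^k eigenvalues, counted with multiplicity, lie in [−ε_*, ε_*]. -/

import Mathlib

open Classical

noncomputable section

/-- Vectors over `F₂` indexed by the `n` qubits. -/
abbrev F2vec (n : ℕ) := Fin n → ZMod 2

/-- Support of a Pauli operator `(x, z)` on `n` qubits. -/
def pSupp {n : ℕ} (p : F2vec n × F2vec n) : Finset (Fin n) :=
  Finset.univ.filter fun i => p.1 i ≠ 0 ∨ p.2 i ≠ 0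

/-- Weight of a Pauli operator. -/
def pWeight {n : ℕ} (p : F2vec n × F2vec n) : ℕ := (pSupp p).card

/-- Symplectic form deciding (anti)commutation of two Pauli operators. -/
def sympl {n : ℕ} (p q : F2vec n × F2vec n) : ZMod 2 :=
  ∑ i, (p.1 i * q.2 i + q.1 i * p.2 i)

/-- The (Hermitian unitary) Pauli matrix of `(x, z)`, acting on `ℂ^(2^n)` with basis
indexed by `F₂ⁿ`:  entry `(a, b)` equals `i^{|{i : xᵢ = zᵢ = 1}|}·(−1)^{Σᵢ zᵢbᵢ}` if
`a = b + x` and `0` otherwise. -/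
def pauli {n : ℕ} (p : F2vec n × F2vec n) : Matrix (F2vec n) (F2vec n) ℂ :=
  fun a b =>
    if a = b + p.1 then
      Complex.I ^ (Finset.univ.filter fun i => p.1 i = 1 ∧ p.2 i = 1).card *
        (-1 : ℂ) ^ (∑ i, (p.2 i).val * (b i).val)
    else 0

/-- The `ℓ² → ℓ²` operator norm of a matrix acting on the `n`-qubit Hilbert space. -/
def opNorm {n : ℕ} (M : Matrix (F2vec n) (F2vec n) ℂ) : ℝ :=
  ‖Matrix.toEuclideanCLM (𝕜 := ℂ) M‖

/-- The syndrome of a Pauli operator: the set of checks that anticommute with it. -/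
def syndrome {n m : ℕ} (C : Fin m → F2vec n × F2vec n) (p : F2vec n × F2vec n) :
    Finset (Fin m) :=
  Finset.univ.filter fun j => sympl p (C j) = 1

/-- A matrix is strongly supported in `S` with syndrome `s`: it is a `ℂ`-linear
combination of Pauli matrices with support inside `S` and syndrome `s`, and every check
in `s` has support inside `S`. -/
def StronglySupported {n m : ℕ} (C : Fin m → F2vec n × F2vec n)
    (M : Matrix (F2vec n) (F2vec n) ℂ) (S : Finset (Fin n)) (s : Finset (Fin m)) : Prop :=
  M ∈ Submodule.span ℂ
      {A : Matrix (F2vec n) (F2vec n) ℂ |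
        ∃ p : F2vec n × F2vec n, A = pauli p ∧ pSupp p ⊆ S ∧ syndrome C p = s} ∧
    ∀ j ∈ s, pSupp (C j) ⊆ S

/-- The `κ`-norm (local strength) of a presentation `S, s ↦ V_{S,s}`:
`max_i Σ_{S ∋ i} Σ_s ‖V_{S,s}‖·e^{κ|S|}`. -/
def kappaNorm {n m : ℕ}
    (VF : Finset (Fin n) → Finset (Fin m) → Matrix (F2vec n) (F2vec n) ℂ) (κ : ℝ) : ℝ :=
  ⨆ i : Fin n, ∑ S ∈ Finset.univ.filter (fun S : Finset (Fin n) => i ∈ S),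
    ∑ s : Finset (Fin m), opNorm (VF S s) * Real.exp (κ * S.card)

/-- The code graph: two distinct qubits are adjacent iff some check acts on both. -/
def codeGraph {n m : ℕ} (C : Fin m → F2vec n × F2vec n) : SimpleGraph (Fin n) :=
  SimpleGraph.fromRel fun i j => ∃ k : Fin m, i ∈ pSupp (C k) ∧ j ∈ pSupp (C k)

/-- Ball of radius `r` around `i` in the code graph (unreachable vertices are at
infinite distance, hence excluded). -/
def gBall {n : ℕ} (G : SimpleGraph (Fin n)) (i : Fin n) (r : ℕ) : Finset (Fin n) :=
  Finset.univ.filter fun j => G.Reachable i j ∧ G.dist i j ≤ r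

/-- `γ(r)`: the maximal surface volume of balls of radius `r` (with `γ(0) = 1`). -/
def gammaMax {n : ℕ} (G : SimpleGraph (Fin n)) (r : ℕ) : ℕ :=
  if r = 0 then 1
  else Finset.univ.sup fun i : Fin n => (gBall G i r).card - (gBall G i (r - 1)).card

/-- A Pauli operator is a logical operator of the code: it commutes with all checks but
is not a product (F₂-sum) of checks. -/
def IsLogical {n m : ℕ} (C : Fin m → F2vec n × F2vec n) (p : F2vec n × F2vec n) : Prop :=
  (∀ j : Fin m, sympl p (C j) = 0) ∧ ¬∃ T : Finset (Fin m), p = ∑ j ∈ T, C j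

/-- The recursively defined radius function `f̃`: `f̃(1) = f⁻¹(1)` and
`f̃(r+1) = f⁻¹( f(f̃(r)) + min(cutoff, f̃(r))/Δ )`. -/
def ftilde (f finv : ℝ → ℝ) (cutoff Δ : ℝ) : ℕ → ℝ
  | 0 => finv 1
  | 1 => finv 1
  | (r + 2) => finv (f (ftilde f finv cutoff Δ (r + 1))
      + min cutoff (ftilde f finv cutoff Δ (r + 1)) / Δ)

/-- The summability condition with constants `(c'_f, c''_f, α)`: for every `δκ > 0`,
every partial sum of `Σ_{r ≥ 1, f̃(r) < d_s} γ(r)·e^{−δκ·f̃(r)}` is at most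
`c''_f·e^{c'_f·δκ^{−α}}`. -/
def SummabilityCondition {n : ℕ} (G : SimpleGraph (Fin n)) (f finv : ℝ → ℝ)
    (ds Δ c'f c''f α : ℝ) : Prop :=
  ∀ δκ : ℝ, 0 < δκ → ∀ R : ℕ,
    (∑ r ∈ Finset.Icc 1 R,
      if ftilde f finv ds Δ r < ds then
        (gammaMax G r : ℝ) * Real.exp (-(δκ * ftilde f finv ds Δ r))
      else 0)
    ≤ c''f * Real.exp (c'f * δκ ^ (-α))

/-- Hamming weight of an `F₂`-vector. -/
def hamWt {n : ℕ} (v : F2vec n) : ℕ := (Finset.univ.filter fun i => v i ≠ 0).card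

section BanachAlgebra

variable {𝔸 : Type*} [NormedRing 𝔸] [NormOneClass 𝔸] [NormedAlgebra ℂ 𝔸] [CompleteSpace 𝔸]

/-- Tails of the exponential series are dominated by those of the real exponential. -/
theorem norm_exp_sub_partial_le (x : 𝔸) (k : ℕ) :
    ‖NormedSpace.exp x - ∑ m ∈ Finset.range k, ((m.factorial : ℂ)⁻¹) • x ^ m‖
      ≤ Real.exp ‖x‖ - ∑ m ∈ Finset.range k, ((m.factorial : ℝ)⁻¹) * ‖x‖ ^ m := by
  have h1 := (hasSum_nat_add_iff' k).2 (NormedSpace.exp_series_hasSum_exp' (𝕂 := ℂ) x)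
  have h2 : HasSum (fun m : ℕ => ((m.factorial : ℝ)⁻¹) * ‖x‖ ^ m) (Real.exp ‖x‖) := by
    have := NormedSpace.exp_series_hasSum_exp' (𝕂 := ℝ) ‖x‖
    rw [← Real.exp_eq_exp_ℝ] at this
    simpa using this
  have h3 := (hasSum_nat_add_iff' k).2 h2
  rw [← h1.tsum_eq, ← h3.tsum_eq]
  refine tsum_of_norm_bounded h3.summable.hasSum fun m => ?_
  rw [norm_smul]
  gcongr
  · simp
  · exact norm_pow_le _ _

theorem norm_exp_le_exp_norm (x : 𝔸) : ‖NormedSpace.exp x‖ ≤ Real.exp ‖x‖ := by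
  simpa using norm_exp_sub_partial_le x 0

theorem norm_exp_sub_one_le_exp_norm (x : 𝔸) :
    ‖NormedSpace.exp x - 1‖ ≤ Real.exp ‖x‖ - 1 := by
  simpa using norm_exp_sub_partial_le x 1

theorem norm_exp_sub_one_sub_le_exp_norm (x : 𝔸) :
    ‖NormedSpace.exp x - 1 - x‖ ≤ Real.exp ‖x‖ - 1 - ‖x‖ := by
  have := norm_exp_sub_partial_le x 2
  simpa [Finset.sum_range_succ, sub_sub] using this

/-- Adding a commuting part to the generator of a conjugation. -/
theorem norm_exp_conj_sub_le {B B' : 𝔸} (h : Commute B B') (M : 𝔸) :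
    ‖NormedSpace.exp (B' + B) * M * NormedSpace.exp (-(B' + B))
        - NormedSpace.exp B' * M * NormedSpace.exp (-B')‖
      ≤ ‖M‖ * (2 * ‖B‖) * Real.exp (2 * (‖B'‖ + ‖B‖)) := by
  let +nondep : NormedAlgebra ℚ 𝔸 := NormedAlgebra.restrictScalars ℚ ℂ 𝔸
  have e1 : NormedSpace.exp (B' + B) = NormedSpace.exp B' * NormedSpace.exp B :=
    NormedSpace.exp_add_of_commute h.symm
  have e2 : NormedSpace.exp (-(B' + B)) = NormedSpace.exp (-B) * NormedSpace.exp (-B') := by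
    rw [neg_add_rev]
    exact NormedSpace.exp_add_of_commute h.neg_left.neg_right
  have key : NormedSpace.exp (B' + B) * M * NormedSpace.exp (-(B' + B))
        - NormedSpace.exp B' * M * NormedSpace.exp (-B')
      = NormedSpace.exp B' * ((NormedSpace.exp B - 1) * M * NormedSpace.exp (-B)
          + M * (NormedSpace.exp (-B) - 1)) * NormedSpace.exp (-B') := by
    rw [e1, e2]; noncomm_ring
  rw [key]
  set b := ‖B‖
  set b' := ‖B'‖
  have hb : 0 ≤ b := norm_nonneg _
  have n1 := norm_exp_sub_one_le_exp_norm B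
  have n2 := norm_exp_sub_one_le_exp_norm (-B)
  have n3 := norm_exp_le_exp_norm (-B)
  have n4 := norm_exp_le_exp_norm B'
  have n5 := norm_exp_le_exp_norm (-B')
  rw [norm_neg] at n2 n3 n5
  have m1 : ‖(NormedSpace.exp B - 1) * M * NormedSpace.exp (-B)
          + M * (NormedSpace.exp (-B) - 1)‖ ≤ ‖M‖ * (Real.exp (2 * b) - 1) := by
    have e0 : (0 : ℝ) ≤ Real.exp b - 1 := by linarith [Real.add_one_le_exp b]
    calc _ ≤ ‖(NormedSpace.exp B - 1) * M * NormedSpace.exp (-B)‖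
          + ‖M * (NormedSpace.exp (-B) - 1)‖ := norm_add_le _ _
      _ ≤ (Real.exp b - 1) * ‖M‖ * Real.exp b + ‖M‖ * (Real.exp b - 1) := by
          gcongr
          · exact (norm_mul₃_le).trans (by gcongr)
          · exact (norm_mul_le _ _).trans (by gcongr)
      _ = ‖M‖ * (Real.exp (2 * b) - 1) := by
          rw [two_mul, Real.exp_add]; ring
  have m2 : Real.exp (2 * b) - 1 ≤ 2 * b * Real.exp (2 * b) := by
    have := Real.add_one_le_exp (-(2 * b))
    have h3 : Real.exp (-(2 * b)) * Real.exp (2 * b) = 1 := by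
      rw [← Real.exp_add]; simp
    nlinarith [Real.exp_pos (2 * b)]
  calc _ ≤ Real.exp b' * (‖M‖ * (2 * b * Real.exp (2 * b))) * Real.exp b' := by
        refine (norm_mul₃_le).trans ?_
        gcongr
        exact m1.trans (by gcongr)
    _ = _ := by
        rw [mul_add, Real.exp_add, show 2 * b' = b' + b' by ring, Real.exp_add]; ring

/-- The nonlinear part `(1 - exp (-2T))/2 - T`. -/
def expRemainder (T : 𝔸) : 𝔸 :=
  (2⁻¹ : ℂ) • (1 - NormedSpace.exp (-((2 : ℂ) • T))) - T

theorem norm_expRemainder_sub_le {B B' : 𝔸} (h : Commute B B') (hle : ‖B'‖ + ‖B‖ ≤ 1 / 2) :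
    ‖expRemainder (B' + B) - expRemainder B'‖ ≤ 8 * ‖B‖ * (‖B'‖ + ‖B‖) := by
  set b := ‖B‖ with hbdef
  set b' := ‖B'‖ with hbdef'
  have hb : 0 ≤ b := norm_nonneg _
  have hb' : 0 ≤ b' := norm_nonneg _
  let +nondep : NormedAlgebra ℚ 𝔸 := NormedAlgebra.restrictScalars ℚ ℂ 𝔸
  have e1 : NormedSpace.exp (-((2 : ℂ) • (B' + B)))
      = NormedSpace.exp (-((2 : ℂ) • B')) * NormedSpace.exp (-((2 : ℂ) • B)) := by
    rw [smul_add, neg_add]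
    exact NormedSpace.exp_add_of_commute
      ((h.symm.smul_left _).smul_right _).neg_left.neg_right
  have key : expRemainder (B' + B) - expRemainder B'
      = (2⁻¹ : ℂ) • (-((NormedSpace.exp (-((2 : ℂ) • B')) - 1)
          * (NormedSpace.exp (-((2 : ℂ) • B)) - 1))
          - (NormedSpace.exp (-((2 : ℂ) • B)) - 1 - (-((2 : ℂ) • B)))) := by
    have : B = (2⁻¹ : ℂ) • ((2 : ℂ) • B) := by rw [smul_smul]; norm_num
    unfold expRemainder
    rw [e1]
    generalize NormedSpace.exp (-((2 : ℂ) • B')) = P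
    generalize NormedSpace.exp (-((2 : ℂ) • B)) = Q
    have h2 : (1 - P * Q) - (1 - P) - (2 : ℂ) • B
        = -((P - 1) * (Q - 1)) - (Q - 1 - (-((2 : ℂ) • B))) := by
      noncomm_ring
    rw [← h2, smul_sub (2⁻¹ : ℂ) (1 - P * Q - (1 - P)), ← this, smul_sub _ (1 - P * Q) (1 - P)]
    abel
  have nb : ‖-((2 : ℂ) • B)‖ = 2 * b := by rw [norm_neg, norm_smul]; simp [hbdef]
  have nb' : ‖-((2 : ℂ) • B')‖ = 2 * b' := by rw [norm_neg, norm_smul]; simp [hbdef']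
  have n1 := norm_exp_sub_one_le_exp_norm (-((2 : ℂ) • B'))
  have n2 := norm_exp_sub_one_le_exp_norm (-((2 : ℂ) • B))
  have n3 := norm_exp_sub_one_sub_le_exp_norm (-((2 : ℂ) • B))
  rw [nb] at n2 n3
  rw [nb'] at n1
  have q1 := Real.norm_exp_sub_one_sub_id_le (x := 2 * b)
    (by rw [Real.norm_of_nonneg] <;> linarith)
  have q2 := Real.norm_exp_sub_one_sub_id_le (x := 2 * b')
    (by rw [Real.norm_of_nonneg] <;> linarith)
  have q1 := (Real.le_norm_self _).trans q1
  have q2 := (Real.le_norm_self _).trans q2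
  rw [Real.norm_of_nonneg (by positivity)] at q1 q2
  have r1 : Real.exp (2 * b) - 1 ≤ 4 * b := by nlinarith
  have r2 : Real.exp (2 * b') - 1 ≤ 4 * b' := by nlinarith
  rw [key, norm_smul]
  calc _ ≤ (1 / 2) * ((4 * b') * (4 * b) + (2 * b) ^ 2) := by
        have : ‖(2⁻¹ : ℂ)‖ = 1 / 2 := by norm_num
        rw [this]
        gcongr
        refine (norm_sub_le _ _).trans ?_
        rw [norm_neg]
        gcongr
        · exact (norm_mul_le _ _).trans
            (mul_le_mul (n1.trans r2) (n2.trans r1) (norm_nonneg _) (by positivity))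
        · exact n3.trans q1
    _ ≤ _ := by nlinarith [mul_nonneg hb hb']

end BanachAlgebra

/-- A holomorphic self-map of a ball whose image is well inside the ball has a fixed point. -/
theorem exists_fixedPoint_of_norm_le {E : Type*} [NormedAddCommGroup E] [NormedSpace ℂ E]
    [CompleteSpace E] {F : E → E} (hF : Differentiable ℂ F) {ρ : ℝ} (hρ : 0 < ρ)
    (hb : ∀ r, ‖r‖ ≤ ρ → ‖F r‖ ≤ ρ / 4) : ∃ r, ‖r‖ ≤ ρ ∧ F r = r := by
  set K : Set E := Metric.closedBall 0 (ρ / 4)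
  have hmaps : Set.MapsTo F K K := fun r hr => by
    simp only [K, mem_closedBall_zero_iff] at hr ⊢
    exact hb r (by linarith)
  have hcontr : ContractingWith (2 / 3) (hmaps.restrict F K K) := by
    refine ⟨by rw [← NNReal.coe_lt_coe]; norm_num, LipschitzWith.of_dist_le_mul ?_⟩
    rintro ⟨z, hz⟩ ⟨r, hr⟩
    simp only [K, mem_closedBall_zero_iff] at hr hz
    have hzr : z ∈ Metric.ball r (3 * ρ / 4) := by
      rw [mem_ball_iff_norm]
      have := norm_sub_le z r
      linarith
    have hm : Set.MapsTo F (Metric.ball r (3 * ρ / 4)) (Metric.closedBall (F r) (ρ / 2)) := by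
      intro y hy
      rw [mem_ball_iff_norm] at hy
      have h1 : ‖y‖ ≤ ρ := by
        have := norm_add_le (y - r) r
        rw [sub_add_cancel] at this
        linarith
      rw [mem_closedBall_iff_norm]
      have := norm_sub_le (F y) (F r)
      have := hb y h1
      have := hb r (by linarith)
      linarith
    have := Complex.dist_le_div_mul_dist_of_mapsTo_ball hF.differentiableOn hm hzr
    have e : ρ / 2 / (3 * ρ / 4) = 2 / 3 := by field_simp; norm_num
    rw [e] at this
    exact this
  obtain ⟨r, hr, hfix, -⟩ := hcontr.exists_fixedPoint'
    (Metric.isClosed_closedBall.isComplete) hmaps (x := 0) (by simp [K]; linarith)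
    (edist_ne_top _ _)
  refine ⟨r, ?_, hfix⟩
  simp only [K, mem_closedBall_zero_iff] at hr
  linarith

section WeightedRows

open scoped Matrix.Norms.Operator
open Matrix

variable {n : ℕ}

theorem F2vec.add_self (a : F2vec n) : a + a = 0 := by
  ext i; exact CharTwo.add_self_eq_zero _

theorem F2vec.add_add_cancel (a b : F2vec n) : a + (a + b) = b := by
  rw [← add_assoc, F2vec.add_self, zero_add]

theorem F2vec.eq_add_comm {a b y : F2vec n} : a = b + y ↔ b = a + y := by
  constructor <;> rintro rfl <;> rw [add_assoc, F2vec.add_self, add_zero]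

/-- Submultiplicative weights on the group of bit strings. -/
structure IsWeight (w : F2vec n → ℝ) : Prop where
  map_zero : w 0 = 1
  one_le : ∀ a, 1 ≤ w a
  add_le : ∀ a b, w (a + b) ≤ w a * w b

theorem IsWeight.pos {w : F2vec n → ℝ} (hw : IsWeight w) (a : F2vec n) : 0 < w a :=
  zero_lt_one.trans_le (hw.one_le a)

/-- Convolution by `g` on functions of bit strings. -/
def convMatrix (g : F2vec n → ℂ) : Matrix (F2vec n) (F2vec n) ℂ := fun a b => g (a + b)

/-- The matrix sending `|b⟩` to `v b |b + y⟩`. -/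
def hopMatrix (y : F2vec n) (v : F2vec n → ℂ) : Matrix (F2vec n) (F2vec n) ℂ :=
  fun a b => if a = b + y then v b else 0

/-- The restriction of a function to the points satisfying a predicate. -/
def restrictTo (p : F2vec n → Prop) (g : F2vec n → ℂ) : F2vec n → ℂ :=
  fun x => if p x then g x else 0

/-- The weighted `ℓ¹` norm of a function. -/
def wSum (w : F2vec n → ℝ) (g : F2vec n → ℂ) : ℝ := ∑ x, ‖g x‖ * w x

theorem wSum_nonneg {w : F2vec n → ℝ} (hw : IsWeight w) (g : F2vec n → ℂ) : 0 ≤ wSum w g :=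
  Finset.sum_nonneg fun x _ => mul_nonneg (norm_nonneg _) (hw.pos x).le

theorem wSum_restrictTo (w : F2vec n → ℝ) (p : F2vec n → Prop) (g : F2vec n → ℂ) :
    wSum w (restrictTo p g) = ∑ x with p x, ‖g x‖ * w x := by
  unfold wSum restrictTo
  rw [Finset.sum_filter]
  refine Finset.sum_congr rfl fun x _ => ?_
  split_ifs <;> simp

theorem restrictTo_add_not (p : F2vec n → Prop) (g : F2vec n → ℂ) :
    restrictTo (fun x => ¬ p x) g + restrictTo p g = g := by
  ext x; simp only [Pi.add_apply, restrictTo]; split_ifs <;> simp_all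

theorem wSum_restrictTo_not_add (w : F2vec n → ℝ) (p : F2vec n → Prop) (g : F2vec n → ℂ) :
    wSum w (restrictTo (fun x => ¬ p x) g) + wSum w (restrictTo p g) = wSum w g := by
  unfold wSum restrictTo
  rw [← Finset.sum_add_distrib]
  refine Finset.sum_congr rfl fun x _ => ?_
  by_cases h : p x <;> simp [h]

theorem convMatrix_add (g h : F2vec n → ℂ) :
    convMatrix (g + h) = convMatrix g + convMatrix h := rfl

theorem convMatrix_commute (g h : F2vec n → ℂ) : Commute (convMatrix g) (convMatrix h) := by
  ext a b
  simp only [Matrix.mul_apply, convMatrix]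
  refine Fintype.sum_equiv (Equiv.addLeft (a + b)) _ _ fun c => ?_
  have h1 : a + (a + b + c) = c + b := by
    rw [add_assoc, F2vec.add_add_cancel, add_comm]
  have h2 : a + b + c + b = a + c := by
    rw [add_assoc a, add_comm a, add_assoc, add_comm b c, add_assoc, add_comm a b]
    rw [← add_assoc b b a, F2vec.add_self, zero_add, add_comm]
  simp only [Equiv.coe_addLeft]
  rw [h1, h2, mul_comm]

/-- Conjugation of a matrix by the diagonal matrix of weights. -/
def wConj (w : F2vec n → ℝ) (T : Matrix (F2vec n) (F2vec n) ℂ) :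
    Matrix (F2vec n) (F2vec n) ℂ :=
  diagonal (fun a => ((w a : ℂ))⁻¹) * T * diagonal (fun a => (w a : ℂ))

theorem wConj_apply (w : F2vec n → ℝ) (T : Matrix (F2vec n) (F2vec n) ℂ) (a b : F2vec n) :
    wConj w T a b = (w a : ℂ)⁻¹ * T a b * w b := by
  simp [wConj]

theorem wConj_add (w : F2vec n → ℝ) (T U : Matrix (F2vec n) (F2vec n) ℂ) :
    wConj w (T + U) = wConj w T + wConj w U := by
  simp only [wConj, Matrix.mul_add, Matrix.add_mul]

theorem wConj_neg (w : F2vec n → ℝ) (T : Matrix (F2vec n) (F2vec n) ℂ) :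
    wConj w (-T) = -wConj w T := by
  simp only [wConj, Matrix.mul_neg, Matrix.neg_mul]

theorem wConj_sub (w : F2vec n → ℝ) (T U : Matrix (F2vec n) (F2vec n) ℂ) :
    wConj w (T - U) = wConj w T - wConj w U := by
  simp only [wConj, Matrix.mul_sub, Matrix.sub_mul]

theorem wConj_smul (w : F2vec n → ℝ) (c : ℂ) (T : Matrix (F2vec n) (F2vec n) ℂ) :
    wConj w (c • T) = c • wConj w T := by
  simp only [wConj, Matrix.mul_smul, Matrix.smul_mul]

theorem IsWeight.diagonal_mul {w : F2vec n → ℝ} (hw : IsWeight w) :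
    diagonal (fun a => (w a : ℂ)) * diagonal (fun a => ((w a : ℂ))⁻¹) = 1 := by
  rw [diagonal_mul_diagonal, ← diagonal_one]
  congr 1; ext a
  exact mul_inv_cancel₀ (by exact_mod_cast (hw.pos a).ne')

theorem IsWeight.diagonal_mul' {w : F2vec n → ℝ} (hw : IsWeight w) :
    diagonal (fun a => ((w a : ℂ))⁻¹) * diagonal (fun a => (w a : ℂ)) = 1 := by
  rw [diagonal_mul_diagonal, ← diagonal_one]
  congr 1; ext a
  exact inv_mul_cancel₀ (by exact_mod_cast (hw.pos a).ne')

theorem wConj_one {w : F2vec n → ℝ} (hw : IsWeight w) : wConj w 1 = 1 := by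
  rw [wConj, Matrix.mul_one, hw.diagonal_mul']

theorem wConj_mul {w : F2vec n → ℝ} (hw : IsWeight w) (T U : Matrix (F2vec n) (F2vec n) ℂ) :
    wConj w (T * U) = wConj w T * wConj w U := by
  unfold wConj
  simp only [Matrix.mul_assoc]
  rw [← Matrix.mul_assoc (diagonal fun a => (w a : ℂ)), hw.diagonal_mul, Matrix.one_mul]

theorem wConj_exp {w : F2vec n → ℝ} (hw : IsWeight w) (T : Matrix (F2vec n) (F2vec n) ℂ) :
    wConj w (NormedSpace.exp T) = NormedSpace.exp (wConj w T) :=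
  (Matrix.exp_units_conj' ⟨_, _, hw.diagonal_mul, hw.diagonal_mul'⟩ T).symm

theorem expRemainder_matrix (T : Matrix (F2vec n) (F2vec n) ℂ) :
    expRemainder T = (2⁻¹ : ℂ) • (1 - NormedSpace.exp (-((2 : ℂ) • T))) - T := rfl

theorem wConj_expRemainder {w : F2vec n → ℝ} (hw : IsWeight w)
    (T : Matrix (F2vec n) (F2vec n) ℂ) :
    wConj w (expRemainder T) = expRemainder (wConj w T) := by
  have h := wConj_exp hw (-((2 : ℂ) • T))
  rw [wConj_neg, wConj_smul] at h
  simp only [expRemainder_matrix, wConj_sub, wConj_smul, wConj_one hw, h]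

theorem sum_row_zero_le {w : F2vec n → ℝ} (hw : IsWeight w)
    (T : Matrix (F2vec n) (F2vec n) ℂ) : ∑ b, ‖T 0 b‖ * w b ≤ ‖wConj w T‖ := by
  rw [Matrix.linfty_opNorm_def]
  have h := Finset.le_sup (f := fun i => ∑ j, ‖wConj w T i j‖₊) (Finset.mem_univ (0 : F2vec n))
  refine le_trans (le_of_eq ?_) (NNReal.coe_le_coe.2 h)
  push_cast
  refine Finset.sum_congr rfl fun b _ => ?_
  rw [wConj_apply, hw.map_zero]
  simp [abs_of_pos (hw.pos b)]

theorem norm_wConj_le {w : F2vec n → ℝ} (hw : IsWeight w)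
    {T : Matrix (F2vec n) (F2vec n) ℂ} {c : ℝ} (hc : 0 ≤ c)
    (h : ∀ a, ∑ b, ‖T a b‖ * w b ≤ c * w a) : ‖wConj w T‖ ≤ c := by
  rw [Matrix.linfty_opNorm_def]
  lift c to NNReal using hc
  refine NNReal.coe_le_coe.2 (Finset.sup_le fun a _ => ?_)
  rw [← NNReal.coe_le_coe]
  push_cast
  have : ∑ b, ‖wConj w T a b‖ = (w a)⁻¹ * ∑ b, ‖T a b‖ * w b := by
    rw [Finset.mul_sum]
    refine Finset.sum_congr rfl fun b _ => ?_
    rw [wConj_apply]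
    simp [abs_of_pos (hw.pos b), abs_of_pos (hw.pos a), mul_assoc]
  rw [this, inv_mul_le_iff₀ (hw.pos a), mul_comm]
  exact h a

theorem norm_wConj_convMatrix_le {w : F2vec n → ℝ} (hw : IsWeight w) (g : F2vec n → ℂ) :
    ‖wConj w (convMatrix g)‖ ≤ wSum w g := by
  refine norm_wConj_le hw (wSum_nonneg hw g) fun a => ?_
  rw [wSum, Finset.sum_mul]
  rw [← Equiv.sum_comp (Equiv.addLeft a)]
  refine Finset.sum_le_sum fun x _ => ?_
  simp only [convMatrix, Equiv.coe_addLeft, F2vec.add_add_cancel]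
  rw [mul_assoc]
  gcongr
  rw [mul_comm]; exact hw.add_le a x

theorem norm_wConj_hopMatrix_le {w : F2vec n → ℝ} (hw : IsWeight w) (y : F2vec n)
    {v : F2vec n → ℂ} {β : ℝ} (hv : ∀ b, ‖v b‖ ≤ β) :
    ‖wConj w (hopMatrix y v)‖ ≤ β * w y := by
  have hβ : 0 ≤ β := (norm_nonneg _).trans (hv 0)
  refine norm_wConj_le hw (mul_nonneg hβ (hw.pos y).le) fun a => ?_
  rw [Finset.sum_eq_single (a + y)]
  · have : a = a + y + y := F2vec.eq_add_comm.1 rfl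
    simp only [hopMatrix]
    rw [if_pos this, mul_assoc, mul_comm (w y)]
    exact mul_le_mul (hv _) (hw.add_le a y) (hw.pos _).le hβ
  · intro b _ hb
    simp only [hopMatrix]
    rw [if_neg fun h => hb (F2vec.eq_add_comm.1 h)]; simp
  · simp

theorem zmod_two_eq (t : ZMod 2) : t = 0 ∨ t = 1 := by
  fin_cases t
  exacts [Or.inl rfl, Or.inr rfl]

/-- The sign character of `ZMod 2`. -/
def zsgn (t : ZMod 2) : ℂ := if t = 0 then 1 else -1

theorem zsgn_zero : zsgn 0 = 1 := by simp [zsgn]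

theorem zsgn_add (s t : ZMod 2) : zsgn (s + t) = zsgn s * zsgn t := by
  rcases zmod_two_eq s with rfl | rfl <;> rcases zmod_two_eq t with rfl | rfl <;>
    simp [zsgn, CharTwo.add_self_eq_zero]

theorem zsgn_mul_self (t : ZMod 2) : zsgn t * zsgn t = 1 := by
  unfold zsgn; split_ifs <;> norm_num

theorem zsgn_ne_zero {t : ZMod 2} (h : t ≠ 0) : zsgn t = -1 := by simp [zsgn, h]

/-- The diagonal matrix of signs of a linear functional. -/
def signMatrix (l : F2vec n →+ ZMod 2) : Matrix (F2vec n) (F2vec n) ℂ :=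
  diagonal fun b => zsgn (l b)

theorem signMatrix_mul_self (l : F2vec n →+ ZMod 2) : signMatrix l * signMatrix l = 1 := by
  simp [signMatrix, zsgn_mul_self]

theorem eq_zero_of_commute_signMatrix {l : F2vec n →+ ZMod 2}
    {T : Matrix (F2vec n) (F2vec n) ℂ} (h : Commute (signMatrix l) T) {b : F2vec n}
    (hb : l b ≠ 0) : T 0 b = 0 := by
  have := congrFun (congrFun h 0) b
  simp only [signMatrix, diagonal_mul, mul_diagonal, map_zero, zsgn_zero, zsgn_ne_zero hb] at this
  linear_combination this / 2

theorem signMatrix_commute_convMatrix (l : F2vec n →+ ZMod 2) {g : F2vec n → ℂ}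
    (hg : ∀ x, l x ≠ 0 → g x = 0) : Commute (signMatrix l) (convMatrix g) := by
  ext a b
  simp only [signMatrix, diagonal_mul, mul_diagonal, convMatrix]
  by_cases h : l (a + b) = 0
  · have : l a = l b := by
      rw [map_add] at h
      exact CharTwo.add_eq_zero.1 h
    rw [this, mul_comm]
  · rw [hg _ h]; simp

theorem signMatrix_conj_convMatrix (l : F2vec n →+ ZMod 2) {g : F2vec n → ℂ}
    (hg : ∀ x, l x = 0 → g x = 0) :
    signMatrix l * convMatrix g * signMatrix l = -convMatrix g := by
  ext a b
  simp only [signMatrix, diagonal_mul, mul_diagonal, convMatrix, Matrix.neg_apply]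
  by_cases h : l (a + b) = 0
  · rw [hg _ h]; simp
  · have h2 : zsgn (l a) * zsgn (l b) = -1 := by
      rw [← zsgn_add, ← map_add, zsgn_ne_zero h]
    linear_combination g (a + b) * h2

theorem signMatrix_commute_hopMatrix (l : F2vec n →+ ZMod 2) {y : F2vec n} (v : F2vec n → ℂ)
    (hy : l y = 0) : Commute (signMatrix l) (hopMatrix y v) := by
  ext a b
  simp only [signMatrix, diagonal_mul, mul_diagonal, hopMatrix]
  split_ifs with h
  · rw [h, map_add, hy, add_zero, mul_comm]
  · simp

/-- `exp (convMatrix g) * M * exp (-convMatrix g)`. -/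
def dressed (g : F2vec n → ℂ) (M : Matrix (F2vec n) (F2vec n) ℂ) :
    Matrix (F2vec n) (F2vec n) ℂ :=
  NormedSpace.exp (convMatrix g) * M * NormedSpace.exp (-convMatrix g)

theorem exp_mul_exp_neg' (A : Matrix (F2vec n) (F2vec n) ℂ) :
    NormedSpace.exp A * NormedSpace.exp (-A) = 1 := by
  rw [← Matrix.exp_add_of_commute _ _ (Commute.refl A).neg_right, add_neg_cancel,
    NormedSpace.exp_zero]

theorem dressed_one (g : F2vec n → ℂ) : dressed g 1 = 1 := by
  rw [dressed, mul_one, exp_mul_exp_neg']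

theorem dressed_add (g : F2vec n → ℂ) (T U : Matrix (F2vec n) (F2vec n) ℂ) :
    dressed g (T + U) = dressed g T + dressed g U := by
  simp only [dressed, mul_add, add_mul]

theorem dressed_sub (g : F2vec n → ℂ) (T U : Matrix (F2vec n) (F2vec n) ℂ) :
    dressed g (T - U) = dressed g T - dressed g U := by
  simp only [dressed, mul_sub, sub_mul]

theorem dressed_smul (g : F2vec n → ℂ) (c : ℂ) (T : Matrix (F2vec n) (F2vec n) ℂ) :
    dressed g (c • T) = c • dressed g T := by
  simp only [dressed, Matrix.mul_smul, Matrix.smul_mul]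

theorem dressed_sum (g : F2vec n → ℂ) {κ : Type*} (s : Finset κ)
    (T : κ → Matrix (F2vec n) (F2vec n) ℂ) :
    dressed g (∑ k ∈ s, T k) = ∑ k ∈ s, dressed g (T k) := by
  simp only [dressed, Finset.mul_sum, Finset.sum_mul]

theorem dressed_add_left (g h : F2vec n → ℂ) (M : Matrix (F2vec n) (F2vec n) ℂ) :
    dressed (g + h) M = dressed h (dressed g M) := by
  unfold dressed
  rw [convMatrix_add, neg_add, Matrix.exp_add_of_commute _ _
    (convMatrix_commute g h).neg_left.neg_right, add_comm, Matrix.exp_add_of_commute _ _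
    (convMatrix_commute h g)]
  simp only [mul_assoc]

theorem dressed_of_commute {g : F2vec n → ℂ} {M : Matrix (F2vec n) (F2vec n) ℂ}
    (h : Commute (convMatrix g) M) : dressed g M = M := by
  unfold dressed
  rw [(h.exp_left).eq, mul_assoc, exp_mul_exp_neg', mul_one]

/-- The shifts that change the amplitude of a hopping matrix. -/
def NearAmp (v : F2vec n → ℂ) (x : F2vec n) : Prop := ∃ b, v (b + x) ≠ v b

theorem dressed_hopMatrix (g : F2vec n → ℂ) (y : F2vec n) (v : F2vec n → ℂ) :
    dressed g (hopMatrix y v) = dressed (restrictTo (NearAmp v) g) (hopMatrix y v) := by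
  conv_lhs => rw [← restrictTo_add_not (NearAmp v) g, dressed_add_left]
  rw [dressed_of_commute (g := restrictTo (fun x => ¬ NearAmp v x) g)]
  ext a b
  simp only [Matrix.mul_apply, convMatrix, hopMatrix, mul_ite, ite_mul, mul_zero, zero_mul]
  rw [Finset.sum_ite_eq' Finset.univ (b + y)]
  have : ∀ c, (a = c + y) ↔ (c = a + y) := fun c => F2vec.eq_add_comm
  simp only [this, Finset.sum_ite_eq', Finset.mem_univ, if_true]
  have e : a + (b + y) = a + y + b := by abel
  rw [e, restrictTo]
  by_cases hn : NearAmp v (a + y + b)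
  · simp [hn]
  · have h1 := not_not.1 (not_exists.1 hn b)
    have h2 : b + (a + y + b) = a + y := by
      rw [add_comm (a + y) b, F2vec.add_add_cancel]
    rw [h2] at h1
    simp [hn, h1, mul_comm]

theorem dressed_signMatrix (g : F2vec n → ℂ) (l : F2vec n →+ ZMod 2) :
    dressed g (signMatrix l) = signMatrix l *
      NormedSpace.exp (-((2 : ℂ) • convMatrix (restrictTo (fun x => l x ≠ 0) g))) := by
  set A := convMatrix (restrictTo (fun x => l x ≠ 0) g) with hA
  conv_lhs => rw [← restrictTo_add_not (fun x => l x ≠ 0) g, dressed_add_left]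
  rw [dressed_of_commute (g := restrictTo (fun x => ¬ l x ≠ 0) g)
    (signMatrix_commute_convMatrix l fun x hx => by simp [restrictTo, hx]).symm]
  have h1 : NormedSpace.exp (-A) = signMatrix l * NormedSpace.exp A * signMatrix l := by
    rw [← signMatrix_conj_convMatrix l (g := restrictTo (fun x => l x ≠ 0) g)
      fun x hx => by simp [restrictTo, hx]]
    exact Matrix.exp_units_conj
      ⟨signMatrix l, signMatrix l, signMatrix_mul_self l, signMatrix_mul_self l⟩ A
  have h2 : NormedSpace.exp A * signMatrix l = signMatrix l * NormedSpace.exp (-A) := by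
    rw [h1, ← mul_assoc, ← mul_assoc, signMatrix_mul_self, one_mul]
  rw [dressed, ← hA, h2, mul_assoc, ← Matrix.exp_add_of_commute _ _ (Commute.refl _)]
  congr 2
  rw [two_smul, neg_add]

theorem sum_row_dressed_hopMatrix_le {w : F2vec n → ℝ} (hw : IsWeight w) (g : F2vec n → ℂ)
    (y : F2vec n) {v : F2vec n → ℂ} {β : ℝ} (hv : ∀ b, ‖v b‖ ≤ β) :
    ∑ b, ‖dressed g (hopMatrix y v) 0 b‖ * w b
      ≤ β * w y * Real.exp (2 * wSum w (restrictTo (NearAmp v) g)) := by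
  refine (sum_row_zero_le hw _).trans ?_
  rw [dressed_hopMatrix, dressed, wConj_mul hw, wConj_mul hw, wConj_exp hw, wConj_exp hw,
    wConj_neg]
  set A := convMatrix (restrictTo (NearAmp v) g)
  have hA := norm_wConj_convMatrix_le hw (restrictTo (NearAmp v) g)
  have h1 := norm_exp_le_exp_norm (wConj w A)
  have h2 := norm_exp_le_exp_norm (-wConj w A)
  rw [norm_neg] at h2
  have hE := Real.exp_le_exp.2 hA
  have h3 := norm_wConj_hopMatrix_le hw y hv
  set E := Real.exp (wSum w (restrictTo (NearAmp v) g)) with hEdef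
  calc _ ≤ E * (β * w y) * E := by
        refine norm_mul₃_le.trans ?_
        have hβ : 0 ≤ β * w y := (norm_nonneg _).trans h3
        exact mul_le_mul (mul_le_mul (h1.trans hE) h3 (norm_nonneg _) (Real.exp_pos _).le)
          (h2.trans hE) (norm_nonneg _) (mul_nonneg (Real.exp_pos _).le hβ)
    _ = _ := by rw [two_mul, Real.exp_add]; ring

/-- Rooted version: only the columns on which `l` does not vanish are counted. -/
theorem sum_root_dressed_hopMatrix_le {w : F2vec n → ℝ} (hw : IsWeight w) (g : F2vec n → ℂ)
    (l : F2vec n →+ ZMod 2) {y : F2vec n} (hy : l y = 0) {v : F2vec n → ℂ} {β : ℝ}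
    (hv : ∀ b, ‖v b‖ ≤ β) :
    ∑ b with l b ≠ 0, ‖dressed g (hopMatrix y v) 0 b‖ * w b
      ≤ β * w y * (2 * wSum w (restrictTo (fun x => l x ≠ 0) (restrictTo (NearAmp v) g)))
        * Real.exp (2 * wSum w (restrictTo (NearAmp v) g)) := by
  rw [dressed_hopMatrix]
  set f := restrictTo (NearAmp v) g
  set f1 := restrictTo (fun x => l x ≠ 0) f
  set f0 := restrictTo (fun x => ¬ l x ≠ 0) f
  have hf : f0 + f1 = f := restrictTo_add_not _ _
  have hsum : wSum w f0 + wSum w f1 = wSum w f := wSum_restrictTo_not_add w _ _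
  have hcomm : Commute (signMatrix l) (convMatrix f0) :=
    signMatrix_commute_convMatrix l fun x hx => by simp [f0, restrictTo, hx]
  have hzero : ∀ b, l b ≠ 0 → dressed f0 (hopMatrix y v) 0 b = 0 := fun b hb =>
    eq_zero_of_commute_signMatrix ((hcomm.exp_right.mul_right
      (signMatrix_commute_hopMatrix l v hy)).mul_right hcomm.neg_right.exp_right) hb
  calc _ = ∑ b with l b ≠ 0,
        ‖(dressed f (hopMatrix y v) - dressed f0 (hopMatrix y v)) 0 b‖ * w b := by
        refine Finset.sum_congr rfl fun b hb => ?_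
        rw [Matrix.sub_apply, hzero b (Finset.mem_filter.1 hb).2, sub_zero]
    _ ≤ ∑ b, ‖(dressed f (hopMatrix y v) - dressed f0 (hopMatrix y v)) 0 b‖ * w b :=
        Finset.sum_le_sum_of_subset_of_nonneg (Finset.filter_subset _ _)
          fun b _ _ => mul_nonneg (norm_nonneg _) (hw.pos b).le
    _ ≤ ‖wConj w (dressed f (hopMatrix y v) - dressed f0 (hopMatrix y v))‖ :=
        sum_row_zero_le hw _
    _ ≤ ‖wConj w (hopMatrix y v)‖ * (2 * ‖wConj w (convMatrix f1)‖)
          * Real.exp (2 * (‖wConj w (convMatrix f0)‖ + ‖wConj w (convMatrix f1)‖)) := by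
        rw [wConj_sub, ← hf]
        unfold dressed
        simp only [wConj_mul hw, wConj_exp hw, wConj_neg, convMatrix_add, wConj_add]
        refine norm_exp_conj_sub_le ?_ _
        rw [Commute, SemiconjBy, ← wConj_mul hw, ← wConj_mul hw, (convMatrix_commute f1 f0).eq]
    _ ≤ _ := by
        rw [← hsum]
        have h1 := norm_wConj_convMatrix_le hw f0
        have h2 := norm_wConj_convMatrix_le hw f1
        have h3 := norm_wConj_hopMatrix_le hw y hv
        have : 0 ≤ β * w y := (norm_nonneg _).trans h3
        have := wSum_nonneg hw f1
        gcongr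

/-- Rooted bound for the nonlinear remainder of a dressed check. -/
theorem sum_root_expRemainder_le {w : F2vec n → ℝ} (hw : IsWeight w) (f : F2vec n → ℂ)
    (l : F2vec n →+ ZMod 2) (hle : wSum w f ≤ 1 / 2) :
    ∑ b with l b ≠ 0, ‖expRemainder (convMatrix f) 0 b‖ * w b
      ≤ 8 * wSum w (restrictTo (fun x => l x ≠ 0) f) * wSum w f := by
  set f1 := restrictTo (fun x => l x ≠ 0) f
  set f0 := restrictTo (fun x => ¬ l x ≠ 0) f
  have hf : f0 + f1 = f := restrictTo_add_not _ _
  have hsum : wSum w f0 + wSum w f1 = wSum w f := wSum_restrictTo_not_add w _ _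
  have hcomm : Commute (signMatrix l) (convMatrix f0) :=
    signMatrix_commute_convMatrix l fun x hx => by simp [f0, restrictTo, hx]
  have hzero : ∀ b, l b ≠ 0 → expRemainder (convMatrix f0) 0 b = 0 := fun b hb =>
    eq_zero_of_commute_signMatrix (((((Commute.one_right _).sub_right
      (hcomm.smul_right _).neg_right.exp_right).smul_right _).sub_right hcomm)) hb
  have h1 := norm_wConj_convMatrix_le hw f0
  have h2 := norm_wConj_convMatrix_le hw f1
  calc _ = ∑ b with l b ≠ 0,
        ‖(expRemainder (convMatrix f) - expRemainder (convMatrix f0)) 0 b‖ * w b := by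
        refine Finset.sum_congr rfl fun b hb => ?_
        rw [Matrix.sub_apply, hzero b (Finset.mem_filter.1 hb).2, sub_zero]
    _ ≤ ∑ b, ‖(expRemainder (convMatrix f) - expRemainder (convMatrix f0)) 0 b‖ * w b :=
        Finset.sum_le_sum_of_subset_of_nonneg (Finset.filter_subset _ _)
          fun b _ _ => mul_nonneg (norm_nonneg _) (hw.pos b).le
    _ ≤ ‖wConj w (expRemainder (convMatrix f) - expRemainder (convMatrix f0))‖ :=
        sum_row_zero_le hw _
    _ ≤ 8 * ‖wConj w (convMatrix f1)‖ *
          (‖wConj w (convMatrix f0)‖ + ‖wConj w (convMatrix f1)‖) := by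
        rw [wConj_sub, ← hf, wConj_expRemainder hw, wConj_expRemainder hw, convMatrix_add,
          wConj_add]
        refine norm_expRemainder_sub_le ?_ (by linarith)
        rw [Commute, SemiconjBy, ← wConj_mul hw, ← wConj_mul hw, (convMatrix_commute f1 f0).eq]
    _ ≤ _ := by
        rw [← hsum]
        have := wSum_nonneg hw f1
        gcongr

end WeightedRows

section HopModels

open scoped Matrix.Norms.Operator
open Matrix

/-- A variant of the fixed point theorem in which the ball is measured through an injective
linear map. -/
theorem exists_fixedPoint_of_norm_map_le {E G : Type*} [NormedAddCommGroup E] [NormedSpace ℂ E]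
    [FiniteDimensional ℂ E] [NormedAddCommGroup G] [NormedSpace ℂ G] (Φ : E →ₗ[ℂ] G)
    (hΦ : Function.Injective Φ) {F : E → E} (hF : Differentiable ℂ F) {ρ : ℝ} (hρ : 0 < ρ)
    (hb : ∀ r, ‖Φ r‖ ≤ ρ → ‖Φ (F r)‖ ≤ ρ / 4) : ∃ r, ‖Φ r‖ ≤ ρ ∧ F r = r := by
  set ψ := LinearEquiv.ofInjective Φ hΦ
  haveI : FiniteDimensional ℂ (LinearMap.range Φ) := ψ.finiteDimensional
  haveI : CompleteSpace (LinearMap.range Φ) := FiniteDimensional.complete ℂ _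
  have hψ : ∀ z : LinearMap.range Φ, Φ (ψ.symm z) = z := fun z =>
    congrArg Subtype.val (ψ.apply_symm_apply z)
  obtain ⟨z, hz, hfix⟩ := exists_fixedPoint_of_norm_le (F := fun z => ψ (F (ψ.symm z)))
    ((LinearMap.toContinuousLinearMap ψ.toLinearMap).differentiable.comp
      (hF.comp (LinearMap.toContinuousLinearMap ψ.symm.toLinearMap).differentiable)) hρ
    fun z hz => hb (ψ.symm z) (by rw [hψ]; exact hz)
  refine ⟨ψ.symm z, by rw [hψ]; exact hz, ?_⟩
  apply ψ.injective
  rw [ψ.apply_symm_apply]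
  exact hfix

/-- A classical code Hamiltonian perturbed by hopping matrices, with the locality data
that controls the perturbation. -/
structure HopModel (n m : ℕ) (ι : Type) where
  w : F2vec n → ℝ
  isWeight : IsWeight w
  l : Fin m → F2vec n →+ ZMod 2
  Q : Fin m → Finset (Fin n)
  exists_mem_Q : ∀ j x, l j x ≠ 0 → ∃ i ∈ Q j, x i ≠ 0
  lam : Fin m → ℝ
  one_le_lam : ∀ j, 1 ≤ lam j
  y : ι → F2vec n
  v : ι → F2vec n → ℂ
  β : ι → ℝ
  norm_v_le : ∀ τ b, ‖v τ b‖ ≤ β τ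
  S : ι → Finset (Fin n)
  y_eq_zero : ∀ τ i, i ∉ S τ → y τ i = 0
  N : ι → Finset (Fin m)
  exists_mem_S : ∀ τ x, NearAmp (v τ) x → ∃ i ∈ S τ, x i ≠ 0
  exists_mem_N : ∀ τ x, NearAmp (v τ) x → ∃ j ∈ N τ, l j x ≠ 0

namespace HopModel

variable {n m : ℕ} {ι : Type} (M : HopModel n m ι)

/-- The unperturbed energy of a bit string. -/
def energy (x : F2vec n) : ℝ := ∑ j with M.l j x ≠ 0, M.lam j

/-- The Hamiltonian of the model. -/
def ham [Fintype ι] : Matrix (F2vec n) (F2vec n) ℂ :=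
  ∑ j, ((M.lam j / 2 : ℝ) : ℂ) • (1 - signMatrix (M.l j)) + ∑ τ, hopMatrix (M.y τ) (M.v τ)

/-- The strength of a term, including the cost of dressing it. -/
def strength (ρ : ℝ) (τ : ι) : ℝ :=
  M.β τ * M.w (M.y τ) * Real.exp (2 * ((M.S τ).card * ρ))

/-- The part of a function seen by a check. -/
def checkPart (g : F2vec n → ℂ) (j : Fin m) : F2vec n → ℂ :=
  restrictTo (fun x => M.l j x ≠ 0) g

/-- The weighted sum of a function over the strings containing `i`. -/
def root (g : F2vec n → ℂ) (i : Fin n) : ℝ :=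
  wSum M.w (restrictTo (fun x => x i ≠ 0) g)

theorem energy_nonneg (x : F2vec n) : 0 ≤ M.energy x :=
  Finset.sum_nonneg fun j _ => zero_le_one.trans (M.one_le_lam j)

theorem card_le_energy (x : F2vec n) :
    ((Finset.univ.filter fun j => M.l j x ≠ 0).card : ℝ) ≤ M.energy x := by
  rw [Finset.cast_card]
  exact Finset.sum_le_sum fun j _ => M.one_le_lam j

theorem one_le_energy {x : F2vec n} {j : Fin m} (h : M.l j x ≠ 0) : 1 ≤ M.energy x :=
  le_trans (by
    exact_mod_cast Finset.card_pos.2 ⟨j, Finset.mem_filter.2 ⟨Finset.mem_univ _, h⟩⟩)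
    (M.card_le_energy x)

theorem energy_eq_zero_iff {x : F2vec n} : M.energy x = 0 ↔ ∀ j, M.l j x = 0 := by
  refine ⟨fun h j => ?_, fun h => ?_⟩
  · by_contra hj
    linarith [M.one_le_energy hj]
  · unfold energy
    rw [Finset.filter_false_of_mem (by simpa using h), Finset.sum_empty]

theorem one_le_energy_of_ne {x : F2vec n} (h : M.energy x ≠ 0) : 1 ≤ M.energy x := by
  rw [Ne, energy_eq_zero_iff, not_forall] at h
  exact M.one_le_energy h.choose_spec

theorem β_nonneg (τ : ι) : 0 ≤ M.β τ := (norm_nonneg _).trans (M.norm_v_le τ 0)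

theorem strength_nonneg (ρ : ℝ) (τ : ι) : 0 ≤ M.strength ρ τ :=
  mul_nonneg (mul_nonneg (M.β_nonneg τ) (M.isWeight.pos _).le) (Real.exp_pos _).le

/-- Every weighted sum is bounded by the weighted sums over a hitting set. -/
theorem wSum_restrictTo_le_card_mul {w : F2vec n → ℝ} (hw : IsWeight w) {p : F2vec n → Prop}
    {κ : Type} (T : Finset κ) (P : κ → F2vec n → Prop) (hp : ∀ x, p x → ∃ i ∈ T, P i x)
    (g : F2vec n → ℂ) :
    wSum w (restrictTo p g) ≤ ∑ i ∈ T, wSum w (restrictTo (P i) g) := by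
  unfold wSum
  rw [Finset.sum_comm]
  refine Finset.sum_le_sum fun x _ => ?_
  have hnn : ∀ i ∈ T, 0 ≤ ‖restrictTo (P i) g x‖ * w x := fun i _ =>
    mul_nonneg (norm_nonneg _) (hw.pos x).le
  by_cases hx : p x
  · obtain ⟨i, hi, hPi⟩ := hp x hx
    refine le_trans (le_of_eq ?_) (Finset.single_le_sum hnn hi)
    simp [restrictTo, hx, hPi]
  · simpa [restrictTo, hx] using Finset.sum_nonneg hnn

theorem wSum_mono {w : F2vec n → ℝ} (hw : IsWeight w) {g h : F2vec n → ℂ}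
    (hgh : ∀ x, ‖g x‖ ≤ ‖h x‖) : wSum w g ≤ wSum w h :=
  Finset.sum_le_sum fun x _ => mul_le_mul_of_nonneg_right (hgh x) (hw.pos x).le

theorem root_nonneg (g : F2vec n → ℂ) (i : Fin n) : 0 ≤ M.root g i := wSum_nonneg M.isWeight _

/-- The solution of `energy * g = r`. -/
def resolve (r : F2vec n → ℂ) : F2vec n → ℂ := fun x => r x / M.energy x

theorem norm_resolve_mul_energy_le (r : F2vec n → ℂ) (x : F2vec n) :
    ‖M.resolve r x‖ * M.energy x ≤ ‖r x‖ := by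
  unfold resolve
  by_cases h : M.energy x = 0
  · simp [h]
  · rw [norm_div, Complex.norm_real, Real.norm_of_nonneg (M.energy_nonneg x),
      div_mul_cancel₀ _ h]

theorem norm_resolve_le (r : F2vec n → ℂ) (x : F2vec n) : ‖M.resolve r x‖ ≤ ‖r x‖ := by
  by_cases h : M.energy x = 0
  · simp [resolve, h]
  · have h1 := M.one_le_energy_of_ne h
    have h2 := M.norm_resolve_mul_energy_le r x
    nlinarith [norm_nonneg (M.resolve r x)]

theorem root_resolve_le (r : F2vec n → ℂ) (i : Fin n) : M.root (M.resolve r) i ≤ M.root r i := by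
  refine wSum_mono M.isWeight fun x => ?_
  unfold restrictTo
  split_ifs
  · exact M.norm_resolve_le r x
  · exact le_rfl

theorem wSum_checkPart_le {g : F2vec n → ℂ} {ρ : ℝ} (hg : ∀ i, M.root g i ≤ ρ) (j : Fin m) :
    wSum M.w (M.checkPart g j) ≤ (M.Q j).card * ρ := by
  refine (wSum_restrictTo_le_card_mul M.isWeight (M.Q j) (fun i x => x i ≠ 0)
    (M.exists_mem_Q j) g).trans ?_
  rw [← nsmul_eq_mul]
  exact Finset.sum_le_card_nsmul _ _ _ fun i _ => hg i

theorem wSum_near_le {g : F2vec n → ℂ} {ρ : ℝ} (hg : ∀ i, M.root g i ≤ ρ) {τ : ι}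
    {p : F2vec n → Prop} (hp : ∀ x, p x → NearAmp (M.v τ) x) :
    wSum M.w (restrictTo p g) ≤ (M.S τ).card * ρ := by
  refine (wSum_restrictTo_le_card_mul M.isWeight (M.S τ) (fun i x => x i ≠ 0)
    (fun x hx => M.exists_mem_S τ x (hp x hx)) g).trans ?_
  rw [← nsmul_eq_mul]
  exact Finset.sum_le_card_nsmul _ _ _ fun i _ => hg i

/-- Rooted sums of the check parts, weighted by the couplings, are bounded by those of `r`. -/
theorem sum_lam_mul_root_checkPart_le (r : F2vec n → ℂ) (i : Fin n) :
    ∑ j, M.lam j * M.root (M.checkPart (M.resolve r) j) i ≤ M.root r i := by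
  unfold root wSum
  simp only [Finset.mul_sum]
  rw [Finset.sum_comm]
  refine Finset.sum_le_sum fun x _ => ?_
  by_cases hx : x i = 0
  · simp [restrictTo, hx]
  · have h1 : ∀ j, M.lam j * (‖restrictTo (fun x => x i ≠ 0) (M.checkPart (M.resolve r) j) x‖
        * M.w x) = (if M.l j x ≠ 0 then M.lam j else 0) * (‖M.resolve r x‖ * M.w x) := by
      intro j
      by_cases hj : M.l j x = 0 <;> simp [restrictTo, checkPart, hx, hj]
    simp only [h1]
    rw [← Finset.sum_mul, ← Finset.sum_filter]
    change M.energy x * _ ≤ _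
    have := mul_le_mul_of_nonneg_right (M.norm_resolve_mul_energy_le r x) (M.isWeight.pos x).le
    simp only [restrictTo, hx, ne_eq, not_false_eq_true, if_true]
    linarith

theorem sum_root_checkPart_le (r : F2vec n → ℂ) (i : Fin n) :
    ∑ j, M.root (M.checkPart (M.resolve r) j) i ≤ M.root r i := by
  refine (Finset.sum_le_sum fun j _ => ?_).trans (M.sum_lam_mul_root_checkPart_le r i)
  exact le_mul_of_one_le_left (M.root_nonneg _ i) (M.one_le_lam j)

variable [Fintype ι]

/-- The first row of the dressed Hamiltonian. -/
theorem dressed_ham_zero (g : F2vec n → ℂ) (b : F2vec n) :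
    dressed g M.ham 0 b = M.energy b * g b
      + (∑ j, (M.lam j : ℂ) * expRemainder (convMatrix (M.checkPart g j)) 0 b
      + ∑ τ, dressed g (hopMatrix (M.y τ) (M.v τ)) 0 b) := by
  have hj : ∀ j, ((M.lam j / 2 : ℝ) : ℂ) * dressed g (1 - signMatrix (M.l j)) 0 b
      = (M.lam j : ℂ) * M.checkPart g j b
        + (M.lam j : ℂ) * expRemainder (convMatrix (M.checkPart g j)) 0 b := by
    intro j
    rw [dressed_sub, dressed_one, dressed_signMatrix]
    simp only [Matrix.sub_apply, signMatrix, diagonal_mul, map_zero, zsgn_zero, one_mul,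
      expRemainder_matrix, Matrix.smul_apply, smul_eq_mul]
    have : convMatrix (M.checkPart g j) 0 b = M.checkPart g j b := by
      simp [convMatrix]
    rw [this]
    push_cast
    unfold checkPart
    ring
  have he : ∑ j, (M.lam j : ℂ) * M.checkPart g j b = M.energy b * g b := by
    unfold energy checkPart restrictTo
    push_cast
    rw [Finset.sum_mul, Finset.sum_filter]
    refine Finset.sum_congr rfl fun j _ => ?_
    split_ifs <;> simp
  rw [ham, dressed_add, dressed_sum, dressed_sum, Matrix.add_apply, Matrix.sum_apply,
    Matrix.sum_apply]
  simp only [dressed_smul, Matrix.smul_apply, smul_eq_mul, hj]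
  rw [Finset.sum_add_distrib, he, add_assoc]

end HopModel
end HopModels

section HopModelFixedPoint

open scoped Matrix.Norms.Operator
open Matrix

namespace HopModel

variable {n m : ℕ} {ι : Type} [Fintype ι] (M : HopModel n m ι)

/-- The nonlinear part of the first row of the dressed Hamiltonian. -/
def nonlin (r : F2vec n → ℂ) : F2vec n → ℂ := fun b =>
  dressed (M.resolve r) M.ham 0 b - M.energy b * M.resolve r b

/-- Smallness of the perturbation, measured at dressing radius `ρ₀`. -/
structure IsSmall (q ε δ ρ₀ : ℝ) : Prop where
  q_nonneg : 0 ≤ q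
  δ_nonneg : 0 ≤ δ
  card_Q_le : ∀ j, ((M.Q j).card : ℝ) ≤ q
  sum_S_le : ∀ i, ∑ τ with i ∈ M.S τ, M.strength ρ₀ τ ≤ ε
  sum_N_le : ∀ j, ∑ τ with j ∈ M.N τ, M.strength ρ₀ τ ≤ δ

variable {M} {q ε δ ρ₀ : ℝ}

theorem root_nonlin_le (hM : M.IsSmall q ε δ ρ₀) {r : F2vec n → ℂ} {ρ : ℝ}
    (hρ : 0 ≤ ρ) (hρ₀ : ρ ≤ ρ₀) (hqρ : q * ρ ≤ 1 / 2) (hr : ∀ i, M.root r i ≤ ρ) (i : Fin n) :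
    M.root (M.nonlin r) i ≤ ε + 2 * δ * ρ + 8 * q * ρ ^ 2 := by
  have hw := M.isWeight
  have hδ := hM.δ_nonneg
  have hq := hM.q_nonneg
  set g := M.resolve r with hg
  have hgr : ∀ i, M.root g i ≤ ρ := fun i => (M.root_resolve_le r i).trans (hr i)
  set li : F2vec n →+ ZMod 2 := Pi.evalAddMonoidHom (fun _ => ZMod 2) i
  have hcheck : ∀ j, wSum M.w (M.checkPart g j) ≤ q * ρ := fun j =>
    (M.wSum_checkPart_le hgr j).trans (mul_le_mul_of_nonneg_right (hM.card_Q_le j) hρ)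
  have hexp : ∀ τ, Real.exp (2 * wSum M.w (restrictTo (NearAmp (M.v τ)) g))
      ≤ Real.exp (2 * ((M.S τ).card * ρ₀)) := fun τ => by
    have := M.wSum_near_le hgr (τ := τ) (p := NearAmp (M.v τ)) fun x hx => hx
    gcongr
    exact this.trans (by gcongr)
  set B : F2vec n → ℂ := fun b =>
    ∑ j, (M.lam j : ℂ) * expRemainder (convMatrix (M.checkPart g j)) 0 b with hB
  set D : F2vec n → ℂ := fun b => ∑ τ, dressed g (hopMatrix (M.y τ) (M.v τ)) 0 b with hD
  have hnl : ∀ b, M.nonlin r b = B b + D b := fun b => by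
    rw [nonlin, dressed_ham_zero]; ring
  -- the check part
  have hBsum : ∑ b with li b ≠ 0, ‖B b‖ * M.w b ≤ 8 * q * ρ ^ 2 := by
    calc _ ≤ ∑ b with li b ≠ 0, ∑ j,
          M.lam j * (‖expRemainder (convMatrix (M.checkPart g j)) 0 b‖ * M.w b) := by
          refine Finset.sum_le_sum fun b _ => ?_
          have : ‖B b‖ ≤ ∑ j, M.lam j * ‖expRemainder (convMatrix (M.checkPart g j)) 0 b‖ := by
            refine (norm_sum_le _ _).trans (Finset.sum_le_sum fun j _ => ?_)
            rw [norm_mul, Complex.norm_real,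
              Real.norm_of_nonneg (zero_le_one.trans (M.one_le_lam j))]
          refine (mul_le_mul_of_nonneg_right this (hw.pos b).le).trans (le_of_eq ?_)
          rw [Finset.sum_mul]
          exact Finset.sum_congr rfl fun j _ => mul_assoc _ _ _
      _ = ∑ j, M.lam j * ∑ b with li b ≠ 0,
          ‖expRemainder (convMatrix (M.checkPart g j)) 0 b‖ * M.w b := by
          rw [Finset.sum_comm]
          simp only [Finset.mul_sum]
      _ ≤ ∑ j, M.lam j * (8 * M.root (M.checkPart g j) i * (q * ρ)) := by
          refine Finset.sum_le_sum fun j _ => ?_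
          refine mul_le_mul_of_nonneg_left ?_ (zero_le_one.trans (M.one_le_lam j))
          refine (sum_root_expRemainder_le hw (M.checkPart g j) li
            ((hcheck j).trans hqρ)).trans ?_
          exact mul_le_mul_of_nonneg_left (hcheck j)
            (mul_nonneg (by norm_num) (M.root_nonneg _ i))
      _ = 8 * (q * ρ) * ∑ j, M.lam j * M.root (M.checkPart g j) i := by
          rw [Finset.mul_sum]
          exact Finset.sum_congr rfl fun j _ => by ring
      _ ≤ 8 * (q * ρ) * ρ := by
          exact mul_le_mul_of_nonneg_left ((M.sum_lam_mul_root_checkPart_le r i).trans (hr i))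
            (by positivity)
      _ = _ := by ring
  -- the hopping part
  have hterm : ∀ τ, ∑ b with li b ≠ 0, ‖dressed g (hopMatrix (M.y τ) (M.v τ)) 0 b‖ * M.w b
      ≤ (if i ∈ M.S τ then M.strength ρ₀ τ else 0)
        + 2 * ∑ j, (if j ∈ M.N τ then M.strength ρ₀ τ else 0) * M.root (M.checkPart g j) i := by
    intro τ
    have hβw : 0 ≤ M.β τ * M.w (M.y τ) := mul_nonneg (M.β_nonneg τ) (hw.pos _).le
    have hnn : 0 ≤ ∑ j, (if j ∈ M.N τ then M.strength ρ₀ τ else 0)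
        * M.root (M.checkPart g j) i := by
      refine Finset.sum_nonneg fun j _ => mul_nonneg ?_ (M.root_nonneg _ i)
      split_ifs
      exacts [M.strength_nonneg _ _, le_rfl]
    by_cases hi : i ∈ M.S τ
    · rw [if_pos hi]
      have h1 : ∑ b with li b ≠ 0, ‖dressed g (hopMatrix (M.y τ) (M.v τ)) 0 b‖ * M.w b
          ≤ ∑ b, ‖dressed g (hopMatrix (M.y τ) (M.v τ)) 0 b‖ * M.w b :=
        Finset.sum_le_sum_of_subset_of_nonneg (Finset.filter_subset _ _)
          fun b _ _ => mul_nonneg (norm_nonneg _) (hw.pos b).le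
      have h2 := sum_row_dressed_hopMatrix_le hw g (M.y τ) (M.norm_v_le τ)
      have h3 := mul_le_mul_of_nonneg_left (hexp τ) hβw
      rw [strength]
      rw [strength] at hnn
      linarith
    · rw [if_neg hi, zero_add]
      refine (sum_root_dressed_hopMatrix_le hw g li (M.y_eq_zero τ i hi)
        (M.norm_v_le τ)).trans ?_
      have hnear : wSum M.w (restrictTo (fun x => li x ≠ 0) (restrictTo (NearAmp (M.v τ)) g))
          ≤ ∑ j ∈ M.N τ, M.root (M.checkPart g j) i := by
        have e : ∀ p : F2vec n → Prop, restrictTo (fun x => li x ≠ 0) (restrictTo p g)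
            = restrictTo p (restrictTo (fun x => x i ≠ 0) g) := by
          intro p; ext x; simp only [restrictTo]
          have hx : li x = x i := rfl
          by_cases h : x i = 0 <;> simp [hx, h]
        rw [e]
        refine (wSum_restrictTo_le_card_mul hw (M.N τ) (fun j x => M.l j x ≠ 0)
          (M.exists_mem_N τ) _).trans (le_of_eq ?_)
        refine Finset.sum_congr rfl fun j _ => ?_
        rw [← e]; rfl
      calc _ ≤ M.β τ * M.w (M.y τ) * (2 * ∑ j ∈ M.N τ, M.root (M.checkPart g j) i)
            * Real.exp (2 * ((M.S τ).card * ρ₀)) := by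
            have := wSum_nonneg hw
              (restrictTo (fun x => li x ≠ 0) (restrictTo (NearAmp (M.v τ)) g))
            have h0 : 0 ≤ ∑ j ∈ M.N τ, M.root (M.checkPart g j) i := this.trans hnear
            exact mul_le_mul (mul_le_mul_of_nonneg_left (by linarith) hβw) (hexp τ)
              (Real.exp_pos _).le (mul_nonneg hβw (by linarith))
        _ = 2 * (M.strength ρ₀ τ * ∑ j ∈ M.N τ, M.root (M.checkPart g j) i) := by
            rw [strength]; ring
        _ = _ := by
            rw [Finset.mul_sum, ← Finset.sum_filter_add_sum_filter_not Finset.univ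
              (fun j => j ∈ M.N τ)]
            congr 1
            rw [Finset.sum_eq_zero (s := Finset.univ.filter fun j => ¬ j ∈ M.N τ), add_zero]
            · rw [Finset.filter_mem_eq_inter, Finset.univ_inter]
              exact Finset.sum_congr rfl fun j hj => by rw [if_pos hj]
            · intro j hj
              rw [if_neg (Finset.mem_filter.1 hj).2, zero_mul]
  have hDsum : ∑ b with li b ≠ 0, ‖D b‖ * M.w b ≤ ε + 2 * δ * ρ := by
    calc _ ≤ ∑ b with li b ≠ 0, ∑ τ,
          ‖dressed g (hopMatrix (M.y τ) (M.v τ)) 0 b‖ * M.w b := by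
          refine Finset.sum_le_sum fun b _ => ?_
          rw [← Finset.sum_mul]
          exact mul_le_mul_of_nonneg_right (norm_sum_le _ _) (hw.pos b).le
      _ = ∑ τ, ∑ b with li b ≠ 0,
          ‖dressed g (hopMatrix (M.y τ) (M.v τ)) 0 b‖ * M.w b := Finset.sum_comm
      _ ≤ ∑ τ, ((if i ∈ M.S τ then M.strength ρ₀ τ else 0) + 2 * ∑ j,
          (if j ∈ M.N τ then M.strength ρ₀ τ else 0) * M.root (M.checkPart g j) i) :=
          Finset.sum_le_sum fun τ _ => hterm τ
      _ = (∑ τ with i ∈ M.S τ, M.strength ρ₀ τ) + 2 * ∑ j,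
          (∑ τ with j ∈ M.N τ, M.strength ρ₀ τ) * M.root (M.checkPart g j) i := by
          rw [Finset.sum_add_distrib, Finset.sum_filter, ← Finset.mul_sum, Finset.sum_comm]
          simp only [Finset.sum_filter, Finset.sum_mul]
      _ ≤ ε + 2 * ∑ j, δ * M.root (M.checkPart g j) i := by
          have := hM.sum_S_le i
          have : ∑ j, (∑ τ with j ∈ M.N τ, M.strength ρ₀ τ) * M.root (M.checkPart g j) i
              ≤ ∑ j, δ * M.root (M.checkPart g j) i :=
            Finset.sum_le_sum fun j _ =>
              mul_le_mul_of_nonneg_right (hM.sum_N_le j) (M.root_nonneg _ i)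
          linarith
      _ ≤ _ := by
          rw [← Finset.mul_sum]
          have := mul_le_mul_of_nonneg_left ((M.sum_root_checkPart_le r i).trans (hr i)) hδ
          linarith
  calc M.root (M.nonlin r) i = ∑ b with li b ≠ 0, ‖M.nonlin r b‖ * M.w b :=
        (wSum_restrictTo _ _ _).trans (Finset.sum_congr (by ext x; simp [li]) fun _ _ => rfl)
    _ ≤ ∑ b with li b ≠ 0, (‖B b‖ * M.w b + ‖D b‖ * M.w b) := by
        refine Finset.sum_le_sum fun b _ => ?_
        rw [← add_mul, hnl]
        exact mul_le_mul_of_nonneg_right (norm_add_le _ _) (hw.pos b).le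
    _ ≤ _ := by rw [Finset.sum_add_distrib]; linarith

end HopModel
end HopModelFixedPoint

section HopModelDressing

open scoped Matrix.Norms.Operator
open Matrix

namespace HopModel

variable {n m : ℕ} {ι : Type} (M : HopModel n m ι)

/-- The generator of the dressing as a linear function of `r`. -/
def generator : (F2vec n → ℂ) →ₗ[ℂ] Matrix (F2vec n) (F2vec n) ℂ where
  toFun r := convMatrix (M.resolve r)
  map_add' r r' := by
    ext a b; simp [convMatrix, resolve, add_div]
  map_smul' c r := by
    ext a b; simp [convMatrix, resolve, mul_div_assoc]

theorem differentiable_nonlin [Fintype ι] : Differentiable ℂ M.nonlin := by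
  have hA : Differentiable ℂ fun r => M.generator r :=
    (LinearMap.toContinuousLinearMap M.generator).differentiable
  have hexp : Differentiable ℂ
      (NormedSpace.exp : Matrix (F2vec n) (F2vec n) ℂ → Matrix (F2vec n) (F2vec n) ℂ) :=
    fun T => (NormedSpace.exp_analytic (𝕂 := ℂ) T).differentiableAt
  have hD : Differentiable ℂ fun r => dressed (M.resolve r) M.ham :=
    ((hexp.comp hA).mul (differentiable_const _)).mul (hexp.comp hA.neg)
  rw [differentiable_pi]
  intro b
  have h1 : Differentiable ℂ fun r => dressed (M.resolve r) M.ham 0 b :=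
    (LinearMap.toContinuousLinearMap
      (Matrix.entryLinearMap ℂ ℂ (0 : F2vec n) b)).differentiable.comp hD
  have h2 : Differentiable ℂ fun r : F2vec n → ℂ => (M.energy b : ℂ) * M.resolve r b := by
    simp only [resolve, div_eq_mul_inv]
    exact ((differentiable_apply b).mul_const _).const_mul _
  exact h1.sub h2

/-- The rooted sums as the norm of a linear image, with the value at `0` added for
injectivity. -/
def rootMap : (F2vec n → ℂ) →ₗ[ℂ] (Fin n → PiLp 1 fun _ : F2vec n => ℂ) × ℂ where
  toFun r := (fun i => WithLp.toLp 1 fun x => if x i ≠ 0 then (M.w x : ℂ) * r x else 0, r 0)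
  map_add' r r' := by
    refine Prod.ext ?_ rfl
    ext i x
    by_cases h : x i = 0 <;> simp [h, mul_add]
  map_smul' c r := by
    refine Prod.ext ?_ rfl
    ext i x
    by_cases h : x i = 0 <;> simp [h, mul_left_comm]

theorem rootMap_injective : Function.Injective M.rootMap := by
  rw [← LinearMap.ker_eq_bot, LinearMap.ker_eq_bot']
  intro r hr
  obtain ⟨h1, h2⟩ := Prod.ext_iff.1 hr
  ext x
  by_cases hx : x = 0
  · subst hx; exact h2
  · obtain ⟨i, hi⟩ : ∃ i, x i ≠ 0 := Function.ne_iff.1 hx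
    have h3 : (if x i ≠ 0 then (M.w x : ℂ) * r x else 0) = 0 :=
      congrArg (fun z : PiLp 1 fun _ : F2vec n => ℂ => z x) (congrFun h1 i)
    rw [if_pos hi] at h3
    exact (mul_eq_zero.1 h3).resolve_left (by exact_mod_cast (M.isWeight.pos x).ne')

theorem norm_rootMap_le_iff {r : F2vec n → ℂ} {ρ : ℝ} (hρ : 0 ≤ ρ) :
    ‖M.rootMap r‖ ≤ ρ ↔ (∀ i, M.root r i ≤ ρ) ∧ ‖r 0‖ ≤ ρ := by
  rw [norm_prod_le_iff, pi_norm_le_iff_of_nonneg hρ]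
  refine and_congr (forall_congr' fun i => ?_) Iff.rfl
  have : ‖(M.rootMap r).1 i‖ = M.root r i := by
    rw [PiLp.norm_eq_of_L1]
    refine Finset.sum_congr rfl fun x _ => ?_
    simp only [rootMap, LinearMap.coe_mk, AddHom.coe_mk, restrictTo]
    by_cases h : x i = 0
    · simp [h]
    · simp [h, abs_of_pos (M.isWeight.pos x), mul_comm]
  rw [this]

variable [Fintype ι] {M} {q ε δ ρ₀ : ℝ}

theorem exists_dressing (hM : M.IsSmall q ε δ ρ₀) (hε : 0 ≤ ε) (hρ₀ : 0 < ρ₀)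
    (hq : 64 * q * ρ₀ ≤ 1) (hsmall : ε + 2 * δ * ρ₀ ≤ ρ₀ / 8) :
    ∃ r : F2vec n → ℂ, (∀ i, M.root r i ≤ 2 * (ε + 2 * δ * ρ₀)) ∧
      (∀ i, M.root (M.nonlin r) i ≤ 2 * (ε + 2 * δ * ρ₀)) ∧
      ∀ b, M.energy b ≠ 0 → dressed (M.resolve r) M.ham 0 b = 0 := by
  have hδ := hM.δ_nonneg
  have hq0 := hM.q_nonneg
  set F : (F2vec n → ℂ) → F2vec n → ℂ := fun r b =>
    if M.energy b = 0 then 0 else -M.nonlin r b with hF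
  have hFd : Differentiable ℂ F := by
    rw [differentiable_pi]
    intro b
    by_cases hb : M.energy b = 0
    · simp only [hF, hb, if_true]; exact differentiable_const _
    · simp only [hF, hb, if_false]
      exact (differentiable_pi.1 M.differentiable_nonlin b).neg
  have hF0 : ∀ r, F r 0 = 0 := fun r => by
    have : M.energy 0 = 0 := M.energy_eq_zero_iff.2 fun j => map_zero _
    simp [hF, this]
  have hFle : ∀ r i, M.root (F r) i ≤ M.root (M.nonlin r) i := fun r i => by
    refine wSum_mono M.isWeight fun x => ?_
    by_cases hx : x i = 0 <;> by_cases he : M.energy x = 0 <;> simp [restrictTo, hF, hx, he]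
  have hbound : ∀ r ρ, 0 ≤ ρ → ρ ≤ ρ₀ → ‖M.rootMap r‖ ≤ ρ → ∀ i,
      M.root (M.nonlin r) i ≤ ε + 2 * δ * ρ + 8 * q * ρ ^ 2 := by
    intro r ρ h0 h1 hr i
    refine root_nonlin_le hM h0 h1 ?_ ((M.norm_rootMap_le_iff h0).1 hr).1 i
    nlinarith [mul_le_mul_of_nonneg_left h1 hq0]
  obtain ⟨r, hr, hfix⟩ := exists_fixedPoint_of_norm_map_le M.rootMap M.rootMap_injective hFd hρ₀
    fun r hr => by
      rw [M.norm_rootMap_le_iff (by positivity)]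
      refine ⟨fun i => ((hFle r i).trans (hbound r ρ₀ hρ₀.le le_rfl hr i)).trans ?_, ?_⟩
      · nlinarith
      · rw [hF0, norm_zero]; positivity
  set ρ := ‖M.rootMap r‖ with hρdef
  have hρ : 0 ≤ ρ := norm_nonneg _
  have hNL : ∀ i, M.root (M.nonlin r) i ≤ ε + 2 * δ * ρ₀ + ρ / 8 := fun i => by
    refine (hbound r ρ hρ hr le_rfl i).trans ?_
    have h1 := mul_le_mul_of_nonneg_left hr hδ
    have h2 := mul_le_mul_of_nonneg_left hr (mul_nonneg hq0 hρ)
    nlinarith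
  have hρle : ρ ≤ ε + 2 * δ * ρ₀ + ρ / 8 := by
    rw [hρdef, M.norm_rootMap_le_iff (by positivity)]
    refine ⟨fun i => ?_, ?_⟩
    · conv_lhs => rw [← hfix]
      exact (hFle r i).trans (hNL i)
    · rw [← hfix, hF0, norm_zero]; positivity
  have hpos : 0 ≤ ε + 2 * δ * ρ₀ := by positivity
  refine ⟨r, fun i => ?_, fun i => (hNL i).trans (by linarith), fun b hb => ?_⟩
  · exact (((M.norm_rootMap_le_iff hρ).1 le_rfl).1 i).trans (by linarith)
  · have h1 := congrFun hfix b
    simp only [hF, if_neg hb, nonlin] at h1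
    have h2 : (M.energy b : ℂ) * M.resolve r b = r b := by
      rw [resolve, mul_div_cancel₀]
      exact_mod_cast hb
    rw [h2] at h1
    linear_combination -h1

end HopModel
end HopModelDressing

section BlockSpectrum

open Matrix

theorem charpoly_eq_mul_of_block {κ : Type*} [Fintype κ] [DecidableEq κ] (T : Matrix κ κ ℂ)
    (p : κ → Prop) [Fintype {i // p i}] [DecidableEq {i // p i}] [Fintype {i // ¬ p i}]
    [DecidableEq {i // ¬ p i}] (h : ∀ i, p i → ∀ j, ¬ p j → T i j = 0) :
    T.charpoly = (T.toSquareBlockProp p).charpoly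
      * (T.toSquareBlockProp fun i => ¬ p i).charpoly := by
  have hb : ∀ (r : κ → Prop) [DecidableEq {a // r a}],
      (T.toSquareBlockProp r).charmatrix = T.charmatrix.toSquareBlockProp r := by
    intro r _
    ext i j : 1
    simp [charmatrix_apply, toSquareBlockProp_def, diagonal_apply, Subtype.ext_iff]
  unfold Matrix.charpoly
  refine (twoBlockTriangular_det' T.charmatrix p fun i hi j hj => ?_).trans ?_
  rotate_left
  · congr!
    · exact (hb p).symm
    · exact (hb fun i => ¬ p i).symm
  have hij : i ≠ j := fun e => hj (e ▸ hi)
  rw [charmatrix_apply_ne _ _ _ hij, h i hi j hj]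
  simp

/-- Gershgorin's theorem for roots of the characteristic polynomial of a diagonal block, with
centers that only approximate the diagonal. -/
theorem exists_norm_sub_le_of_isRoot_charpoly {κ : Type*} [Fintype κ] [DecidableEq κ]
    {T : Matrix κ κ ℂ} {p : κ → Prop} [Fintype {i // p i}] [DecidableEq {i // p i}] {z : κ → ℂ} {R : κ → ℝ}
    (h : ∀ a, p a → ∑ c, ‖T a c - if c = a then z a else 0‖ ≤ R a) {μ : ℂ}
    (hμ : (T.toSquareBlockProp p).charpoly.IsRoot μ) : ∃ a, p a ∧ ‖μ - z a‖ ≤ R a := by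
  have hev : Module.End.HasEigenvalue (Matrix.toLin' (T.toSquareBlockProp p)) μ := by
    rw [Module.End.hasEigenvalue_iff_isRoot_charpoly, Matrix.charpoly_toLin']
    exact hμ
  obtain ⟨⟨a, ha⟩, hball⟩ := eigenvalue_mem_ball hev
  refine ⟨a, ha, ?_⟩
  rw [mem_closedBall_iff_norm] at hball
  have h1 : ∑ c : {c // p c}, ‖T a c - if (c : κ) = a then z a else 0‖ ≤ R a := by
    refine le_trans ?_ (h a ha)
    have := Finset.sum_subtype (F := inferInstance) (Finset.univ.filter p) (p := p) (by simp)
      fun c => ‖T a c - if c = a then z a else 0‖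
    rw [← this]
    exact Finset.sum_le_sum_of_subset_of_nonneg (Finset.filter_subset _ _)
      fun _ _ _ => norm_nonneg _
  rw [← Finset.add_sum_erase _ _ (Finset.mem_univ (⟨a, ha⟩ : {c // p c}))] at h1
  have h2 : ∑ j ∈ Finset.univ.erase (⟨a, ha⟩ : {c // p c}),
      ‖T.toSquareBlockProp p ⟨a, ha⟩ j‖
      = ∑ c ∈ Finset.univ.erase (⟨a, ha⟩ : {c // p c}),
        ‖T a c - if (c : κ) = a then z a else 0‖ := by
    refine Finset.sum_congr rfl fun c hc => ?_
    have : (c : κ) ≠ a := fun e => (Finset.ne_of_mem_erase hc) (Subtype.ext e)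
    rw [if_neg this, sub_zero]; rfl
  rw [h2] at hball
  simp only [if_true] at h1
  have h3 : ‖μ - z a‖ ≤ ‖μ - T a a‖ + ‖T a a - z a‖ := norm_sub_le_norm_sub_add_norm_sub _ _ _
  have h4 : T.toSquareBlockProp p ⟨a, ha⟩ ⟨a, ha⟩ = T a a := rfl
  rw [h4] at hball
  linarith

/-- If the characteristic polynomial of a Hermitian matrix splits into a part with roots near
`z` and a part with roots far to the right, the eigenvalues form two clusters. -/
theorem card_eigenvalues_le_of_charpoly_eq_mul {κ κ₁ κ₂ : Type*} [Fintype κ] [DecidableEq κ]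
    [Fintype κ₁] [DecidableEq κ₁] [Fintype κ₂] [DecidableEq κ₂] {A : Matrix κ κ ℂ}
    (hA : A.IsHermitian) {P : Matrix κ₁ κ₁ ℂ} {Q : Matrix κ₂ κ₂ ℂ}
    (h : A.charpoly = P.charpoly * Q.charpoly) {z : ℂ} {η γ : ℝ}
    (hP : ∀ μ, P.charpoly.IsRoot μ → ‖μ - z‖ ≤ η)
    (hQ : ∀ μ, Q.charpoly.IsRoot μ → z.re + γ ≤ μ.re) (hγ : η < γ) :
    (∀ v, hA.eigenvalues v ∈ Set.Icc (z.re - η) (z.re + η) ∨ z.re + γ ≤ hA.eigenvalues v) ∧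
      (Finset.univ.filter fun v => hA.eigenvalues v ≤ z.re + η).card = Fintype.card κ₁ := by
  have hP' : ∀ μ, P.charpoly.IsRoot μ → μ.re ∈ Set.Icc (z.re - η) (z.re + η) := fun μ hμ => by
    have h1 := (Complex.abs_re_le_norm (μ - z)).trans (hP μ hμ)
    rw [Complex.sub_re, abs_le] at h1
    exact ⟨by linarith [h1.1], by linarith [h1.2]⟩
  have hne : P.charpoly * Q.charpoly ≠ 0 :=
    mul_ne_zero P.charpoly_monic.ne_zero Q.charpoly_monic.ne_zero
  have hroots : Multiset.map ((fun x : ℝ => (x : ℂ)) ∘ hA.eigenvalues) Finset.univ.val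
      = P.charpoly.roots + Q.charpoly.roots := by
    rw [← Polynomial.roots_mul hne, ← h]
    exact hA.roots_charpoly_eq_eigenvalues.symm
  refine ⟨fun v => ?_, ?_⟩
  · have hv : ((hA.eigenvalues v : ℝ) : ℂ) ∈ P.charpoly.roots + Q.charpoly.roots := by
      rw [← hroots]
      exact Multiset.mem_map_of_mem _ (Finset.mem_univ_val v)
    rcases Multiset.mem_add.1 hv with hv | hv
    · exact Or.inl (by simpa using hP' _ (Polynomial.isRoot_of_mem_roots hv))
    · exact Or.inr (by simpa using hQ _ (Polynomial.isRoot_of_mem_roots hv))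
  · have hc := congrArg (Multiset.countP fun μ : ℂ => μ.re ≤ z.re + η) hroots
    rw [Multiset.countP_add, Multiset.countP_map] at hc
    have h1 : Multiset.countP (fun μ : ℂ => μ.re ≤ z.re + η) P.charpoly.roots
        = Fintype.card κ₁ := by
      rw [Multiset.countP_eq_card.2 fun μ hμ => (hP' μ (Polynomial.isRoot_of_mem_roots hμ)).2,
        ← (IsAlgClosed.splits P.charpoly).natDegree_eq_card_roots, charpoly_natDegree_eq_dim]
    have h2 : Multiset.countP (fun μ : ℂ => μ.re ≤ z.re + η) Q.charpoly.roots = 0 := by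
      rw [Multiset.countP_eq_zero]
      intro μ hμ
      have := hQ μ (Polynomial.isRoot_of_mem_roots hμ)
      linarith
    rw [h1, h2, add_zero] at hc
    rw [← hc]
    rfl

end BlockSpectrum

section HopModelSpectrum

open scoped Matrix.Norms.Operator
open Matrix

/-- Conjugation of a matrix by the shift `b ↦ a + b`. -/
def shiftConj {n : ℕ} (a : F2vec n) (T : Matrix (F2vec n) (F2vec n) ℂ) :
    Matrix (F2vec n) (F2vec n) ℂ := fun b c => T (a + b) (a + c)

theorem shiftConj_eq_mul {n : ℕ} (a : F2vec n) (T : Matrix (F2vec n) (F2vec n) ℂ) :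
    shiftConj a T = convMatrix (Pi.single a 1) * T * convMatrix (Pi.single a 1) := by
  have h : ∀ b c : F2vec n, b + c = a ↔ c = a + b := fun b c => by
    rw [eq_comm, add_comm b c, F2vec.eq_add_comm]
  ext b c
  simp only [Matrix.mul_apply, convMatrix, Pi.single_apply, h, ite_mul, one_mul, zero_mul,
    Finset.sum_ite_eq', Finset.mem_univ, if_true, mul_ite, mul_one, mul_zero, shiftConj]
  have h' : ∀ d : F2vec n, (c = a + d) ↔ d = a + c := fun d => by
    rw [add_comm a d, F2vec.eq_add_comm, add_comm]
  simp [h']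

theorem dressed_shiftConj {n : ℕ} (g : F2vec n → ℂ) (a : F2vec n)
    (T : Matrix (F2vec n) (F2vec n) ℂ) :
    dressed g (shiftConj a T) = shiftConj a (dressed g T) := by
  simp only [shiftConj_eq_mul, dressed]
  set X := convMatrix (Pi.single a (1 : ℂ)) with hX
  have h1 : NormedSpace.exp (convMatrix g) * X = X * NormedSpace.exp (convMatrix g) :=
    ((convMatrix_commute g _).exp_left).eq
  have h2 : X * NormedSpace.exp (-convMatrix g) = NormedSpace.exp (-convMatrix g) * X :=
    (((convMatrix_commute g _).neg_left).exp_left).eq.symm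
  calc _ = NormedSpace.exp (convMatrix g) * X * T * (X * NormedSpace.exp (-convMatrix g)) := by
        simp only [mul_assoc]
    _ = _ := by rw [h1, h2]; simp only [mul_assoc]

theorem shiftConj_signMatrix {n : ℕ} (a : F2vec n) (l : F2vec n →+ ZMod 2) :
    shiftConj a (signMatrix l) = zsgn (l a) • signMatrix l := by
  ext b c
  simp [shiftConj, signMatrix, diagonal_apply, zsgn_add]

theorem shiftConj_hopMatrix {n : ℕ} (a y : F2vec n) (v : F2vec n → ℂ) :
    shiftConj a (hopMatrix y v) = hopMatrix y fun b => v (a + b) := by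
  ext b c
  simp [shiftConj, hopMatrix, add_assoc]

theorem shiftConj_one {n : ℕ} (a : F2vec n) : shiftConj a 1 = 1 := by
  ext b c
  simp [shiftConj, one_apply]

namespace HopModel

variable {n m : ℕ} {ι : Type} [Fintype ι] {M : HopModel n m ι} {q ε δ ρ₀ : ℝ}

theorem shiftConj_ham (M : HopModel n m ι) (a : F2vec n) :
    shiftConj a M.ham = M.ham + (∑ j with M.l j a ≠ 0, (M.lam j : ℂ) • signMatrix (M.l j)
      + ∑ τ, hopMatrix (M.y τ) fun b => M.v τ (a + b) - M.v τ b) := by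
  have h1 : ∀ j, shiftConj a (((M.lam j / 2 : ℝ) : ℂ) • (1 - signMatrix (M.l j)))
      = ((M.lam j / 2 : ℝ) : ℂ) • (1 - signMatrix (M.l j))
        + if M.l j a ≠ 0 then (M.lam j : ℂ) • signMatrix (M.l j) else 0 := by
    intro j
    have e : shiftConj a (((M.lam j / 2 : ℝ) : ℂ) • (1 - signMatrix (M.l j)))
      = ((M.lam j / 2 : ℝ) : ℂ) • (shiftConj a 1 - shiftConj a (signMatrix (M.l j))) := rfl
    rw [e, shiftConj_one, shiftConj_signMatrix]
    split_ifs with h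
    · rw [zsgn_ne_zero h]
      push_cast
      module
    · rw [not_not.1 h, zsgn_zero, one_smul, add_zero]
  have h2 : ∀ τ, shiftConj a (hopMatrix (M.y τ) (M.v τ))
      = hopMatrix (M.y τ) (M.v τ) + hopMatrix (M.y τ) fun b => M.v τ (a + b) - M.v τ b := by
    intro τ
    rw [shiftConj_hopMatrix]
    ext b c
    simp only [hopMatrix, Matrix.add_apply]
    split_ifs <;> ring
  have h3 : shiftConj a M.ham
      = ∑ j, shiftConj a (((M.lam j / 2 : ℝ) : ℂ) • (1 - signMatrix (M.l j)))
        + ∑ τ, shiftConj a (hopMatrix (M.y τ) (M.v τ)) := by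
    ext b c
    simp [shiftConj, ham, Matrix.sum_apply]
  rw [h3, Finset.sum_congr rfl fun j _ => h1 j, Finset.sum_congr rfl fun τ _ => h2 τ,
    Finset.sum_add_distrib, Finset.sum_add_distrib, ← Finset.sum_filter, ham]
  abel

/-- Rows of the dressed Hamiltonian differ from the first row by the energy, up to a
small fraction of it. -/
theorem sum_row_sub_le (hM : M.IsSmall q ε δ ρ₀) {g : F2vec n → ℂ} {ρ : ℝ} (hρ : 0 ≤ ρ)
    (hρρ₀ : ρ ≤ ρ₀) (hg : ∀ i, M.root g i ≤ ρ) (hq : 64 * q * ρ₀ ≤ 1) (hδ : δ ≤ 1 / 32)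
    (a : F2vec n) :
    ∑ b, ‖dressed g M.ham a (a + b) - dressed g M.ham 0 b
      - (if b = 0 then (M.energy a : ℂ) else 0)‖ ≤ M.energy a / 8 := by
  have hw := M.isWeight
  have hq0 := hM.q_nonneg
  have hδ0 := hM.δ_nonneg
  set E : Fin m → Matrix (F2vec n) (F2vec n) ℂ := fun j =>
    NormedSpace.exp (-((2 : ℂ) • convMatrix (M.checkPart g j))) with hE
  set u : ι → F2vec n → ℂ := fun τ b => M.v τ (a + b) - M.v τ b with hu
  have hunear : ∀ τ x, NearAmp (u τ) x → NearAmp (M.v τ) x := by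
    rintro τ x ⟨b, hb⟩
    by_contra hn
    have hn' : ∀ b, M.v τ (b + x) = M.v τ b := fun b => not_not.1 (not_exists.1 hn b)
    apply hb
    simp only [hu]
    rw [← add_assoc, hn', hn']
  have hu0 : ∀ τ, ¬ NearAmp (M.v τ) a → u τ = 0 := by
    intro τ hn
    funext b
    have := not_not.1 (not_exists.1 hn b)
    simp only [hu]
    rw [add_comm, this, sub_self]; rfl
  have hrow : ∀ b, dressed g M.ham a (a + b) - dressed g M.ham 0 b
      - (if b = 0 then (M.energy a : ℂ) else 0)
      = ∑ j with M.l j a ≠ 0, (M.lam j : ℂ) * (E j - 1) 0 b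
        + ∑ τ, dressed g (hopMatrix (M.y τ) (u τ)) 0 b := by
    intro b
    have h0 : dressed g M.ham a (a + b) = shiftConj a (dressed g M.ham) 0 b := by
      simp [shiftConj]
    rw [h0, ← dressed_shiftConj, shiftConj_ham, dressed_add, dressed_add, dressed_sum,
      dressed_sum]
    simp only [Matrix.add_apply, Matrix.sum_apply, dressed_smul, Matrix.smul_apply, smul_eq_mul,
      dressed_signMatrix]
    have h1 : ∀ j, (signMatrix (M.l j) * E j) 0 b = E j 0 b := fun j => by
      simp [signMatrix, diagonal_mul, zsgn_zero]
    have h2 : (if b = 0 then (M.energy a : ℂ) else 0)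
        = ∑ j with M.l j a ≠ 0, (M.lam j : ℂ) * (1 : Matrix (F2vec n) (F2vec n) ℂ) 0 b := by
      rw [← Finset.sum_mul, energy, one_apply]
      push_cast
      simp [eq_comm]
    have h3 : ∑ j with M.l j a ≠ 0, (M.lam j : ℂ) * (E j - 1) 0 b
        = ∑ j with M.l j a ≠ 0, (M.lam j : ℂ) * E j 0 b
          - ∑ j with M.l j a ≠ 0, (M.lam j : ℂ) * (1 : Matrix (F2vec n) (F2vec n) ℂ) 0 b := by
      rw [← Finset.sum_sub_distrib]
      simp only [Matrix.sub_apply, mul_sub]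
    rw [h2, h3]
    have h4 : ∑ j with M.l j a ≠ 0, (M.lam j : ℂ) * (signMatrix (M.l j) * NormedSpace.exp
        (-((2 : ℂ) • convMatrix (restrictTo (fun x => M.l j x ≠ 0) g)))) 0 b
        = ∑ j with M.l j a ≠ 0, (M.lam j : ℂ) * E j 0 b :=
      Finset.sum_congr rfl fun j _ => by rw [← h1 j]; rfl
    rw [h4]
    ring
  have hEj : ∀ j, ∑ b, ‖(E j - 1) 0 b‖ ≤ 1 / 16 := by
    intro j
    calc _ ≤ ∑ b, ‖(E j - 1) 0 b‖ * M.w b :=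
          Finset.sum_le_sum fun b _ => le_mul_of_one_le_right (norm_nonneg _) (hw.one_le b)
      _ ≤ ‖wConj M.w (E j - 1)‖ := sum_row_zero_le hw _
      _ ≤ Real.exp (2 * wSum M.w (M.checkPart g j)) - 1 := by
          rw [wConj_sub, wConj_one hw, hE, wConj_exp hw, wConj_neg, wConj_smul]
          refine (norm_exp_sub_one_le_exp_norm _).trans ?_
          rw [norm_neg, norm_smul]
          have := norm_wConj_convMatrix_le hw (M.checkPart g j)
          have h2 : ‖(2 : ℂ)‖ = 2 := by simp
          rw [h2]
          gcongr
      _ ≤ 1 / 16 := by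
          have h1 := (M.wSum_checkPart_le hg j).trans
            (mul_le_mul_of_nonneg_right (hM.card_Q_le j) hρ)
          have h2 : q * ρ ≤ q * ρ₀ := by gcongr
          set t := 2 * wSum M.w (M.checkPart g j) with ht
          have ht0 : 0 ≤ t := by have := wSum_nonneg hw (M.checkPart g j); positivity
          have ht1 : t ≤ 1 / 32 := by linarith
          have h3 := (le_abs_self _).trans (Real.abs_exp_sub_one_le (x := t) (by
            rw [abs_of_nonneg ht0]; linarith))
          rw [abs_of_nonneg ht0] at h3
          linarith
  have hτ : ∀ τ, ∑ b, ‖dressed g (hopMatrix (M.y τ) (u τ)) 0 b‖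
      ≤ if NearAmp (M.v τ) a then 2 * M.strength ρ₀ τ else 0 := by
    intro τ
    split_ifs with hn
    · have hv : ∀ b, ‖u τ b‖ ≤ 2 * M.β τ := fun b => by
        have := (norm_sub_le (M.v τ (a + b)) (M.v τ b)).trans
          (add_le_add (M.norm_v_le τ (a + b)) (M.norm_v_le τ b))
        rw [two_mul]; exact this
      have hS := M.wSum_near_le hg (τ := τ) (p := NearAmp (u τ)) (hunear τ)
      have hβ := M.β_nonneg τ
      have hwy := (hw.pos (M.y τ)).le
      calc _ ≤ ∑ b, ‖dressed g (hopMatrix (M.y τ) (u τ)) 0 b‖ * M.w b :=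
            Finset.sum_le_sum fun b _ => le_mul_of_one_le_right (norm_nonneg _) (hw.one_le b)
        _ ≤ 2 * M.β τ * M.w (M.y τ) * Real.exp (2 * wSum M.w (restrictTo (NearAmp (u τ)) g)) :=
            sum_row_dressed_hopMatrix_le hw g _ hv
        _ ≤ 2 * M.β τ * M.w (M.y τ) * Real.exp (2 * ((M.S τ).card * ρ₀)) := by
            gcongr
            exact hS.trans (by gcongr)
        _ = _ := by unfold strength; ring
    · have : hopMatrix (M.y τ) (u τ) = 0 := by
        rw [hu0 τ hn]; ext b c; simp [hopMatrix]
      simp [this, dressed]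
  have hsum : ∑ τ, (if NearAmp (M.v τ) a then 2 * M.strength ρ₀ τ else 0)
      ≤ 2 * δ * M.energy a := by
    calc _ ≤ ∑ τ, ∑ j with M.l j a ≠ 0, if j ∈ M.N τ then 2 * M.strength ρ₀ τ else 0 := by
          refine Finset.sum_le_sum fun τ _ => ?_
          have hs := M.strength_nonneg ρ₀ τ
          have hnn : ∀ j ∈ Finset.univ.filter (fun j => M.l j a ≠ 0),
              0 ≤ if j ∈ M.N τ then 2 * M.strength ρ₀ τ else 0 := fun j _ => by
            split_ifs <;> positivity
          split_ifs with hn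
          · obtain ⟨j, hj, hja⟩ := M.exists_mem_N τ a hn
            refine le_trans (le_of_eq ?_) (Finset.single_le_sum hnn
              (Finset.mem_filter.2 ⟨Finset.mem_univ j, hja⟩))
            rw [if_pos hj]
          · exact Finset.sum_nonneg hnn
      _ = ∑ j with M.l j a ≠ 0, 2 * ∑ τ with j ∈ M.N τ, M.strength ρ₀ τ := by
          rw [Finset.sum_comm]
          refine Finset.sum_congr rfl fun j _ => ?_
          rw [← Finset.sum_filter, Finset.mul_sum]
      _ ≤ ∑ j with M.l j a ≠ 0, 2 * δ :=
          Finset.sum_le_sum fun j _ => mul_le_mul_of_nonneg_left (hM.sum_N_le j) zero_le_two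
      _ = (Finset.univ.filter fun j => M.l j a ≠ 0).card * (2 * δ) := by simp
      _ ≤ M.energy a * (2 * δ) := by
          have := M.card_le_energy a
          gcongr
      _ = _ := by ring
  have hchk : ∑ j with M.l j a ≠ 0, M.lam j * ∑ b, ‖(E j - 1) 0 b‖ ≤ M.energy a / 16 := by
    rw [energy, Finset.sum_div]
    refine Finset.sum_le_sum fun j _ => ?_
    have := mul_le_mul_of_nonneg_left (hEj j) (zero_le_one.trans (M.one_le_lam j))
    linarith
  calc _ ≤ ∑ b, (∑ j with M.l j a ≠ 0, M.lam j * ‖(E j - 1) 0 b‖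
        + ∑ τ, ‖dressed g (hopMatrix (M.y τ) (u τ)) 0 b‖) := by
        refine Finset.sum_le_sum fun b _ => ?_
        rw [hrow]
        refine (norm_add_le _ _).trans (add_le_add ((norm_sum_le _ _).trans
          (Finset.sum_le_sum fun j _ => ?_)) (norm_sum_le _ _))
        rw [norm_mul, Complex.norm_real, Real.norm_of_nonneg (zero_le_one.trans (M.one_le_lam j))]
    _ = ∑ j with M.l j a ≠ 0, M.lam j * ∑ b, ‖(E j - 1) 0 b‖
        + ∑ τ, ∑ b, ‖dressed g (hopMatrix (M.y τ) (u τ)) 0 b‖ := by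
        rw [Finset.sum_add_distrib, Finset.sum_comm, Finset.sum_comm (γ := ι)]
        simp only [Finset.mul_sum]
    _ ≤ M.energy a / 16 + 2 * δ * M.energy a :=
        add_le_add hchk ((Finset.sum_le_sum fun τ _ => hτ τ).trans hsum)
    _ ≤ _ := by nlinarith [M.energy_nonneg a]

end HopModel
end HopModelSpectrum

section HopModelEigenvalues

open scoped Matrix.Norms.Operator
open Matrix

namespace HopModel

variable {n m : ℕ} {ι : Type} {M : HopModel n m ι} {q ε δ ρ₀ : ℝ}

theorem energy_add_eq_zero_iff {a b : F2vec n} (ha : M.energy a = 0) :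
    M.energy (a + b) = 0 ↔ M.energy b = 0 := by
  simp only [energy_eq_zero_iff, map_add] at ha ⊢
  simp only [ha, zero_add]

theorem charpoly_dressed (g : F2vec n → ℂ) (T : Matrix (F2vec n) (F2vec n) ℂ) :
    (dressed g T).charpoly = T.charpoly := by
  have h := exp_mul_exp_neg' (-convMatrix g)
  rw [neg_neg] at h
  rw [dressed, charpoly_mul_comm, ← mul_assoc, h, one_mul]

/-- The eigenvalues of a small Hermitian hopping model form a narrow cluster, with as many
elements as there are zero energy strings, and a part well above it. -/
theorem eigenvalues_ham [Fintype ι] (hM : M.IsSmall q ε δ ρ₀) (hε : 0 ≤ ε) (hρ₀ : 0 < ρ₀)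
    (hq : 64 * q * ρ₀ ≤ 1) (hsmall : ε + 2 * δ * ρ₀ ≤ ρ₀ / 8) (hδ : δ ≤ 1 / 32)
    (hH : M.ham.IsHermitian) {W η : ℝ} (hW : 0 < W)
    (hWle : ∀ u, u ≠ 0 → M.energy u = 0 → W ≤ M.w u)
    (hη : n * (2 * (ε + 2 * δ * ρ₀)) / W ≤ η) (hη' : η < 7 / 8 - η) :
    ∃ c : ℝ, (∀ x, hH.eigenvalues x ∈ Set.Icc (c - η) (c + η) ∨
        c + (7 / 8 - η) ≤ hH.eigenvalues x) ∧
      (Finset.univ.filter fun x => hH.eigenvalues x ≤ c + η).card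
        = Fintype.card {x // M.energy x = 0} := by
  obtain ⟨r, hr, hnl, hzero⟩ := exists_dressing hM hε hρ₀ hq hsmall
  set ρ := 2 * (ε + 2 * δ * ρ₀) with hρdef
  have hδ0 := hM.δ_nonneg
  have hρ : 0 ≤ ρ := by positivity
  have hρρ₀ : ρ ≤ ρ₀ := by rw [hρdef]; linarith
  set T := dressed (M.resolve r) M.ham with hT
  have hrow := sum_row_sub_le hM hρ hρρ₀
    (fun i => (M.root_resolve_le r i).trans (hr i)) hq hδ
  rw [← hT] at hrow
  have hfirst : ∑ b, ‖T 0 b - if b = 0 then T 0 0 else 0‖ ≤ η := by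
    refine le_trans ?_ hη
    rw [le_div_iff₀ hW, Finset.sum_mul]
    calc _ ≤ ∑ b, ∑ i, ‖restrictTo (fun x => x i ≠ 0) (M.nonlin r) b‖ * M.w b := by
          refine Finset.sum_le_sum fun b _ => ?_
          have hnn : ∀ i ∈ Finset.univ,
              0 ≤ ‖restrictTo (fun x => x i ≠ 0) (M.nonlin r) b‖ * M.w b := fun i _ =>
            mul_nonneg (norm_nonneg _) (M.isWeight.pos b).le
          by_cases hb : b = 0
          · simpa [hb] using Finset.sum_nonneg hnn
          by_cases he : M.energy b = 0
          · obtain ⟨i, hi⟩ : ∃ i, b i ≠ 0 := by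
              by_contra hcon
              push Not at hcon
              exact hb (funext hcon)
            refine le_trans ?_ (Finset.single_le_sum hnn (Finset.mem_univ i))
            have e : M.nonlin r b = T 0 b := by
              simp [nonlin, he, hT]
            simp only [restrictTo, hi, hb, ne_eq, not_false_eq_true, if_true, if_false, e, sub_zero]
            have := hWle b hb he
            gcongr
          · rw [if_neg hb, sub_zero, hzero b he, norm_zero, zero_mul]
            exact Finset.sum_nonneg hnn
      _ = ∑ i, M.root (M.nonlin r) i := by
          rw [Finset.sum_comm]; rfl
      _ ≤ n * ρ := by
          refine (Finset.sum_le_card_nsmul _ _ _ fun i _ => hnl i).trans ?_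
          simp
  have hger : ∀ a, ∑ c, ‖T a c - if c = a then T 0 0 + M.energy a else 0‖
      ≤ M.energy a / 8 + η := by
    intro a
    refine le_trans ?_ (add_le_add (hrow a) hfirst)
    rw [← Equiv.sum_comp (Equiv.addLeft a), ← Finset.sum_add_distrib]
    refine Finset.sum_le_sum fun b _ => ?_
    refine le_trans (le_of_eq ?_) (norm_add_le _ _)
    simp only [Equiv.coe_addLeft, add_eq_left]
    congr 1
    split_ifs <;> ring
  have hblock : ∀ i, M.energy i = 0 → ∀ j, ¬ M.energy j = 0 → T i j = 0 := by
    intro i hi j hj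
    have h1 := hrow i
    rw [hi, zero_div] at h1
    have h2 := (Finset.sum_eq_zero_iff_of_nonneg fun b _ => norm_nonneg _).1
      (le_antisymm h1 (Finset.sum_nonneg fun b _ => norm_nonneg _)) (i + j) (Finset.mem_univ _)
    rw [F2vec.add_add_cancel, hzero (i + j) (by rwa [Ne, energy_add_eq_zero_iff hi])] at h2
    simpa using h2
  have hchar : M.ham.charpoly = (T.toSquareBlockProp fun i => M.energy i = 0).charpoly
      * (T.toSquareBlockProp fun i => ¬ M.energy i = 0).charpoly := by
    rw [← charpoly_eq_mul_of_block T _ hblock, hT, charpoly_dressed]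
  have hnear : ∀ μ, (T.toSquareBlockProp fun i => M.energy i = 0).charpoly.IsRoot μ →
      ‖μ - T 0 0‖ ≤ η := by
    intro μ hμ
    obtain ⟨a, ha, h⟩ := exists_norm_sub_le_of_isRoot_charpoly (fun a _ => hger a) hμ
    simpa [ha] using h
  have hfar : ∀ μ, (T.toSquareBlockProp fun i => ¬ M.energy i = 0).charpoly.IsRoot μ →
      (T 0 0).re + (7 / 8 - η) ≤ μ.re := by
    intro μ hμ
    obtain ⟨a, ha, h⟩ := exists_norm_sub_le_of_isRoot_charpoly (fun a _ => hger a) hμ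
    have h1 := M.one_le_energy_of_ne ha
    have h2 := (Complex.abs_re_le_norm _).trans h
    rw [Complex.sub_re, Complex.add_re, Complex.ofReal_re, abs_le] at h2
    linarith [h2.1]
  exact ⟨(T 0 0).re, card_eigenvalues_le_of_charpoly_eq_mul hH hchar hnear hfar hη'⟩

end HopModel
end HopModelEigenvalues

section EigenvaluePerturbation

open Matrix

variable {κ : Type*} [Fintype κ] [DecidableEq κ] {A B : Matrix κ κ ℂ}

theorem re_inner_toEuclideanCLM (hA : A.IsHermitian) (x : EuclideanSpace ℂ κ) :
    (inner ℂ x (toEuclideanCLM (𝕜 := ℂ) A x)).re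
      = ∑ i, hA.eigenvalues i * ‖inner ℂ (hA.eigenvectorBasis i) x‖ ^ 2 := by
  have hsymm := isSymmetric_toEuclideanLin_iff.mpr hA
  have hev : ∀ i, toEuclideanCLM (𝕜 := ℂ) A (hA.eigenvectorBasis i)
      = (hA.eigenvalues i : ℂ) • hA.eigenvectorBasis i := by
    intro i
    have h := hA.mulVec_eigenvectorBasis i
    ext k
    have h' := congrFun h k
    simpa using h'
  rw [← hA.eigenvectorBasis.sum_inner_mul_inner, Complex.re_sum]
  refine Finset.sum_congr rfl fun i _ => ?_
  have h1 : inner ℂ (hA.eigenvectorBasis i) (toEuclideanCLM (𝕜 := ℂ) A x)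
      = (hA.eigenvalues i : ℂ) * inner ℂ (hA.eigenvectorBasis i) x := by
    have := hsymm (hA.eigenvectorBasis i) x
    calc _ = inner ℂ (toEuclideanCLM (𝕜 := ℂ) A (hA.eigenvectorBasis i)) x := this.symm
      _ = _ := by rw [hev, inner_smul_left, Complex.conj_ofReal]
  rw [h1, ← inner_conj_symm x, mul_left_comm, ← Complex.normSq_eq_conj_mul_self,
    ← Complex.ofReal_mul, Complex.ofReal_re, Complex.normSq_eq_norm_sq]

/-- Weyl's inequality, in terms of counting functions. -/
theorem card_eigenvalues_le_card_eigenvalues (hA : A.IsHermitian) (hB : B.IsHermitian) {s : ℝ}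
    (h : ∀ x, (inner ℂ x (toEuclideanCLM (𝕜 := ℂ) B x)).re
      ≤ (inner ℂ x (toEuclideanCLM (𝕜 := ℂ) A x)).re + s * ‖x‖ ^ 2) (t : ℝ) :
    (Finset.univ.filter fun i => hA.eigenvalues i ≤ t).card
      ≤ (Finset.univ.filter fun i => hB.eigenvalues i ≤ t + s).card := by
  by_contra hlt
  push Not at hlt
  set F : EuclideanSpace ℂ κ →ₗ[ℂ]
      ({i // ¬ hA.eigenvalues i ≤ t} ⊕ {i // hB.eigenvalues i ≤ t + s} → ℂ) :=
    LinearMap.pi (Sum.elim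
      (fun i => (innerSL ℂ (hA.eigenvectorBasis i)).toLinearMap)
      (fun i => (innerSL ℂ (hB.eigenvectorBasis i)).toLinearMap)) with hF
  have hker : LinearMap.ker F ≠ ⊥ := by
    refine LinearMap.ker_ne_bot_of_finrank_lt ?_
    rw [Module.finrank_fintype_fun_eq_card, finrank_euclideanSpace, Fintype.card_sum,
      Fintype.card_subtype, Fintype.card_subtype]
    have := Finset.card_filter_add_card_filter_not (s := Finset.univ)
      (fun i => hA.eigenvalues i ≤ t)
    rw [Finset.card_univ] at this
    omega
  obtain ⟨x, hx, hx0⟩ := Submodule.exists_mem_ne_zero_of_ne_bot hker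
  have hxA : ∀ i, ¬ hA.eigenvalues i ≤ t → inner ℂ (hA.eigenvectorBasis i) x = 0 := fun i hi =>
    congrFun (LinearMap.mem_ker.1 hx) (Sum.inl ⟨i, hi⟩)
  have hxB : ∀ i, hB.eigenvalues i ≤ t + s → inner ℂ (hB.eigenvectorBasis i) x = 0 := fun i hi =>
    congrFun (LinearMap.mem_ker.1 hx) (Sum.inr ⟨i, hi⟩)
  have h1 : (inner ℂ x (toEuclideanCLM (𝕜 := ℂ) A x)).re ≤ t * ‖x‖ ^ 2 := by
    rw [re_inner_toEuclideanCLM hA, ← hA.eigenvectorBasis.sum_sq_norm_inner_right x,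
      Finset.mul_sum]
    refine Finset.sum_le_sum fun i _ => ?_
    by_cases hi : hA.eigenvalues i ≤ t
    · gcongr
    · simp [hxA i hi]
  have h2 : (t + s) * ‖x‖ ^ 2 < (inner ℂ x (toEuclideanCLM (𝕜 := ℂ) B x)).re := by
    have hsum := hB.eigenvectorBasis.sum_sq_norm_inner_right x
    rw [re_inner_toEuclideanCLM hB, ← hsum, Finset.mul_sum]
    refine Finset.sum_lt_sum (fun i _ => ?_) ?_
    · by_cases hi : hB.eigenvalues i ≤ t + s
      · simp [hxB i hi]
      · push Not at hi
        gcongr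
    · have hpos : 0 < ∑ i, ‖inner ℂ (hB.eigenvectorBasis i) x‖ ^ 2 := by
        rw [hsum]; positivity
      obtain ⟨i, hi, hi0⟩ := Finset.exists_ne_zero_of_sum_ne_zero hpos.ne'
      refine ⟨i, hi, ?_⟩
      have hib : ¬ hB.eigenvalues i ≤ t + s := fun hle => hi0 (by simp [hxB i hle])
      push Not at hib
      have : 0 < ‖inner ℂ (hB.eigenvectorBasis i) x‖ ^ 2 := lt_of_le_of_ne (by positivity) hi0.symm
      gcongr
  have h3 := h x
  nlinarith

theorem abs_re_inner_sub_le {c η : ℝ}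
    (h : ‖toEuclideanCLM (𝕜 := ℂ) (B - A + (c : ℂ) • (1 : Matrix κ κ ℂ))‖ ≤ η)
    (x : EuclideanSpace ℂ κ) :
    |(inner ℂ x (toEuclideanCLM (𝕜 := ℂ) B x)).re
      - ((inner ℂ x (toEuclideanCLM (𝕜 := ℂ) A x)).re - c * ‖x‖ ^ 2)| ≤ η * ‖x‖ ^ 2 := by
  have h1 := (Complex.abs_re_le_norm _).trans (norm_inner_le_norm (𝕜 := ℂ) x
    (toEuclideanCLM (𝕜 := ℂ) (B - A + (c : ℂ) • (1 : Matrix κ κ ℂ)) x))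
  have h2 := (toEuclideanCLM (𝕜 := ℂ) (B - A + (c : ℂ) • (1 : Matrix κ κ ℂ))).le_of_opNorm_le h x
  have h3 : ‖x‖ * ‖toEuclideanCLM (𝕜 := ℂ) (B - A + (c : ℂ) • (1 : Matrix κ κ ℂ)) x‖
      ≤ η * ‖x‖ ^ 2 := by nlinarith [norm_nonneg x]
  refine le_trans (le_of_eq ?_) (h1.trans h3)
  congr 1
  rw [map_add, map_sub, map_smul, map_one]
  simp only [_root_.add_apply, _root_.sub_apply, _root_.smul_apply, one_apply_eq_self, inner_add_right,
    inner_sub_right, inner_smul_right, Complex.add_re, Complex.sub_re,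
    inner_self_eq_norm_sq_to_K]
  have h4 : (((‖x‖ : ℂ)) ^ 2).re = ‖x‖ ^ 2 := by norm_cast
  have h5 : (((c : ℂ)) * (‖x‖ : ℂ) ^ 2).re = c * ‖x‖ ^ 2 := by rw [Complex.re_ofReal_mul, h4]
  simp only [Complex.coe_algebraMap, h5]
  ring

/-- A narrow cluster of eigenvalues separated by a gap is stable under a small
perturbation. -/
theorem eigenvalues_cluster_perturb (hA : A.IsHermitian) (hB : B.IsHermitian)
    {c η η' γ : ℝ} {N : ℕ}
    (hBA : ‖toEuclideanCLM (𝕜 := ℂ) (B - A + (c : ℂ) • (1 : Matrix κ κ ℂ))‖ ≤ η')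
    (hcl : ∀ i, hA.eigenvalues i ∈ Set.Icc (c - η) (c + η) ∨ c + γ ≤ hA.eigenvalues i)
    (hN : (Finset.univ.filter fun i => hA.eigenvalues i ≤ c + η).card = N)
    (hη : 0 ≤ η) (hgap : η + 2 * η' < γ) :
    (∀ i, hB.eigenvalues i ∈ Set.Icc (-(η + η')) (η + η') ∨ γ - η' ≤ hB.eigenvalues i) ∧
      (Finset.univ.filter fun i => hB.eigenvalues i ∈ Set.Icc (-(η + η')) (η + η')).card = N := by
  have habs := abs_re_inner_sub_le hBA
  have hAB := card_eigenvalues_le_card_eigenvalues hA hB (s := η' - c) fun x => by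
    have := (abs_le.1 (habs x)).2
    linarith
  have hBA' := card_eigenvalues_le_card_eigenvalues hB hA (s := η' + c) fun x => by
    have := (abs_le.1 (habs x)).1
    linarith
  have hlow : ∀ i, -(η + η') ≤ hB.eigenvalues i := by
    intro i
    by_contra hi
    push Not at hi
    have h1 : 0 < (Finset.univ.filter fun j => hB.eigenvalues j ≤ hB.eigenvalues i).card :=
      Finset.card_pos.2 ⟨i, by simp⟩
    have h2 := hBA' (hB.eigenvalues i)
    obtain ⟨j, hj⟩ := Finset.card_pos.1 (h1.trans_le h2)
    have hj' := (Finset.mem_filter.1 hj).2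
    have hη' : 0 ≤ η' := (norm_nonneg _).trans hBA
    rcases hcl j with hj1 | hj1
    · linarith [hj1.1]
    · linarith
  have hge : N ≤ (Finset.univ.filter fun i => hB.eigenvalues i ≤ η + η').card := by
    rw [← hN]
    refine (hAB (c + η)).trans (le_of_eq ?_)
    congr 1
    ext i
    rw [Finset.mem_filter, Finset.mem_filter, show c + η + (η' - c) = η + η' by ring]
  have hle : ∀ t, t < γ - η' → (Finset.univ.filter fun i => hB.eigenvalues i ≤ t).card ≤ N := by
    intro t ht
    rw [← hN]
    refine (hBA' t).trans (Finset.card_le_card fun j hj => ?_)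
    have hj' := (Finset.mem_filter.1 hj).2
    refine Finset.mem_filter.2 ⟨Finset.mem_univ _, ?_⟩
    rcases hcl j with hj1 | hj1
    · exact hj1.2
    · linarith
  refine ⟨fun i => ?_, ?_⟩
  · by_cases h1 : hB.eigenvalues i ≤ η + η'
    · exact Or.inl ⟨hlow i, h1⟩
    · right
      by_contra h2
      push Not at h1 h2
      have h3 := hle _ h2
      have h4 : (Finset.univ.filter fun j => hB.eigenvalues j ≤ η + η').card
          < (Finset.univ.filter fun j => hB.eigenvalues j ≤ hB.eigenvalues i).card := by
        refine Finset.card_lt_card ⟨fun j hj => ?_, fun hsub => ?_⟩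
        · exact Finset.mem_filter.2 ⟨Finset.mem_univ _, (Finset.mem_filter.1 hj).2.trans h1.le⟩
        · have := hsub (Finset.mem_filter.2 ⟨Finset.mem_univ i, le_rfl⟩)
          exact absurd (Finset.mem_filter.1 this).2 (not_le.2 h1)
      omega
  · have : (Finset.univ.filter fun i => hB.eigenvalues i ∈ Set.Icc (-(η + η')) (η + η'))
        = Finset.univ.filter fun i => hB.eigenvalues i ≤ η + η' := by
      ext i
      rw [Finset.mem_filter, Finset.mem_filter, Set.mem_Icc]
      simp only [hlow i, true_and]
    rw [this]
    exact le_antisymm (hle _ (by linarith)) hge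

end EigenvaluePerturbation

section CheckLocality

/-- A set of vectors that is of minimum cardinality among those with the same sum. -/
def IsMinSum {m n : ℕ} (h : Fin m → F2vec n) (T : Finset (Fin m)) : Prop :=
  ∀ T' : Finset (Fin m), ∑ j ∈ T', h j = ∑ j ∈ T, h j → T.card ≤ T'.card

variable {m n : ℕ} {h : Fin m → F2vec n}

theorem exists_isMinSum (h : Fin m → F2vec n) (T : Finset (Fin m)) :
    ∃ T', ∑ j ∈ T', h j = ∑ j ∈ T, h j ∧ IsMinSum h T' := by
  obtain ⟨T', hT', hmin⟩ := Finset.exists_min_image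
    (Finset.univ.filter fun T' => ∑ j ∈ T', h j = ∑ j ∈ T, h j) Finset.card ⟨T, by simp⟩
  have hT'' := (Finset.mem_filter.1 hT').2
  exact ⟨T', hT'', fun T'' h'' => hmin T'' (by simp [h''.trans hT''])⟩

theorem sum_symmDiff_eq_add (h : Fin m → F2vec n) (A B : Finset (Fin m)) :
    ∑ j ∈ symmDiff A B, h j = ∑ j ∈ A, h j + ∑ j ∈ B, h j := by
  have h1 : ∑ j ∈ symmDiff A B, h j = ∑ j ∈ A \ B, h j + ∑ j ∈ B \ A, h j := by
    rw [symmDiff_def, Finset.sup_eq_union, Finset.sum_union]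
    exact disjoint_sdiff_sdiff
  have h2 := Finset.sum_inter_add_sum_sdiff A B h
  have h3 := Finset.sum_inter_add_sum_sdiff B A h
  rw [h1, ← h2, ← h3, Finset.inter_comm B A]
  have := F2vec.add_self (∑ j ∈ A ∩ B, h j)
  calc _ = (∑ j ∈ A ∩ B, h j + ∑ j ∈ A ∩ B, h j) + (∑ j ∈ A \ B, h j + ∑ j ∈ B \ A, h j) := by
        rw [this, zero_add]
    _ = _ := by abel

theorem IsMinSum.subset {T U : Finset (Fin m)} (hT : IsMinSum h T) (hU : U ⊆ T) :
    IsMinSum h U := by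
  intro U' hU'
  have h1 := hT (symmDiff (T \ U) U') (by
    rw [sum_symmDiff_eq_add, hU', Finset.sum_sdiff hU])
  have h2 : (symmDiff (T \ U) U').card ≤ (T \ U).card + U'.card := by
    refine (Finset.card_le_card ?_).trans (Finset.card_union_le _ _)
    intro j hj
    rw [Finset.mem_symmDiff] at hj
    rw [Finset.mem_union]
    tauto
  have h3 := Finset.card_sdiff_add_card_eq_card hU
  omega

variable {G : SimpleGraph (Fin n)} {f finv : ℝ → ℝ} {dc ds : ℝ} {q : ℕ}

theorem finv_mono (hf : StrictMonoOn f (Set.Ici 0)) (hfinv : ∀ x, 0 ≤ x → 0 ≤ finv x)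
    (hffinv : ∀ x, 0 ≤ x → f (finv x) = x) {x y : ℝ} (hx : 0 ≤ x) (hxy : x ≤ y) :
    finv x ≤ finv y := by
  rw [← hf.le_iff_le (hfinv x hx) (hfinv y (hx.trans hxy)), hffinv x hx, hffinv y (hx.trans hxy)]
  exact hxy

theorem ftilde_nonneg (hf0 : ∀ x, 0 ≤ x → 0 ≤ f x) (hfinv : ∀ x, 0 ≤ x → 0 ≤ finv x)
    (hds : 0 ≤ ds) (r : ℕ) : 0 ≤ ftilde f finv ds q r := by
  have h1 : ∀ r, 0 ≤ ftilde f finv ds q (r + 1) := by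
    intro r
    induction r with
    | zero => exact hfinv 1 zero_le_one
    | succ r ih =>
      refine hfinv _ (add_nonneg (hf0 _ ih) ?_)
      exact div_nonneg (le_min hds ih) (Nat.cast_nonneg q)
  rcases r with _ | r
  · exact hfinv 1 zero_le_one
  · exact h1 r

/-- The checks of a minimal set reach out of every region in which their sum vanishes, at the
rate prescribed by the soundness function. -/
theorem exists_reachable_mem_support
    (hG : ∀ k i i', h k i ≠ 0 → h k i' ≠ 0 → i ≠ i' → G.Adj i i')
    (hq : ∀ k, hamWt (h k) ≤ q) (hq0 : 0 < q)
    (hf : StrictMonoOn f (Set.Ici 0)) (hf0 : ∀ x, 0 ≤ x → 0 ≤ f x)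
    (hfinv : ∀ x, 0 ≤ x → 0 ≤ finv x) (hfinvf : ∀ x, 0 ≤ x → finv (f x) = x)
    (hffinv : ∀ x, 0 ≤ x → f (finv x) = x)
    (hsound : ∀ T : Finset (Fin m), (hamWt (∑ j ∈ T, h j) : ℝ) < dc →
      ∃ T' : Finset (Fin m), ∑ j ∈ T', h j = ∑ j ∈ T, h j ∧
        (T'.card : ℝ) ≤ f (hamWt (∑ j ∈ T, h j)))
    (hds : 0 < ds) (hdsc : ds ≤ dc) {T : Finset (Fin m)} (hT : IsMinSum h T)
    {S : Finset (Fin n)} (hS : ∀ i, (∑ j ∈ T, h j) i ≠ 0 → i ∈ S) (hSdc : (S.card : ℝ) < dc)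
    {j : Fin m} (hj : j ∈ T) {i₀ : Fin n} (hi₀ : h j i₀ ≠ 0) :
    ∃ i ∈ S, G.Reachable i₀ i ∧
      (G.dist i₀ i = 0 ∨ ftilde f finv ds q (G.dist i₀ i) ≤ S.card) := by
  have hsound' : ∀ U, IsMinSum h U → (hamWt (∑ j ∈ U, h j) : ℝ) < dc →
      (U.card : ℝ) ≤ f (hamWt (∑ j ∈ U, h j)) := fun U hU hlt => by
    obtain ⟨T', hT', hle⟩ := hsound U hlt
    exact le_trans (by exact_mod_cast hU T' hT') hle
  -- the checks of `T` that meet the ball of radius `r`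
  set U : ℕ → Finset (Fin m) := fun r =>
    T.filter fun k => ∃ i, h k i ≠ 0 ∧ i ∈ gBall G i₀ r with hU
  have hUT : ∀ r, U r ⊆ T := fun r => Finset.filter_subset _ _
  have hUmono : ∀ r, U r ⊆ U (r + 1) := by
    intro r k hk
    obtain ⟨hkT, i, hki, hir⟩ := Finset.mem_filter.1 hk
    refine Finset.mem_filter.2 ⟨hkT, i, hki, ?_⟩
    have := (Finset.mem_filter.1 hir).2
    exact Finset.mem_filter.2 ⟨Finset.mem_univ _, this.1, this.2.trans (Nat.le_succ r)⟩
  have hUball : ∀ r, ∀ k ∈ U r, ∀ i, h k i ≠ 0 → i ∈ gBall G i₀ (r + 1) := by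
    intro r k hk i hki
    obtain ⟨hkT, i', hki', hir⟩ := Finset.mem_filter.1 hk
    obtain ⟨hreach, hdist⟩ := (Finset.mem_filter.1 hir).2
    refine Finset.mem_filter.2 ⟨Finset.mem_univ _, ?_⟩
    by_cases hii : i' = i
    · subst hii
      exact ⟨hreach, hdist.trans (Nat.le_succ r)⟩
    · have hadj := hG k i' i hki' hki hii
      refine ⟨hreach.trans hadj.reachable, ?_⟩
      obtain ⟨p, hp⟩ := hreach.exists_walk_length_eq_dist
      refine (SimpleGraph.dist_le (p.concat hadj)).trans ?_
      rw [SimpleGraph.Walk.length_concat, hp]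
      omega
  have hbd : ∀ r, min ds (finv (U r).card) ≤ hamWt (∑ j ∈ U r, h j) := by
    intro r
    by_cases hlt : (hamWt (∑ j ∈ U r, h j) : ℝ) < dc
    · have h1 := hsound' (U r) (hT.subset (hUT r)) hlt
      refine (min_le_right _ _).trans ?_
      rw [← hfinvf (hamWt (∑ j ∈ U r, h j)) (Nat.cast_nonneg _)]
      exact finv_mono hf hfinv hffinv (Nat.cast_nonneg _) h1
    · exact (min_le_left _ _).trans (hdsc.trans (not_lt.1 hlt))
  have hstep : ∀ r, (∀ i ∈ S, ¬ (G.Reachable i₀ i ∧ G.dist i₀ i ≤ r + 1)) →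
      (U r).card + min ds (finv (U r).card) / q ≤ (U (r + 1)).card := by
    intro r hr
    have hcov : (Finset.univ.filter fun i => (∑ j ∈ U r, h j) i ≠ 0)
        ⊆ (U (r + 1) \ U r).biUnion fun k => Finset.univ.filter fun i => h k i ≠ 0 := by
      intro i hi
      have hi' := (Finset.mem_filter.1 hi).2
      have hball : i ∈ gBall G i₀ (r + 1) := by
        rw [Finset.sum_apply] at hi'
        obtain ⟨k, hk, hki⟩ := Finset.exists_ne_zero_of_sum_ne_zero hi'
        exact hUball r k hk i hki
      have hTi : (∑ j ∈ T, h j) i = 0 := by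
        by_contra hne
        exact hr i (hS i hne) (Finset.mem_filter.1 hball).2
      rw [← Finset.sum_sdiff (hUT r), Pi.add_apply] at hTi
      have hrest : (∑ j ∈ T \ U r, h j) i ≠ 0 := by
        intro h0
        rw [h0, zero_add] at hTi
        exact hi' hTi
      rw [Finset.sum_apply] at hrest
      obtain ⟨k, hk, hki⟩ := Finset.exists_ne_zero_of_sum_ne_zero hrest
      obtain ⟨hkT, hkU⟩ := Finset.mem_sdiff.1 hk
      refine Finset.mem_biUnion.2 ⟨k, Finset.mem_sdiff.2 ⟨Finset.mem_filter.2
        ⟨hkT, i, hki, hball⟩, hkU⟩, Finset.mem_filter.2 ⟨Finset.mem_univ _, hki⟩⟩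
    have hcard : hamWt (∑ j ∈ U r, h j) ≤ (U (r + 1) \ U r).card * q :=
      (Finset.card_le_card hcov).trans (Finset.card_biUnion_le_card_mul _ _ _ fun k _ => hq k)
    have h1 := Finset.card_sdiff_add_card_eq_card (hUmono r)
    have h2 : (hamWt (∑ j ∈ U r, h j) : ℝ) ≤ (U (r + 1) \ U r).card * (q : ℝ) := by
      exact_mod_cast hcard
    have h3 : ((U (r + 1) \ U r).card : ℝ) + (U r).card = (U (r + 1)).card := by
      exact_mod_cast h1
    have hq0' : (0 : ℝ) < q := by exact_mod_cast hq0
    have h4 : min ds (finv (U r).card) / q ≤ (U (r + 1) \ U r).card :=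
      (div_le_iff₀ hq0').2 ((hbd r).trans h2)
    linarith
  have hU0 : 1 ≤ (U 0).card :=
    Finset.card_pos.2 ⟨j, Finset.mem_filter.2 ⟨hj, i₀, hi₀,
      Finset.mem_filter.2 ⟨Finset.mem_univ _, SimpleGraph.Reachable.refl _, by simp⟩⟩⟩
  have hq0' : (0 : ℝ) < q := by exact_mod_cast hq0
  have hf00 : f 0 = 0 := by
    have h0 := hf.monotoneOn (Set.mem_Ici.2 le_rfl) (Set.mem_Ici.2 (hfinv 0 le_rfl))
      (hfinv 0 le_rfl)
    rw [hffinv 0 le_rfl] at h0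
    exact le_antisymm h0 (hf0 0 le_rfl)
  -- some point of `S` is reachable
  have hreach : ∃ i ∈ S, G.Reachable i₀ i := by
    by_contra hno
    push Not at hno
    have hgrow : ∀ r, r + 1 ≤ (U r).card := by
      intro r
      induction r with
      | zero => exact hU0
      | succ r ih =>
        have h1 := hstep r fun i hi hi' => hno i hi hi'.1
        have h2 : 0 < finv (U r).card := by
          refine lt_of_le_of_ne (hfinv _ (Nat.cast_nonneg _)) fun h0 => ?_
          have h3 := hffinv (U r).card (Nat.cast_nonneg _)
          rw [← h0, hf00] at h3
          have : (U r).card = 0 := by exact_mod_cast h3.symm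
          omega
        have h4 : 0 < min ds (finv (U r).card) / q := div_pos (lt_min hds h2) hq0'
        have h5 : ((U r).card : ℝ) < (U (r + 1)).card := by linarith
        have h6 : (U r).card < (U (r + 1)).card := by exact_mod_cast h5
        omega
    have h1 := hgrow m
    have h2 := Finset.card_le_univ (U m)
    rw [Fintype.card_fin] at h2
    omega
  -- a closest such point
  obtain ⟨i, hi, hmin⟩ := Finset.exists_min_image (S.filter fun i => G.Reachable i₀ i)
    (G.dist i₀) (by obtain ⟨i, hi, hr⟩ := hreach; exact ⟨i, Finset.mem_filter.2 ⟨hi, hr⟩⟩)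
  obtain ⟨hiS, hir⟩ := Finset.mem_filter.1 hi
  refine ⟨i, hiS, hir, ?_⟩
  set D := G.dist i₀ i with hD
  rcases Nat.eq_zero_or_pos D with h0 | hpos
  · exact Or.inl h0
  right
  have hft : ∀ r, 0 ≤ ftilde f finv ds q r := ftilde_nonneg hf0 hfinv hds.le
  have hgrow : ∀ r, r + 1 ≤ D → f (ftilde f finv ds q (r + 1)) ≤ (U r).card := by
    intro r
    induction r with
    | zero =>
      intro _
      change f (finv 1) ≤ _
      rw [hffinv 1 zero_le_one]
      exact_mod_cast hU0
    | succ r ih =>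
      intro hr
      have ih' := ih (by omega)
      have h1 := hstep r fun i' hi' hi'' => by
        have := hmin i' (Finset.mem_filter.2 ⟨hi', hi''.1⟩)
        omega
      change f (finv (f (ftilde f finv ds q (r + 1))
        + min ds (ftilde f finv ds q (r + 1)) / q)) ≤ _
      have h2 : 0 ≤ f (ftilde f finv ds q (r + 1)) := hf0 _ (hft _)
      have h3 : ftilde f finv ds q (r + 1) ≤ finv (U r).card := by
        rw [← hfinvf _ (hft (r + 1))]
        exact finv_mono hf hfinv hffinv h2 ih'
      rw [hffinv _ (add_nonneg h2 (div_nonneg (le_min hds.le (hft _)) hq0'.le))]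
      refine le_trans (add_le_add ih' ?_) h1
      gcongr
  obtain ⟨r, hr⟩ : ∃ r, D = r + 1 := ⟨D - 1, by omega⟩
  have h1 := hgrow r hr.ge
  rw [← hr] at h1
  have h2 : hamWt (∑ j ∈ T, h j) ≤ S.card :=
    Finset.card_le_card fun i hi => hS i (Finset.mem_filter.1 hi).2
  have h2' : (hamWt (∑ j ∈ T, h j) : ℝ) ≤ S.card := by exact_mod_cast h2
  have h3 := hsound' T hT (h2'.trans_lt hSdc)
  have h4 : ((U r).card : ℝ) ≤ T.card := by exact_mod_cast Finset.card_le_card (hUT r)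
  have h5 : f (ftilde f finv ds q D) ≤ f (hamWt (∑ j ∈ T, h j)) := h1.trans (h4.trans h3)
  rw [hf.le_iff_le (hft D) (Set.mem_Ici.2 (Nat.cast_nonneg _))] at h5
  exact h5.trans h2'

end CheckLocality

section TermStructure

variable {m n : ℕ} {Hm : Matrix (Fin m) (Fin n) (ZMod 2)}

theorem zmod_two_ne_zero_iff {t : ZMod 2} : t ≠ 0 ↔ t = 1 := by
  rcases zmod_two_eq t with rfl | rfl <;> decide

theorem sympl_zType (p : F2vec n × F2vec n) (z : F2vec n) :
    sympl p ((0 : F2vec n), z) = ∑ i, z i * p.1 i := by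
  simp [sympl, mul_comm]

theorem pauli_apply_add (p : F2vec n × F2vec n) (b : F2vec n) :
    pauli p (b + p.1) b =
      Complex.I ^ (Finset.univ.filter fun i => p.1 i = 1 ∧ p.2 i = 1).card *
        (-1 : ℂ) ^ (∑ i, (p.2 i).val * (b i).val) := by
  simp [pauli]

theorem pauli_xType_apply (u a b : F2vec n) :
    pauli (u, (0 : F2vec n)) a b = if a = b + u then 1 else 0 := by
  simp [pauli]

theorem mul_pauli_xType (A : Matrix (F2vec n) (F2vec n) ℂ) (u a b : F2vec n) :
    (A * pauli (u, (0 : F2vec n))) a b = A a (b + u) := by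
  simp [Matrix.mul_apply, pauli_xType_apply]

theorem pauli_xType_mul (A : Matrix (F2vec n) (F2vec n) ℂ) (u a b : F2vec n) :
    (pauli (u, (0 : F2vec n)) * A) a b = A (a + u) b := by
  have h : ∀ c : F2vec n, (a = c + u) = (c = a + u) := fun c => propext F2vec.eq_add_comm
  simp [Matrix.mul_apply, pauli_xType_apply, h]

theorem norm_apply_le_opNorm (A : Matrix (F2vec n) (F2vec n) ℂ) (a b : F2vec n) :
    ‖A a b‖ ≤ opNorm A := by
  have h1 := (Matrix.toEuclideanCLM (𝕜 := ℂ) A).le_opNorm (EuclideanSpace.single b 1)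
  have h2 : (Matrix.toEuclideanCLM (𝕜 := ℂ) A (EuclideanSpace.single b 1)) a = A a b := by
    rw [Matrix.ofLp_toEuclideanCLM]
    simp
  rw [PiLp.norm_single, norm_one, mul_one] at h1
  rw [← h2]
  exact (PiLp.norm_apply_le _ a).trans h1

/-- A strongly supported term smaller than the code distance and commuting with the symmetries
flips a fixed set of bits, with an amplitude that is local and invariant under codewords. -/
theorem exists_eq_hopMatrix {C : Fin m → F2vec n × F2vec n}
    (hC : C = fun j => ((0 : F2vec n), fun i => Hm j i)) {A : Matrix (F2vec n) (F2vec n) ℂ}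
    {S : Finset (Fin n)} {s : Finset (Fin m)} (hA : StronglySupported C A S s)
    (hd : ∀ u : F2vec n, u ≠ 0 → Hm.mulVec u = 0 → S.card < hamWt u)
    (hcomm : ∀ u : F2vec n, Hm.mulVec u = 0 →
      A * pauli (u, (0 : F2vec n)) = pauli (u, (0 : F2vec n)) * A) :
    ∃ (y : F2vec n) (v : F2vec n → ℂ), A = hopMatrix y v ∧ (∀ i, i ∉ S → y i = 0) ∧
      (∀ b, ‖v b‖ ≤ opNorm A) ∧
      (∀ t : F2vec n, (∀ i ∈ S, t i = 0) → ∀ b, v (b + t) = v b) ∧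
      ∀ u : F2vec n, Hm.mulVec u = 0 → ∀ b, v (b + u) = v b := by
  obtain ⟨y, hyS, hgen⟩ : ∃ y : F2vec n, (∀ i, i ∉ S → y i = 0) ∧
      ∀ p : F2vec n × F2vec n, pSupp p ⊆ S → syndrome C p = s → p.1 = y := by
    by_cases hp : ∃ p : F2vec n × F2vec n, pSupp p ⊆ S ∧ syndrome C p = s
    · obtain ⟨p₀, hp₀S, hp₀⟩ := hp
      have hout : ∀ p : F2vec n × F2vec n, pSupp p ⊆ S → ∀ i, i ∉ S → p.1 i = 0 := by
        intro p hpS i hi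
        by_contra hne
        exact hi (hpS (Finset.mem_filter.2 ⟨Finset.mem_univ _, Or.inl hne⟩))
      refine ⟨p₀.1, hout p₀ hp₀S, fun p hpS hp => ?_⟩
      have hsy : ∀ j, Hm.mulVec p.1 j = Hm.mulVec p₀.1 j := by
        intro j
        have h1 : (sympl p (C j) = 1) ↔ (sympl p₀ (C j) = 1) := by
          have := congrArg (fun s => j ∈ s) (hp.trans hp₀.symm)
          simpa [syndrome] using this
        have h2 : ∀ p : F2vec n × F2vec n, sympl p (C j) = Hm.mulVec p.1 j := by
          intro p
          rw [hC, sympl_zType]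
          rfl
        rw [h2, h2] at h1
        rcases zmod_two_eq (Hm.mulVec p.1 j) with h | h <;>
          rcases zmod_two_eq (Hm.mulVec p₀.1 j) with h' | h' <;> simp_all
      by_contra hne
      have h0 : p.1 + p₀.1 ≠ 0 := by
        intro h
        apply hne
        have := F2vec.add_add_cancel p₀.1 p.1
        rw [add_comm p₀.1 p.1, h, add_zero] at this
        exact this.symm
      have h1 : Hm.mulVec (p.1 + p₀.1) = 0 := by
        rw [Matrix.mulVec_add]
        ext j
        rw [Pi.add_apply, hsy]
        exact CharTwo.add_self_eq_zero _
      have h2 := hd _ h0 h1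
      have h3 : hamWt (p.1 + p₀.1) ≤ S.card := by
        refine Finset.card_le_card fun i hi => ?_
        by_contra hiS
        refine (Finset.mem_filter.1 hi).2 ?_
        rw [Pi.add_apply, hout p hpS i hiS, hout p₀ hp₀S i hiS, add_zero]
      omega
    · exact ⟨0, fun _ _ => rfl, fun p h1 h2 => absurd ⟨p, h1, h2⟩ hp⟩
  have hstr : (∀ a b, a ≠ b + y → A a b = 0) ∧
      ∀ t : F2vec n, (∀ i ∈ S, t i = 0) → ∀ b, A (b + t + y) (b + t) = A (b + y) b := by
    refine Submodule.span_induction (p := fun A _ => (∀ a b, a ≠ b + y → A a b = 0) ∧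
      ∀ t : F2vec n, (∀ i ∈ S, t i = 0) → ∀ b, A (b + t + y) (b + t) = A (b + y) b)
      ?_ ?_ ?_ ?_ hA.1
    · rintro B ⟨p, rfl, hpS, hps⟩
      obtain rfl := hgen p hpS hps
      refine ⟨fun a b hab => if_neg hab, fun t ht b => ?_⟩
      rw [pauli_apply_add, pauli_apply_add]
      congr 2
      refine Finset.sum_congr rfl fun i _ => ?_
      by_cases hi : i ∈ S
      · rw [Pi.add_apply, ht i hi, add_zero]
      · have : p.2 i = 0 := by
          by_contra hne
          exact hi (hpS (Finset.mem_filter.2 ⟨Finset.mem_univ _, Or.inr hne⟩))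
        rw [this, ZMod.val_zero, zero_mul, zero_mul]
    · simp
    · rintro B B' - - ⟨h1, h2⟩ ⟨h1', h2'⟩
      refine ⟨fun a b hab => ?_, fun t ht b => ?_⟩
      · rw [Matrix.add_apply, h1 a b hab, h1' a b hab, add_zero]
      · rw [Matrix.add_apply, Matrix.add_apply, h2 t ht, h2' t ht]
    · rintro c B - ⟨h1, h2⟩
      refine ⟨fun a b hab => ?_, fun t ht b => ?_⟩
      · rw [Matrix.smul_apply, h1 a b hab, smul_zero]
      · rw [Matrix.smul_apply, Matrix.smul_apply, h2 t ht]
  refine ⟨y, fun b => A (b + y) b, ?_, hyS, fun b => norm_apply_le_opNorm _ _ _, hstr.2, ?_⟩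
  · ext a b
    simp only [hopMatrix]
    split_ifs with h
    · rw [h]
    · exact hstr.1 a b h
  · intro u hu b
    have h1 := congrFun (congrFun (hcomm u hu) (b + y + u)) b
    rw [mul_pauli_xType, pauli_xType_mul, add_assoc (b + y), F2vec.add_self, add_zero] at h1
    change A (b + u + y) (b + u) = A (b + y) b
    rw [← h1, add_right_comm]

/-- A flip pattern that is not the sum of a codeword and a pattern away from `S` is detected by
a check of some minimal set of checks whose sum is supported in `S`. -/
theorem exists_isMinSum_mulVec_ne_zero {S : Finset (Fin n)} {x : F2vec n}
    (hx : ∀ u t : F2vec n, Hm.mulVec u = 0 → (∀ i ∈ S, t i = 0) → u + t ≠ x) :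
    ∃ (T : Finset (Fin m)) (j : Fin m), IsMinSum (fun j i => Hm j i) T ∧
      (∀ i, (∑ j ∈ T, (fun i => Hm j i)) i ≠ 0 → i ∈ S) ∧ j ∈ T ∧ Hm.mulVec x j ≠ 0 := by
  set P : Submodule (ZMod 2) (F2vec n) :=
    { carrier := {t | ∀ i ∈ S, t i = 0}
      add_mem' := fun {t t'} h h' i hi => by
        rw [Pi.add_apply, h i hi, h' i hi, add_zero]
      zero_mem' := fun _ _ => rfl
      smul_mem' := fun c t h i hi => by rw [Pi.smul_apply, h i hi, smul_zero] } with hP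
  have hxU : x ∉ LinearMap.ker Hm.mulVecLin ⊔ P := by
    intro h
    obtain ⟨u, hu, t, ht, hut⟩ := Submodule.mem_sup.1 h
    exact hx u t hu ht hut
  obtain ⟨φ, hφx, hφ⟩ := Submodule.exists_le_ker_of_notMem hxU
  have hker : φ ∈ LinearMap.range Hm.mulVecLin.dualMap := by
    rw [LinearMap.range_dualMap_eq_dualAnnihilator_ker, Submodule.mem_dualAnnihilator]
    exact fun w hw => hφ (Submodule.mem_sup_left hw)
  obtain ⟨ψ, rfl⟩ := hker
  set T₀ : Finset (Fin m) := Finset.univ.filter fun j => ψ (Pi.single j 1) ≠ 0 with hT₀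
  have hval : ∀ z, Hm.mulVecLin.dualMap ψ z = ∑ i, (∑ j ∈ T₀, (fun i => Hm j i)) i * z i := by
    intro z
    have h1 : Hm.mulVecLin.dualMap ψ z = ∑ j ∈ T₀, Hm.mulVec z j := by
      rw [LinearMap.dualMap_apply, LinearMap.pi_apply_eq_sum_univ ψ, hT₀, Finset.sum_filter]
      refine Finset.sum_congr rfl fun j _ => ?_
      have : (fun k => if j = k then (1 : ZMod 2) else 0) = Pi.single j 1 := by
        ext k
        simp [Pi.single_apply, eq_comm]
      rw [this]
      split_ifs with h
      · rw [zmod_two_ne_zero_iff.1 h, smul_eq_mul, mul_one]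
        rfl
      · rw [not_not.1 h, smul_zero]
    rw [h1]
    simp only [Matrix.mulVec, dotProduct, Finset.sum_apply, Finset.sum_mul]
    exact Finset.sum_comm
  obtain ⟨T, hTsum, hTmin⟩ := exists_isMinSum (fun j i => Hm j i) T₀
  have hsupp : ∀ i, (∑ j ∈ T, (fun i => Hm j i)) i ≠ 0 → i ∈ S := by
    intro i hi
    by_contra hiS
    apply hi
    rw [hTsum]
    have h1 : Pi.single i (1 : ZMod 2) ∈ LinearMap.ker (Hm.mulVecLin.dualMap ψ) := by
      refine hφ (Submodule.mem_sup_right fun i' hi' => ?_)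
      rw [Pi.single_apply, if_neg]
      rintro rfl
      exact hiS hi'
    rw [LinearMap.mem_ker, hval] at h1
    simpa [Pi.single_apply] using h1
  have hne : ∑ j ∈ T, Hm.mulVec x j ≠ 0 := by
    have h2 : ∑ j ∈ T, Hm.mulVec x j = Hm.mulVecLin.dualMap ψ x := by
      rw [hval, ← hTsum]
      simp only [Matrix.mulVec, dotProduct, Finset.sum_apply, Finset.sum_mul]
      exact Finset.sum_comm
    rw [h2]
    exact hφx
  obtain ⟨j, hj, hjx⟩ := Finset.exists_ne_zero_of_sum_ne_zero hne
  exact ⟨T, j, hTmin, hsupp, hj, hjx⟩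

end TermStructure

section CodeModel

variable {m n : ℕ}

theorem gBall_mono (G : SimpleGraph (Fin n)) (i : Fin n) {r r' : ℕ} (h : r ≤ r') :
    gBall G i r ⊆ gBall G i r' := fun _ hj =>
  have hj' := (Finset.mem_filter.1 hj).2
  Finset.mem_filter.2 ⟨Finset.mem_univ _, hj'.1, hj'.2.trans h⟩

theorem card_dist_eq_le_gammaMax (G : SimpleGraph (Fin n)) (i : Fin n) {r : ℕ} (hr : r ≠ 0) :
    (Finset.univ.filter fun j => G.Reachable i j ∧ G.dist i j = r).card ≤ gammaMax G r := by
  have h1 : (Finset.univ.filter fun j => G.Reachable i j ∧ G.dist i j = r)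
      ⊆ gBall G i r \ gBall G i (r - 1) := by
    intro j hj
    obtain ⟨hj1, hj2⟩ := (Finset.mem_filter.1 hj).2
    refine Finset.mem_sdiff.2 ⟨Finset.mem_filter.2 ⟨Finset.mem_univ _, hj1, hj2.le⟩, fun hj' => ?_⟩
    have := (Finset.mem_filter.1 hj').2.2
    omega
  refine (Finset.card_le_card h1).trans ?_
  rw [Finset.card_sdiff_of_subset (gBall_mono G i (Nat.sub_le r 1)), gammaMax, if_neg hr]
  exact Finset.le_sup (f := fun i => (gBall G i r).card - (gBall G i (r - 1)).card)
    (Finset.mem_univ i)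

/-- Terms whose supports approach a fixed qubit at the rate of a summable radius function have
small total strength. -/
theorem sum_exp_le_of_reachable {G : SimpleGraph (Fin n)} {F : ℕ → ℝ} {ds κ ε B : ℝ}
    (hκ : 0 < κ)
    (hB : ∀ R : ℕ, (∑ r ∈ Finset.Icc 1 R,
      if F r < ds then (gammaMax G r : ℝ) * Real.exp (-(κ / 4 * F r)) else 0) ≤ B)
    {g : Finset (Fin n) → ℝ} (hg : ∀ S, 0 ≤ g S) (hε : 0 ≤ ε)
    (hgε : ∀ i, ∑ S with i ∈ S, g S * Real.exp (κ * S.card) ≤ ε)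
    (hgds : ∀ S, g S ≠ 0 → (S.card : ℝ) < ds) {i₀ : Fin n} {A : Finset (Finset (Fin n))}
    (hA : ∀ S ∈ A, g S ≠ 0 → ∃ i ∈ S, G.Reachable i₀ i ∧
      (G.dist i₀ i = 0 ∨ F (G.dist i₀ i) ≤ S.card)) :
    ∑ S ∈ A, g S * Real.exp (3 / 4 * κ * S.card) ≤ (1 + B) * ε := by
  set W : ℕ → ℝ := fun r => if r = 0 then 1 else
    if F r < ds then Real.exp (-(κ / 4 * F r)) else 0 with hW
  have hW0 : ∀ r, 0 ≤ W r := by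
    intro r
    simp only [hW]
    split_ifs <;> positivity
  set Rs := Finset.univ.filter fun i => G.Reachable i₀ i with hRs
  have hpt : ∀ S ∈ A, g S * Real.exp (3 / 4 * κ * S.card) ≤
      ∑ i ∈ Rs, W (G.dist i₀ i) * if i ∈ S then g S * Real.exp (κ * S.card) else 0 := by
    intro S hS
    have hnn : ∀ i ∈ Rs, 0 ≤ W (G.dist i₀ i) *
        if i ∈ S then g S * Real.exp (κ * S.card) else 0 := by
      intro i _
      refine mul_nonneg (hW0 _) ?_
      split_ifs
      · exact mul_nonneg (hg S) (Real.exp_pos _).le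
      · exact le_rfl
    by_cases hgS : g S = 0
    · rw [hgS, zero_mul]
      rw [hgS] at hnn
      exact Finset.sum_nonneg hnn
    obtain ⟨i, hi, hreach, hdist⟩ := hA S hS hgS
    refine le_trans ?_ (Finset.single_le_sum hnn
      (Finset.mem_filter.2 ⟨Finset.mem_univ i, hreach⟩))
    rw [if_pos hi]
    have hcard : (0 : ℝ) ≤ S.card := Nat.cast_nonneg _
    have hWi : Real.exp (-(κ / 4 * S.card)) ≤ W (G.dist i₀ i) := by
      simp only [hW]
      split_ifs with h1 h2
      · rw [Real.exp_le_one_iff]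
        nlinarith
      · rw [Real.exp_le_exp]
        have := hdist.resolve_left h1
        nlinarith
      · exact absurd ((hdist.resolve_left h1).trans_lt (hgds S hgS)) h2
    calc g S * Real.exp (3 / 4 * κ * S.card)
        = Real.exp (-(κ / 4 * S.card)) * (g S * Real.exp (κ * S.card)) := by
          rw [mul_left_comm, ← Real.exp_add]
          congr 2
          ring
      _ ≤ _ := by
          gcongr
          exact mul_nonneg (hg S) (Real.exp_pos _).le
  have hsumW : ∑ i ∈ Rs, W (G.dist i₀ i) ≤ 1 + B := by
    set R := Rs.sup (G.dist i₀) with hR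
    have hmaps : ∀ i ∈ Rs, G.dist i₀ i ∈ Finset.range (R + 1) := fun i hi =>
      Finset.mem_range.2 (Nat.lt_succ_of_le (Finset.le_sup hi))
    rw [← Finset.sum_fiberwise_of_maps_to hmaps, Finset.range_eq_Ico,
      Finset.sum_eq_sum_Ico_succ_bot (Nat.succ_pos R)]
    have hfib : ∀ r, (∑ i ∈ Rs with G.dist i₀ i = r, W (G.dist i₀ i)) =
        (Finset.univ.filter fun j => G.Reachable i₀ j ∧ G.dist i₀ j = r).card * W r := by
      intro r
      rw [Finset.sum_congr rfl (g := fun _ => W r) fun i hi => by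
        rw [(Finset.mem_filter.1 hi).2], Finset.sum_const, nsmul_eq_mul, hRs, Finset.filter_filter]
    refine add_le_add ?_ (le_trans (Finset.sum_le_sum fun r hr => ?_) (hB R))
    · rw [hfib]
      have h1 : (Finset.univ.filter fun j => G.Reachable i₀ j ∧ G.dist i₀ j = 0) ⊆ {i₀} := by
        intro j hj
        obtain ⟨h1, h2⟩ := (Finset.mem_filter.1 hj).2
        rw [Finset.mem_singleton]
        exact (h1.dist_eq_zero_iff.1 h2).symm
      have h2 : ((Finset.univ.filter fun j => G.Reachable i₀ j ∧ G.dist i₀ j = 0).card : ℝ) ≤ 1 := by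
        exact_mod_cast Finset.card_le_card h1
      simpa [hW] using h2
    · have hr0 : r ≠ 0 := by
        have := (Finset.mem_Ico.1 hr).1
        omega
      rw [hfib]
      simp only [hW, if_neg hr0]
      split_ifs
      · gcongr
        exact card_dist_eq_le_gammaMax G i₀ hr0
      · rw [mul_zero]
  calc ∑ S ∈ A, g S * Real.exp (3 / 4 * κ * S.card)
      ≤ ∑ S ∈ A, ∑ i ∈ Rs, W (G.dist i₀ i) *
          if i ∈ S then g S * Real.exp (κ * S.card) else 0 := Finset.sum_le_sum hpt
    _ = ∑ i ∈ Rs, W (G.dist i₀ i) *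
          ∑ S ∈ A, if i ∈ S then g S * Real.exp (κ * S.card) else 0 := by
        rw [Finset.sum_comm]
        exact Finset.sum_congr rfl fun i _ => (Finset.mul_sum _ _ _).symm
    _ ≤ ∑ i ∈ Rs, W (G.dist i₀ i) * ε := by
        refine Finset.sum_le_sum fun i _ => mul_le_mul_of_nonneg_left ?_ (hW0 _)
        refine le_trans ?_ (hgε i)
        rw [Finset.sum_filter]
        refine Finset.sum_le_sum_of_subset_of_nonneg (Finset.subset_univ A) fun S _ _ => ?_
        split_ifs
        · exact mul_nonneg (hg S) (Real.exp_pos _).le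
        · exact le_rfl
    _ ≤ _ := by
        rw [← Finset.sum_mul]
        exact mul_le_mul_of_nonneg_right hsumW hε

theorem isWeight_exp_hamWt {κ : ℝ} (hκ : 0 ≤ κ) :
    IsWeight fun x : F2vec n => Real.exp (κ * hamWt x) where
  map_zero := by simp [hamWt]
  one_le a := Real.one_le_exp (mul_nonneg hκ (Nat.cast_nonneg _))
  add_le a b := by
    rw [← Real.exp_add, ← mul_add, Real.exp_le_exp]
    refine mul_le_mul_of_nonneg_left ?_ hκ
    have h : hamWt (a + b) ≤ hamWt a + hamWt b := by
      refine (Finset.card_le_card fun i hi => ?_).trans (Finset.card_union_le _ _)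
      have h1 := (Finset.mem_filter.1 hi).2
      simp only [Finset.mem_union, Finset.mem_filter, Finset.mem_univ, true_and]
      by_contra hno
      push Not at hno
      exact h1 (by rw [Pi.add_apply, hno.1, hno.2, add_zero])
    exact_mod_cast h

/-- The checks that occur in some minimal set of checks whose sum is supported in `S`. -/
def detectors (Hm : Matrix (Fin m) (Fin n) (ZMod 2)) (S : Finset (Fin n)) : Finset (Fin m) :=
  Finset.univ.filter fun j => ∃ T : Finset (Fin m), IsMinSum (fun j i => Hm j i) T ∧
    (∀ i, (∑ j ∈ T, (fun i => Hm j i)) i ≠ 0 → i ∈ S) ∧ j ∈ T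

theorem exists_mem_detectors {Hm : Matrix (Fin m) (Fin n) (ZMod 2)} {S : Finset (Fin n)}
    {v : F2vec n → ℂ} (hloc : ∀ t : F2vec n, (∀ i ∈ S, t i = 0) → ∀ b, v (b + t) = v b)
    (hinv : ∀ u : F2vec n, Hm.mulVec u = 0 → ∀ b, v (b + u) = v b) {x : F2vec n}
    (hx : NearAmp v x) : ∃ j ∈ detectors Hm S, Hm.mulVec x j ≠ 0 := by
  obtain ⟨T, j, hT, hS, hj, hjx⟩ := exists_isMinSum_mulVec_ne_zero (Hm := Hm) (S := S) (x := x)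
    (by
      rintro u t hu ht rfl
      obtain ⟨b, hb⟩ := hx
      exact hb (by rw [← add_assoc, hloc t ht, hinv u hu]))
  exact ⟨j, Finset.mem_filter.2 ⟨Finset.mem_univ _, T, hT, hS, hj⟩, hjx⟩

theorem exists_mem_of_nearAmp {S : Finset (Fin n)}
    {v : F2vec n → ℂ} (hloc : ∀ t : F2vec n, (∀ i ∈ S, t i = 0) → ∀ b, v (b + t) = v b)
    {x : F2vec n} (hx : NearAmp v x) : ∃ i ∈ S, x i ≠ 0 := by
  by_contra hno
  push Not at hno
  obtain ⟨b, hb⟩ := hx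
  exact hb (hloc x hno b)

theorem conjTranspose_hopMatrix (y : F2vec n) (v : F2vec n → ℂ) :
    (hopMatrix y v).conjTranspose = hopMatrix y fun b => star (v (b + y)) := by
  ext a b
  simp only [Matrix.conjTranspose_apply, hopMatrix]
  by_cases h : a = b + y
  · rw [if_pos h, if_pos (F2vec.eq_add_comm.1 h), h]
  · rw [if_neg h, if_neg (fun h' => h (F2vec.eq_add_comm.1 h')), star_zero]

/-- The value of a check on a bit string. -/
def checkHom (Hm : Matrix (Fin m) (Fin n) (ZMod 2)) (j : Fin m) : F2vec n →+ ZMod 2 :=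
  (Pi.evalAddMonoidHom _ j).comp Hm.mulVecLin.toAddMonoidHom

/-- Symmetric local terms on a code form a small model. -/
theorem exists_hopModel (Hm : Matrix (Fin m) (Fin n) (ZMod 2)) {q : ℕ}
    (hq : ∀ j, hamWt (fun i => Hm j i) ≤ q) {lam : Fin m → ℝ} (hlam : ∀ j, 1 ≤ lam j)
    {y : Finset (Fin n) → Finset (Fin m) → F2vec n}
    {v : Finset (Fin n) → Finset (Fin m) → F2vec n → ℂ}
    {g : Finset (Fin n) → Finset (Fin m) → ℝ}
    (hy : ∀ S s i, i ∉ S → y S s i = 0) (hv : ∀ S s b, ‖v S s b‖ ≤ g S s)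
    (hloc : ∀ S s, ∀ t : F2vec n, (∀ i ∈ S, t i = 0) → ∀ b, v S s (b + t) = v S s b)
    (hinv : ∀ S s, ∀ u : F2vec n, Hm.mulVec u = 0 → ∀ b, v S s (b + u) = v S s b)
    {κ ε δ ρ₀ : ℝ} (hκ : 0 < κ) (hρ₀ : ρ₀ ≤ κ / 8) (hδ : 0 ≤ δ)
    (hS : ∀ i, ∑ S with i ∈ S, (∑ s, g S s) * Real.exp (κ * S.card) ≤ ε)
    (hN : ∀ j, ∑ S with j ∈ detectors Hm S,
      (∑ s, g S s) * Real.exp (3 / 4 * κ * S.card) ≤ δ) :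
    ∃ M : HopModel n m (Finset (Fin n) × Finset (Fin m) × Bool),
      M.IsSmall q ε δ ρ₀ ∧ M.l = checkHom Hm ∧ (∀ x, M.w x = Real.exp (κ / 2 * hamWt x)) ∧
      M.ham = ∑ j, ((lam j / 2 : ℝ) : ℂ) • (1 - signMatrix (checkHom Hm j)) +
        ∑ S, ∑ s, (1 / 2 : ℂ) •
          (hopMatrix (y S s) (v S s) + (hopMatrix (y S s) (v S s)).conjTranspose) := by
  have hg : ∀ S s, 0 ≤ g S s := fun S s => (norm_nonneg _).trans (hv S s 0)
  set amp : Finset (Fin n) × Finset (Fin m) × Bool → F2vec n → ℂ := fun τ b =>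
    if τ.2.2 then v τ.1 τ.2.1 b / 2 else star (v τ.1 τ.2.1 (b + y τ.1 τ.2.1)) / 2 with hamp
  have hampnorm : ∀ τ b, ‖amp τ b‖ ≤ g τ.1 τ.2.1 / 2 := by
    intro τ b
    simp only [hamp]
    split_ifs
    · rw [norm_div, Complex.norm_ofNat]
      exact div_le_div_of_nonneg_right (hv _ _ _) zero_le_two
    · rw [norm_div, norm_star, Complex.norm_ofNat]
      exact div_le_div_of_nonneg_right (hv _ _ _) zero_le_two
  have hampinv : ∀ τ t, (∀ b, v τ.1 τ.2.1 (b + t) = v τ.1 τ.2.1 b) →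
      ∀ b, amp τ (b + t) = amp τ b := by
    intro τ t ht b
    simp only [hamp]
    split_ifs
    · rw [ht]
    · rw [add_right_comm, ht]
  have hamploc : ∀ τ, ∀ t : F2vec n, (∀ i ∈ τ.1, t i = 0) → ∀ b, amp τ (b + t) = amp τ b :=
    fun τ t ht => hampinv τ t (hloc _ _ t ht)
  have hampker : ∀ τ, ∀ u : F2vec n, Hm.mulVec u = 0 → ∀ b, amp τ (b + u) = amp τ b :=
    fun τ u hu => hampinv τ u (hinv _ _ u hu)
  set M : HopModel n m (Finset (Fin n) × Finset (Fin m) × Bool) :=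
    { w := fun x => Real.exp (κ / 2 * hamWt x)
      isWeight := isWeight_exp_hamWt (by positivity)
      l := checkHom Hm
      Q := fun j => Finset.univ.filter fun i => Hm j i ≠ 0
      exists_mem_Q := fun j x hx => by
        have hx' : ∑ i, Hm j i * x i ≠ 0 := hx
        obtain ⟨i, -, hi⟩ := Finset.exists_ne_zero_of_sum_ne_zero hx'
        exact ⟨i, Finset.mem_filter.2 ⟨Finset.mem_univ _, left_ne_zero_of_mul hi⟩,
          right_ne_zero_of_mul hi⟩
      lam := lam
      one_le_lam := hlam
      y := fun τ => y τ.1 τ.2.1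
      v := amp
      β := fun τ => g τ.1 τ.2.1 / 2
      norm_v_le := hampnorm
      S := fun τ => τ.1
      y_eq_zero := fun τ => hy _ _
      N := fun τ => detectors Hm τ.1
      exists_mem_S := fun τ x hx => exists_mem_of_nearAmp (hamploc τ) hx
      exists_mem_N := fun τ x hx => exists_mem_detectors (hamploc τ) (hampker τ) hx } with hM
  have hstr : ∀ τ, M.strength ρ₀ τ ≤ g τ.1 τ.2.1 / 2 * Real.exp (3 / 4 * κ * τ.1.card) := by
    intro τ
    change g τ.1 τ.2.1 / 2 * Real.exp (κ / 2 * hamWt (y τ.1 τ.2.1)) *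
      Real.exp (2 * (τ.1.card * ρ₀)) ≤ _
    rw [mul_assoc, ← Real.exp_add]
    refine mul_le_mul_of_nonneg_left (Real.exp_le_exp.2 ?_) (div_nonneg (hg _ _) zero_le_two)
    have h1 : (hamWt (y τ.1 τ.2.1) : ℝ) ≤ τ.1.card := by
      have : hamWt (y τ.1 τ.2.1) ≤ τ.1.card := by
        refine Finset.card_le_card fun i hi => ?_
        by_contra hiS
        exact (Finset.mem_filter.1 hi).2 (hy _ _ i hiS)
      exact_mod_cast this
    have h2 : (0 : ℝ) ≤ τ.1.card := Nat.cast_nonneg _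
    nlinarith [mul_le_mul_of_nonneg_left h1 hκ.le, mul_le_mul_of_nonneg_left hρ₀ h2]
  have hsum : ∀ (P : Finset (Fin n) → Prop) [DecidablePred P],
      ∑ τ : Finset (Fin n) × Finset (Fin m) × Bool with P τ.1, M.strength ρ₀ τ ≤
        ∑ S with P S, (∑ s, g S s) * Real.exp (3 / 4 * κ * S.card) := by
    intro P _
    refine (Finset.sum_le_sum fun τ _ => hstr τ).trans (le_of_eq ?_)
    rw [Finset.sum_filter, Finset.sum_filter, Fintype.sum_prod_type]
    refine Finset.sum_congr rfl fun S _ => ?_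
    split_ifs with hPS
    · rw [Fintype.sum_prod_type, Finset.sum_mul]
      refine Finset.sum_congr rfl fun s _ => ?_
      rw [Fintype.sum_bool]
      ring
    · simp
  refine ⟨M, ⟨Nat.cast_nonneg q, hδ, fun j => by exact_mod_cast hq j, fun i => ?_, fun j => ?_⟩,
    rfl, fun _ => rfl, ?_⟩
  · refine (hsum fun S => i ∈ S).trans (le_trans (Finset.sum_le_sum fun S _ => ?_) (hS i))
    refine mul_le_mul_of_nonneg_left (Real.exp_le_exp.2 ?_) (Finset.sum_nonneg fun s _ => hg S s)
    have h2 : (0 : ℝ) ≤ S.card := Nat.cast_nonneg _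
    nlinarith
  · exact (hsum fun S => j ∈ detectors Hm S).trans (hN j)
  · change _ + ∑ τ, hopMatrix (y τ.1 τ.2.1) (amp τ) = _
    congr 1
    rw [Fintype.sum_prod_type]
    refine Finset.sum_congr rfl fun S _ => ?_
    rw [Fintype.sum_prod_type]
    refine Finset.sum_congr rfl fun s _ => ?_
    rw [Fintype.sum_bool, conjTranspose_hopMatrix]
    ext a b
    simp only [hamp, hopMatrix, Matrix.add_apply, Matrix.smul_apply, smul_eq_mul]
    split_ifs <;> simp_all <;> ring

end CodeModel

section CodeSpectrum

variable {m n : ℕ}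

theorem zsgn_sum {ι : Type*} (s : Finset ι) (t : ι → ZMod 2) :
    zsgn (∑ i ∈ s, t i) = ∏ i ∈ s, zsgn (t i) := by
  induction s using Finset.induction_on with
  | empty => simp [zsgn_zero]
  | insert i s hi ih => rw [Finset.sum_insert hi, Finset.prod_insert hi, zsgn_add, ih]

theorem pauli_zType (Hm : Matrix (Fin m) (Fin n) (ZMod 2)) (j : Fin m) :
    pauli ((0 : F2vec n), fun i => Hm j i) = signMatrix (checkHom Hm j) := by
  have hbit : ∀ s t : ZMod 2, (-1 : ℂ) ^ (s.val * t.val) = zsgn (s * t) := by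
    intro s t
    rcases zmod_two_eq s with rfl | rfl <;> rcases zmod_two_eq t with rfl | rfl <;>
      simp [zsgn, ZMod.val_one]
  ext a b
  simp only [pauli, signMatrix, Matrix.diagonal_apply, add_zero]
  by_cases h : a = b
  · subst h
    rw [if_pos rfl, if_pos rfl]
    have h0 : (Finset.univ.filter fun i : Fin n => (0 : F2vec n) i = 1 ∧ Hm j i = 1) = ∅ := by
      simp
    rw [h0, Finset.card_empty, pow_zero, one_mul, ← Finset.prod_pow_eq_pow_sum]
    change _ = zsgn (∑ i, Hm j i * a i)
    rw [zsgn_sum]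
    exact Finset.prod_congr rfl fun i _ => hbit _ _
  · rw [if_neg h, if_neg h]

theorem opNorm_nonneg (A : Matrix (F2vec n) (F2vec n) ℂ) : 0 ≤ opNorm A := norm_nonneg _

theorem opNorm_sum_le {ι : Type*} (s : Finset ι) (A : ι → Matrix (F2vec n) (F2vec n) ℂ) :
    opNorm (∑ i ∈ s, A i) ≤ ∑ i ∈ s, opNorm (A i) := by
  rw [opNorm, map_sum]
  exact norm_sum_le _ _

theorem opNorm_conjTranspose (A : Matrix (F2vec n) (F2vec n) ℂ) :
    opNorm A.conjTranspose = opNorm A := by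
  rw [opNorm, ← Matrix.star_eq_conjTranspose, map_star, ContinuousLinearMap.star_eq_adjoint,
    LinearIsometryEquiv.norm_map, opNorm]

/-- The Hermitian part of a matrix. -/
def hermPart (A : Matrix (F2vec n) (F2vec n) ℂ) : Matrix (F2vec n) (F2vec n) ℂ :=
  (1 / 2 : ℂ) • (A + A.conjTranspose)

theorem hermPart_zero : hermPart (0 : Matrix (F2vec n) (F2vec n) ℂ) = 0 := by
  simp [hermPart]

theorem hermPart_sum {ι : Type*} (s : Finset ι) (A : ι → Matrix (F2vec n) (F2vec n) ℂ) :
    hermPart (∑ i ∈ s, A i) = ∑ i ∈ s, hermPart (A i) := by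
  simp only [hermPart]
  rw [Matrix.conjTranspose_sum, ← Finset.sum_add_distrib, Finset.smul_sum]

theorem Matrix.IsHermitian.hermPart_eq {A : Matrix (F2vec n) (F2vec n) ℂ} (hA : A.IsHermitian) :
    hermPart A = A := by
  rw [hermPart, hA.eq, ← two_smul ℂ A, smul_smul]
  norm_num

theorem isHermitian_hermPart (A : Matrix (F2vec n) (F2vec n) ℂ) : (hermPart A).IsHermitian := by
  rw [Matrix.IsHermitian, hermPart, Matrix.conjTranspose_smul, Matrix.conjTranspose_add,
    Matrix.conjTranspose_conjTranspose, add_comm]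
  simp

theorem opNorm_hermPart_le (A : Matrix (F2vec n) (F2vec n) ℂ) : opNorm (hermPart A) ≤ opNorm A := by
  have h1 : opNorm (hermPart A) ≤ 1 / 2 * (opNorm A + opNorm A.conjTranspose) := by
    rw [opNorm, hermPart, map_smul, map_add, norm_smul]
    have : ‖(1 / 2 : ℂ)‖ = 1 / 2 := by norm_num
    rw [this]
    exact mul_le_mul_of_nonneg_left (norm_add_le _ _) (by norm_num)
  rw [opNorm_conjTranspose] at h1
  linarith

theorem hermPart_smul_one (c : ℂ) :
    hermPart (c • (1 : Matrix (F2vec n) (F2vec n) ℂ)) = ((c.re : ℝ) : ℂ) • 1 := by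
  rw [hermPart, Matrix.conjTranspose_smul, Matrix.conjTranspose_one, ← add_smul, smul_smul]
  congr 1
  rw [Complex.star_def, Complex.add_conj]
  push_cast
  ring

theorem StronglySupported.exists_eq_smul_one {C : Fin m → F2vec n × F2vec n}
    {A : Matrix (F2vec n) (F2vec n) ℂ} {s : Finset (Fin m)} (hA : StronglySupported C A ∅ s) :
    ∃ c : ℂ, A = c • 1 := by
  have h1 : A ∈ Submodule.span ℂ {(1 : Matrix (F2vec n) (F2vec n) ℂ)} := by
    refine Submodule.span_mono ?_ hA.1
    rintro B ⟨p, rfl, hp, -⟩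
    have hz : ∀ i, p.1 i = 0 ∧ p.2 i = 0 := by
      intro i
      by_contra hne
      refine absurd (hp (Finset.mem_filter.2 ⟨Finset.mem_univ i, ?_⟩)) (Finset.notMem_empty i)
      tauto
    have h1 : p.1 = 0 := funext fun i => (hz i).1
    have h2 : p.2 = 0 := funext fun i => (hz i).2
    rw [Set.mem_singleton_iff]
    ext a b
    simp [pauli, h1, h2, Matrix.one_apply]
  obtain ⟨c, hc⟩ := Submodule.mem_span_singleton.1 h1
  exact ⟨c, hc.symm⟩

theorem card_ker_mulVec (Hm : Matrix (Fin m) (Fin n) (ZMod 2)) :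
    Fintype.card {x : F2vec n // Hm.mulVec x = 0} = 2 ^ (n - Hm.rank) := by
  have h1 := LinearMap.finrank_range_add_finrank_ker Hm.mulVecLin
  rw [Module.finrank_fin_fun] at h1
  have h2 : Module.finrank (ZMod 2) (LinearMap.ker Hm.mulVecLin) = n - Hm.rank := by
    rw [Matrix.rank]
    omega
  have h3 := Module.card_eq_pow_finrank (K := ZMod 2) (V := LinearMap.ker Hm.mulVecLin)
  rw [ZMod.card, h2] at h3
  rw [← h3]
  exact Fintype.card_congr (Equiv.refl _)

theorem sum_exp_le_kappaNorm
    (VF : Finset (Fin n) → Finset (Fin m) → Matrix (F2vec n) (F2vec n) ℂ) (κ : ℝ) (i : Fin n) :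
    ∑ S with i ∈ S, (∑ s, opNorm (VF S s)) * Real.exp (κ * S.card) ≤ kappaNorm VF κ := by
  simp only [Finset.sum_mul]
  exact le_ciSup (f := fun i : Fin n => ∑ S with i ∈ S,
    ∑ s : Finset (Fin m), opNorm (VF S s) * Real.exp (κ * S.card))
    (Set.finite_range _).bddAbove i

theorem kappaNorm_nonneg
    (VF : Finset (Fin n) → Finset (Fin m) → Matrix (F2vec n) (F2vec n) ℂ) (κ : ℝ) :
    0 ≤ kappaNorm VF κ :=
  Real.iSup_nonneg fun _ => Finset.sum_nonneg fun _ _ => Finset.sum_nonneg fun _ _ =>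
    mul_nonneg (opNorm_nonneg _) (Real.exp_pos _).le

/-- Terms with large supports have exponentially small total norm. -/
theorem sum_large_le {g : Finset (Fin n) → ℝ} (hg : ∀ S, 0 ≤ g S) {κ ε ds : ℝ} (hκ : 0 ≤ κ)
    (hds : 0 < ds) (hgε : ∀ i, ∑ S with i ∈ S, g S * Real.exp (κ * S.card) ≤ ε) :
    ∑ S with ds ≤ (S.card : ℝ), g S ≤ n * ε * Real.exp (-(κ * ds)) := by
  have hpt : ∀ S ∈ Finset.univ.filter fun S : Finset (Fin n) => ds ≤ (S.card : ℝ),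
      g S ≤ ∑ i, (if i ∈ S then g S * Real.exp (κ * S.card) else 0) * Real.exp (-(κ * ds)) := by
    intro S hS
    have hS' := (Finset.mem_filter.1 hS).2
    obtain ⟨i, hi⟩ : S.Nonempty := by
      rw [Finset.nonempty_iff_ne_empty]
      rintro rfl
      rw [Finset.card_empty, Nat.cast_zero] at hS'
      linarith
    have hnn : ∀ i ∈ Finset.univ, 0 ≤
        (if i ∈ S then g S * Real.exp (κ * S.card) else 0) * Real.exp (-(κ * ds)) := by
      intro i _
      refine mul_nonneg ?_ (Real.exp_pos _).le
      split_ifs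
      · exact mul_nonneg (hg S) (Real.exp_pos _).le
      · exact le_rfl
    refine le_trans ?_ (Finset.single_le_sum hnn (Finset.mem_univ i))
    rw [if_pos hi, mul_assoc, ← Real.exp_add]
    refine le_mul_of_one_le_right (hg S) (Real.one_le_exp ?_)
    nlinarith
  calc ∑ S with ds ≤ (S.card : ℝ), g S
      ≤ ∑ S with ds ≤ (S.card : ℝ), ∑ i,
          (if i ∈ S then g S * Real.exp (κ * S.card) else 0) * Real.exp (-(κ * ds)) :=
        Finset.sum_le_sum hpt
    _ ≤ ∑ S, ∑ i,
          (if i ∈ S then g S * Real.exp (κ * S.card) else 0) * Real.exp (-(κ * ds)) := by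
        refine Finset.sum_le_sum_of_subset_of_nonneg (Finset.filter_subset _ _) fun S _ _ =>
          Finset.sum_nonneg fun i _ => mul_nonneg ?_ (Real.exp_pos _).le
        split_ifs
        · exact mul_nonneg (hg S) (Real.exp_pos _).le
        · exact le_rfl
    _ ≤ ∑ _i : Fin n, ε * Real.exp (-(κ * ds)) := by
        rw [Finset.sum_comm]
        refine Finset.sum_le_sum fun i _ => ?_
        rw [← Finset.sum_mul, ← Finset.sum_filter]
        exact mul_le_mul_of_nonneg_right (hgε i) (Real.exp_pos _).le
    _ = _ := by
        rw [Finset.sum_const, Finset.card_univ, Fintype.card_fin, nsmul_eq_mul, mul_assoc]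

theorem pWeight_zType (z : F2vec n) : pWeight ((0 : F2vec n), z) = hamWt z := by
  simp [pWeight, pSupp, hamWt]

theorem mem_pSupp_zType {z : F2vec n} {i : Fin n} : i ∈ pSupp ((0 : F2vec n), z) ↔ z i ≠ 0 := by
  simp [pSupp]

theorem sum_zType (h : Fin m → F2vec n) (T : Finset (Fin m)) :
    ∑ j ∈ T, ((0 : F2vec n), h j) = ((0 : F2vec n), ∑ j ∈ T, h j) := by
  refine Prod.ext ?_ ?_
  · rw [Prod.fst_sum]
    simp
  · rw [Prod.snd_sum]

end CodeSpectrum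

section CodeSpectrum

variable {m n : ℕ}

/-- The total strength of the short terms that a given check can detect. -/
theorem sum_detectors_le {Hm : Matrix (Fin m) (Fin n) (ZMod 2)} {C : Fin m → F2vec n × F2vec n}
    (hC : C = fun j => ((0 : F2vec n), fun i => Hm j i))
    (hrow : ∀ j, (fun i => Hm j i) ≠ (0 : F2vec n)) {q : ℕ} (hq0 : 0 < q)
    (hq : ∀ j, hamWt (fun i => Hm j i) ≤ q) {f finv : ℝ → ℝ} {dc ds : ℝ}
    (hf : StrictMonoOn f (Set.Ici 0)) (hf0 : ∀ x, 0 ≤ x → 0 ≤ f x)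
    (hfinv : ∀ x, 0 ≤ x → 0 ≤ finv x) (hfinvf : ∀ x, 0 ≤ x → finv (f x) = x)
    (hffinv : ∀ x, 0 ≤ x → f (finv x) = x)
    (hsound : ∀ T : Finset (Fin m), ((pWeight (∑ j ∈ T, C j) : ℝ) < dc) →
      ∃ T' : Finset (Fin m), (∑ j ∈ T', C j) = ∑ j ∈ T, C j ∧
        (T'.card : ℝ) ≤ f (pWeight (∑ j ∈ T, C j)))
    (hds : 0 < ds) (hdsc : ds ≤ dc) {κ ε B : ℝ} (hκ : 0 < κ) (hε : 0 ≤ ε)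
    (hB : ∀ R : ℕ, (∑ r ∈ Finset.Icc 1 R, if ftilde f finv ds q r < ds then
      (gammaMax (codeGraph C) r : ℝ) * Real.exp (-(κ / 4 * ftilde f finv ds q r)) else 0) ≤ B)
    {g : Finset (Fin n) → ℝ} (hg : ∀ S, 0 ≤ g S)
    (hgε : ∀ i, ∑ S with i ∈ S, g S * Real.exp (κ * S.card) ≤ ε)
    (hgds : ∀ S, g S ≠ 0 → (S.card : ℝ) < ds) (j : Fin m) :
    ∑ S with j ∈ detectors Hm S, g S * Real.exp (3 / 4 * κ * S.card) ≤ (1 + B) * ε := by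
  obtain ⟨i₀, hi₀⟩ := Function.ne_iff.1 (hrow j)
  have hG : ∀ k i i', Hm k i ≠ 0 → Hm k i' ≠ 0 → i ≠ i' → (codeGraph C).Adj i i' := by
    intro k i i' hi hi' hne
    rw [codeGraph, SimpleGraph.fromRel_adj]
    refine ⟨hne, Or.inl ⟨k, ?_, ?_⟩⟩ <;> rw [hC] <;> exact mem_pSupp_zType.2 ‹_›
  have hsound' : ∀ T : Finset (Fin m), (hamWt (∑ j ∈ T, (fun i => Hm j i)) : ℝ) < dc →
      ∃ T' : Finset (Fin m), ∑ j ∈ T', (fun i => Hm j i) = ∑ j ∈ T, (fun i => Hm j i) ∧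
        (T'.card : ℝ) ≤ f (hamWt (∑ j ∈ T, (fun i => Hm j i))) := by
    intro T hT
    have h1 := hsound T
    simp only [hC, sum_zType (fun j i => Hm j i), pWeight_zType] at h1
    obtain ⟨T', hT', hle⟩ := h1 hT
    exact ⟨T', congrArg Prod.snd hT', hle⟩
  refine sum_exp_le_of_reachable (i₀ := i₀) hκ hB hg hε hgε hgds fun S hS hgS => ?_
  obtain ⟨T, hT, hTS, hjT⟩ := (Finset.mem_filter.1 (Finset.mem_filter.1 hS).2).2
  exact exists_reachable_mem_support (h := fun j i => Hm j i) hG hq hq0 hf hf0 hfinv hfinvf hffinv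
    hsound' hds hdsc hT hTS ((hgds S hgS).trans_le hdsc) hjT hi₀

/-- The spectrum of a perturbed code Hamiltonian, for explicit constants. -/
theorem eigenvalues_code_perturbation {Hm : Matrix (Fin m) (Fin n) (ZMod 2)}
    {C : Fin m → F2vec n × F2vec n} (hC : C = fun j => ((0 : F2vec n), fun i => Hm j i))
    {q : ℕ} (hq : ∀ j, hamWt (fun i => Hm j i) ≤ q) {ds : ℝ} (hds : 0 < ds)
    (hd : ∀ u : F2vec n, u ≠ 0 → Hm.mulVec u = 0 → ds ≤ hamWt u)
    {lam : Fin m → ℝ} (hlam : ∀ j, 1 ≤ lam j)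
    {VF : Finset (Fin n) → Finset (Fin m) → Matrix (F2vec n) (F2vec n) ℂ}
    (hV : (∑ S, ∑ s, VF S s).IsHermitian)
    (hVS : ∀ S s, VF S s ≠ 0 → StronglySupported C (VF S s) S s)
    (hsymm : ∀ S s, ∀ u : F2vec n, Hm.mulVec u = 0 →
      VF S s * pauli (u, (0 : F2vec n)) = pauli (u, (0 : F2vec n)) * VF S s)
    {κ ε δ ρ₀ : ℝ} (hκ : 0 < κ) (hε : 0 ≤ ε) (hδ : 0 ≤ δ)
    (hVε : ∀ i, ∑ S with i ∈ S, (∑ s, opNorm (VF S s)) * Real.exp (κ * S.card) ≤ ε)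
    (hN : ∀ j, ∑ S with j ∈ detectors Hm S,
      (if (S.card : ℝ) < ds then ∑ s, opNorm (VF S s) else 0) *
        Real.exp (3 / 4 * κ * S.card) ≤ δ)
    (hρ₀ : 0 < ρ₀) (hρ₀κ : ρ₀ ≤ κ / 8) (hqρ : 64 * (q : ℝ) * ρ₀ ≤ 1)
    (hsmall : ε + 2 * δ * ρ₀ ≤ ρ₀ / 8) (hδ' : δ ≤ 1 / 32) {η η' : ℝ}
    (hη : n * (2 * (ε + 2 * δ * ρ₀)) * Real.exp (-(κ * ds / 2)) ≤ η)
    (hη' : n * ε * Real.exp (-(κ * ds / 2)) ≤ η') (hgap : 2 * η + 2 * η' < 7 / 8) :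
    ∃ (cstar : ℝ) (hH : (∑ j, ((lam j / 2 : ℝ) : ℂ) • (1 - pauli (C j)) + ∑ S, ∑ s, VF S s -
        (cstar : ℂ) • (1 : Matrix (F2vec n) (F2vec n) ℂ)).IsHermitian),
      (∀ x, hH.eigenvalues x ∈ Set.Icc (-(η + η')) (η + η') ∨
        7 / 8 - η - η' ≤ hH.eigenvalues x) ∧
      (Finset.univ.filter fun x => hH.eigenvalues x ∈ Set.Icc (-(η + η')) (η + η')).card
        = 2 ^ (n - Hm.rank) := by
  have hη0 : 0 ≤ η := le_trans (by positivity) hη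
  have hη'0 : 0 ≤ η' := le_trans (by positivity) hη'
  -- the short nonempty terms form a model
  set g : Finset (Fin n) → Finset (Fin m) → ℝ := fun S s =>
    if S.Nonempty ∧ (S.card : ℝ) < ds then opNorm (VF S s) else 0 with hg
  have hhop : ∀ S s, ∃ (y : F2vec n) (v : F2vec n → ℂ),
      hopMatrix y v = (if S.Nonempty ∧ (S.card : ℝ) < ds then VF S s else 0) ∧
      (∀ i, i ∉ S → y i = 0) ∧ (∀ b, ‖v b‖ ≤ g S s) ∧
      (∀ t : F2vec n, (∀ i ∈ S, t i = 0) → ∀ b, v (b + t) = v b) ∧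
      ∀ u : F2vec n, Hm.mulVec u = 0 → ∀ b, v (b + u) = v b := by
    intro S s
    have hzero : hopMatrix (0 : F2vec n) (fun _ => (0 : ℂ)) = 0 := by
      ext a b
      simp [hopMatrix]
    by_cases hS : S.Nonempty ∧ (S.card : ℝ) < ds
    · simp only [hg, if_pos hS]
      by_cases h0 : VF S s = 0
      · exact ⟨0, fun _ => 0, by rw [h0, hzero], fun _ _ => rfl,
          fun _ => by rw [norm_zero]; exact opNorm_nonneg _, fun _ _ _ => rfl, fun _ _ _ => rfl⟩
      · obtain ⟨y, v, h1, h2⟩ := exists_eq_hopMatrix hC (hVS S s h0)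
          (fun u hu hu' => by exact_mod_cast hS.2.trans_le (hd u hu hu')) (hsymm S s)
        exact ⟨y, v, h1.symm, h2⟩
    · simp only [hg, if_neg hS]
      exact ⟨0, fun _ => 0, hzero, fun _ _ => rfl, fun _ => by rw [norm_zero],
        fun _ _ _ => rfl, fun _ _ _ => rfl⟩
  choose y v hyv hyS hvg hvloc hvinv using hhop
  have hgle : ∀ S, ∑ s, g S s ≤ if (S.card : ℝ) < ds then ∑ s, opNorm (VF S s) else 0 := by
    intro S
    simp only [hg]
    split_ifs with h1 h2 h2
    · exact le_rfl
    · exact absurd h1.2 h2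
    · rw [Finset.sum_const_zero]
      exact Finset.sum_nonneg fun s _ => opNorm_nonneg _
    · rw [Finset.sum_const_zero]
  have hgle' : ∀ S, ∑ s, g S s ≤ ∑ s, opNorm (VF S s) := by
    intro S
    refine (hgle S).trans ?_
    split_ifs
    · exact le_rfl
    · exact Finset.sum_nonneg fun s _ => opNorm_nonneg _
  obtain ⟨M, hM, hMl, hMw, hMham⟩ := exists_hopModel Hm hq hlam hyS hvg hvloc hvinv hκ hρ₀κ hδ
    (fun i => (Finset.sum_le_sum fun S _ => mul_le_mul_of_nonneg_right (hgle' S)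
      (Real.exp_pos _).le).trans (hVε i))
    (fun j => (Finset.sum_le_sum fun S _ => mul_le_mul_of_nonneg_right (hgle S)
      (Real.exp_pos _).le).trans (hN j))
  set H₀ : Matrix (F2vec n) (F2vec n) ℂ := ∑ j, ((lam j / 2 : ℝ) : ℂ) • (1 - pauli (C j)) with hH₀
  have hH₀' : H₀ = ∑ j, ((lam j / 2 : ℝ) : ℂ) • (1 - signMatrix (checkHom Hm j)) := by
    simp only [hH₀, hC, pauli_zType]
  set Vs : Matrix (F2vec n) (F2vec n) ℂ := ∑ S, ∑ s,
    hermPart (if S.Nonempty ∧ (S.card : ℝ) < ds then VF S s else 0) with hVs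
  have hMham' : M.ham = H₀ + Vs := by
    rw [hMham, ← hH₀', hVs]
    congr 1
    refine Finset.sum_congr rfl fun S _ => Finset.sum_congr rfl fun s _ => ?_
    rw [hyv, hermPart]
  have hsum_herm : ∀ A : Finset (Fin n) → Finset (Fin m) → Matrix (F2vec n) (F2vec n) ℂ,
      ∑ S, ∑ s, hermPart (A S s) = hermPart (∑ S, ∑ s, A S s) := by
    intro A
    rw [hermPart_sum]
    exact Finset.sum_congr rfl fun S _ => (hermPart_sum _ _).symm
  have hVsH : Vs.IsHermitian := by
    rw [hVs, hsum_herm]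
    exact isHermitian_hermPart _
  have hH₀H : H₀.IsHermitian := by
    rw [hH₀', Matrix.IsHermitian, Matrix.conjTranspose_sum]
    refine Finset.sum_congr rfl fun j _ => ?_
    rw [Matrix.conjTranspose_smul, Matrix.conjTranspose_sub, Matrix.conjTranspose_one, signMatrix,
      Matrix.diagonal_conjTranspose]
    congr 1
    · exact Complex.conj_ofReal _
    · congr 2
      ext b
      simp only [Pi.star_apply, zsgn]
      split_ifs <;> simp
  have hMH : M.ham.IsHermitian := by
    rw [hMham']
    exact hH₀H.add hVsH
  have henergy : ∀ x, M.energy x = 0 ↔ Hm.mulVec x = 0 := by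
    intro x
    rw [M.energy_eq_zero_iff, hMl, funext_iff]
    rfl
  obtain ⟨c, hcl, hcard⟩ := HopModel.eigenvalues_ham hM hε hρ₀ hqρ hsmall hδ' hMH
    (W := Real.exp (κ * ds / 2)) (η := η) (Real.exp_pos _)
    (fun u hu hu' => by
      rw [hMw, Real.exp_le_exp]
      have := hd u hu ((henergy u).1 hu')
      nlinarith)
    (by rwa [div_eq_mul_inv, ← Real.exp_neg]) (by linarith)
  have hcard' : Fintype.card {x // M.energy x = 0} = 2 ^ (n - Hm.rank) := by
    rw [← card_ker_mulVec]
    exact Fintype.card_congr (Equiv.subtypeEquivRight henergy)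
  -- the empty terms are scalar
  have hempty : ∀ s, ∃ c : ℝ, hermPart (VF ∅ s) = (c : ℂ) • 1 := by
    intro s
    by_cases h0 : VF ∅ s = 0
    · exact ⟨0, by rw [h0, hermPart_zero, Complex.ofReal_zero, zero_smul]⟩
    · obtain ⟨c, hc⟩ := (hVS ∅ s h0).exists_eq_smul_one
      exact ⟨c.re, by rw [hc, hermPart_smul_one]⟩
  choose c₀ hc₀ using hempty
  -- the long terms are negligible
  set R : Matrix (F2vec n) (F2vec n) ℂ := ∑ S with ds ≤ (S.card : ℝ), ∑ s, hermPart (VF S s)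
    with hR
  have hsplit : ∑ S, ∑ s, VF S s = Vs + ((∑ s, c₀ s : ℝ) : ℂ) • 1 + R := by
    have h1 : ∑ S, ∑ s, VF S s = ∑ S, ∑ s, hermPart (VF S s) := by
      rw [hsum_herm, hV.hermPart_eq]
    have h2 : ((∑ s, c₀ s : ℝ) : ℂ) • (1 : Matrix (F2vec n) (F2vec n) ℂ)
        = ∑ S : Finset (Fin n), if S = ∅ then ∑ s, hermPart (VF S s) else 0 := by
      rw [Finset.sum_ite_eq' Finset.univ ∅, if_pos (Finset.mem_univ _), Complex.ofReal_sum,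
        Finset.sum_smul]
      exact Finset.sum_congr rfl fun s _ => (hc₀ s).symm
    rw [h1, h2, hVs, hR, Finset.sum_filter, ← Finset.sum_add_distrib, ← Finset.sum_add_distrib]
    refine Finset.sum_congr rfl fun S _ => ?_
    by_cases hS : S = ∅
    · have hc : ¬ ds ≤ (S.card : ℝ) := by rw [hS, Finset.card_empty, Nat.cast_zero]; linarith
      have hne : ¬ (S.Nonempty ∧ (S.card : ℝ) < ds) := by simp [hS]
      simp only [if_neg hne, if_neg hc, if_pos hS, hermPart_zero, Finset.sum_const_zero, zero_add,
        add_zero]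
    · by_cases hc : ds ≤ (S.card : ℝ)
      · have hne : ¬ (S.Nonempty ∧ (S.card : ℝ) < ds) := fun h => absurd h.2 (not_lt.2 hc)
        simp only [if_neg hne, if_pos hc, if_neg hS, hermPart_zero, Finset.sum_const_zero,
          zero_add]
      · have hpos : S.Nonempty ∧ (S.card : ℝ) < ds :=
          ⟨Finset.nonempty_iff_ne_empty.2 hS, not_le.1 hc⟩
        simp only [if_pos hpos, if_neg hc, if_neg hS, add_zero]
  have hRle : opNorm R ≤ η' := by
    calc opNorm R ≤ ∑ S with ds ≤ (S.card : ℝ), ∑ s, opNorm (VF S s) :=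
          (opNorm_sum_le _ _).trans (Finset.sum_le_sum fun S _ =>
            (opNorm_sum_le _ _).trans (Finset.sum_le_sum fun s _ => opNorm_hermPart_le _))
      _ ≤ n * ε * Real.exp (-(κ * ds)) :=
          sum_large_le (fun S => Finset.sum_nonneg fun s _ => opNorm_nonneg _) hκ.le hds hVε
      _ ≤ n * ε * Real.exp (-(κ * ds / 2)) := by
          have : -(κ * ds) ≤ -(κ * ds / 2) := by nlinarith
          gcongr
      _ ≤ η' := hη'
  set cstar : ℝ := c + ∑ s, c₀ s with hcstar
  have hBH : (H₀ + ∑ S, ∑ s, VF S s -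
      (cstar : ℂ) • (1 : Matrix (F2vec n) (F2vec n) ℂ)).IsHermitian := by
    refine (hH₀H.add hV).sub ?_
    rw [Matrix.IsHermitian, Matrix.conjTranspose_smul, Matrix.conjTranspose_one]
    congr 1
    exact Complex.conj_ofReal _
  refine ⟨cstar, hBH, ?_⟩
  have hdiff : H₀ + ∑ S, ∑ s, VF S s - (cstar : ℂ) • (1 : Matrix (F2vec n) (F2vec n) ℂ) - M.ham
      + (c : ℂ) • 1 = R := by
    rw [hMham', hsplit, hcstar, Complex.ofReal_add, add_smul]
    abel
  have hfin := eigenvalues_cluster_perturb hMH hBH (c := c) (η := η) (η' := η') (γ := 7 / 8 - η)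
    (N := 2 ^ (n - Hm.rank)) (by rw [hdiff]; exact hRle) hcl (hcard.trans hcard') hη0
    (by linarith)
  exact hfin

end CodeSpectrum

/-- Stability of classical LDPC codes under symmetric perturbations
(spectral part).  For a classical `(q,q')`-LDPC code given by a parity-check matrix `H`
with nonzero rows, `k = n − rank H`, distance `d` the minimum weight of a nonzero
codeword, `(d_c, f)`-check-soundness with `d_s = min(d, d_c) ≥ c_d·log n` and the
summability condition, any perturbation `V` whose strongly-supported terms commute with
every X-type symmetry `P(u, 0)` (for codewords `u`) and whose `κ₁`-norm is
`ε ≤ min(ε₀, 1/(3c₁))` shifts the spectrum of `H₀ + V` (up to an overall constant) into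
`[−ε_*, ε_*] ∪ [1/2 + ε_*, ∞)` with exactly `2^k` eigenvalues in the first interval,
where `ε_* = c₂·n·ε·e^{−κ₁·d_s/2}`. -/
theorem classical_ldpc_stability_symmetric_spectral
    (q q' : ℕ) (hq : 2 ≤ q) (hq' : 2 ≤ q')
    (c_d κ₁ : ℝ) (hcd : 0 < c_d) (hκ₁ : 2 / c_d < κ₁)
    (a : ℝ) (ha : 1 ≤ a)
    (c'f c''f α : ℝ) (hc'f : 0 < c'f) (hc''f : 0 < c''f) (hα : 0 < α) :
    ∃ ε₀ c₁ c₂ c₃ : ℝ, 0 < ε₀ ∧ 0 < c₁ ∧ 0 < c₂ ∧ 0 < c₃ ∧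
      ∀ (n mC : ℕ) (Hm : Matrix (Fin mC) (Fin n) (ZMod 2))
        (C : Fin mC → F2vec n × F2vec n),
        -- the checks are the Z-type Pauli operators given by the rows of Hm
        C = (fun j => ((0 : F2vec n), fun i => Hm j i)) →
        -- nonzero rows
        (∀ j : Fin mC, (fun i => Hm j i) ≠ (0 : F2vec n)) →
        -- (q, q')-LDPC
        (∀ j : Fin mC, (pSupp (C j)).card ≤ q) →
        (∀ i : Fin n, (Finset.univ.filter fun j : Fin mC => i ∈ pSupp (C j)).card ≤ q') →
        -- at least c₃ qubits
        (c₃ ≤ (n : ℝ)) →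
        ∀ (k d : ℕ) (dc : ℝ) (f finv : ℝ → ℝ),
        -- k := n − rank H
        k = n - Hm.rank →
        -- d := minimum Hamming weight of a nonzero codeword
        d = sInf {M : ℕ | ∃ u : F2vec n, u ≠ 0 ∧ Hm.mulVec u = 0 ∧ hamWt u = M} →
        -- f is an increasing bijection of [0, ∞), with inverse finv
        StrictMonoOn f (Set.Ici 0) →
        (∀ x : ℝ, 0 ≤ x → 0 ≤ f x) →
        (∀ x : ℝ, 0 ≤ x → 0 ≤ finv x) →
        (∀ x : ℝ, 0 ≤ x → finv (f x) = x) →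
        (∀ x : ℝ, 0 ≤ x → f (finv x) = x) →
        -- (d_c, f)-check-soundness
        (∀ T : Finset (Fin mC), ((pWeight (∑ j ∈ T, C j) : ℝ) < dc) →
          ∃ T' : Finset (Fin mC), (∑ j ∈ T', C j) = ∑ j ∈ T, C j ∧
            (T'.card : ℝ) ≤ f (pWeight (∑ j ∈ T, C j))) →
        -- d_s = min(d, d_c) ≥ c_d·log n
        (c_d * Real.log n ≤ min (d : ℝ) dc) →
        -- summability condition with constants (c'_f, c''_f, α), Δ := q
        SummabilityCondition (codeGraph C) f finv (min (d : ℝ) dc) (q : ℝ) c'f c''f α →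
        -- the code Hamiltonian
        ∀ (lam : Fin mC → ℝ), (∀ j, 1 ≤ lam j ∧ lam j ≤ a) →
        ∀ H₀ : Matrix (F2vec n) (F2vec n) ℂ,
        H₀ = (∑ j : Fin mC, ((lam j / 2 : ℝ) : ℂ) • ((1 : Matrix (F2vec n) (F2vec n) ℂ) - pauli (C j))) →
        -- the perturbation, presented as a sum of strongly supported symmetric terms
        ∀ (VF : Finset (Fin n) → Finset (Fin mC) → Matrix (F2vec n) (F2vec n) ℂ)
          (V : Matrix (F2vec n) (F2vec n) ℂ),
        V = (∑ S : Finset (Fin n), ∑ s : Finset (Fin mC), VF S s) →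
        V.IsHermitian →
        (∀ S s, VF S s ≠ 0 → StronglySupported C (VF S s) S s) →
        -- each term commutes with every X-type symmetry P(u, 0), H·u = 0
        (∀ S s, ∀ u : F2vec n, Hm.mulVec u = 0 →
          VF S s * pauli (u, (0 : F2vec n)) = pauli (u, (0 : F2vec n)) * VF S s) →
        ∀ ε : ℝ, ε = kappaNorm VF κ₁ →
        ε ≤ min ε₀ (1 / (3 * c₁)) →
        -- conclusion
        ∃ cstar : ℝ,
          ∃ hH : (H₀ + V - (cstar : ℂ) • (1 : Matrix (F2vec n) (F2vec n) ℂ)).IsHermitian,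
            (∀ v : F2vec n, hH.eigenvalues v ∈
              Set.Icc (-(c₂ * n * ε * Real.exp (-(κ₁ * min (d : ℝ) dc / 2))))
                      (c₂ * n * ε * Real.exp (-(κ₁ * min (d : ℝ) dc / 2))) ∪
              Set.Ici (1 / 2 + c₂ * n * ε * Real.exp (-(κ₁ * min (d : ℝ) dc / 2)))) ∧
            (Finset.univ.filter fun v : F2vec n => hH.eigenvalues v ∈
              Set.Icc (-(c₂ * n * ε * Real.exp (-(κ₁ * min (d : ℝ) dc / 2))))
                      (c₂ * n * ε * Real.exp (-(κ₁ * min (d : ℝ) dc / 2)))).card = 2 ^ k := by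
  have hκ : 0 < κ₁ := (div_pos two_pos hcd).trans hκ₁
  have hq0 : (0 : ℝ) < q := by
    have : 0 < q := by omega
    exact_mod_cast this
  set B : ℝ := c''f * Real.exp (c'f * (κ₁ / 4) ^ (-α)) with hB
  have hB0 : 0 < B := by positivity
  set ρ₀ : ℝ := min (κ₁ / 8) (1 / (64 * q)) with hρ₀
  have hρ₀0 : 0 < ρ₀ := lt_min (by positivity) (by positivity)
  set c₂ : ℝ := 2 * (1 + 2 * (1 + B) * ρ₀) + 1 with hc₂
  have hc₂0 : 0 < c₂ := by positivity
  set ε₀ : ℝ := min (ρ₀ / (8 * (1 + 2 * (1 + B) * ρ₀)))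
    (min (1 / (32 * (1 + B))) (1 / (8 * c₂))) with hε₀
  have hε₀0 : 0 < ε₀ :=
    lt_min (by positivity) (lt_min (by positivity) (by positivity))
  refine ⟨ε₀, 1, c₂, 2, hε₀0, one_pos, hc₂0, two_pos, ?_⟩
  intro n mC Hm C hC hrow hCq hCq' hn k d dc f finv hk hd hf hf0 hfinv hfinvf hffinv hsound hdlog
    hsummable lam hlam H₀ hH₀ VF V hVdef hVH hVS hsymm ε hε hεle
  set ds : ℝ := min (d : ℝ) dc with hds
  have hn0 : (0 : ℝ) < n := by linarith
  have hlog : 0 < Real.log n := Real.log_pos (by linarith)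
  have hds0 : 0 < ds := (mul_pos hcd hlog).trans_le hdlog
  have hε0 : 0 ≤ ε := hε ▸ kappaNorm_nonneg VF κ₁
  have hεε₀ : ε ≤ ε₀ := hεle.trans (min_le_left _ _)
  have hX : n * Real.exp (-(κ₁ * ds / 2)) ≤ 1 := by
    rw [Real.exp_neg, ← div_eq_mul_inv, div_le_one (Real.exp_pos _)]
    refine (Real.exp_log hn0).symm.le.trans (Real.exp_le_exp.2 ?_)
    rw [div_lt_iff₀ hcd] at hκ₁
    nlinarith
  have hqH : ∀ j, hamWt (fun i => Hm j i) ≤ q := by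
    intro j
    rw [← pWeight_zType]
    have := hCq j
    rwa [hC] at this
  have hdu : ∀ u : F2vec n, u ≠ 0 → Hm.mulVec u = 0 → ds ≤ hamWt u := by
    intro u hu hu'
    refine (min_le_left _ _).trans ?_
    rw [hd]
    refine Nat.cast_le.2 (Nat.sInf_le ?_)
    exact ⟨u, hu, hu', rfl⟩
  have hVε : ∀ i, ∑ S with i ∈ S, (∑ s, opNorm (VF S s)) * Real.exp (κ₁ * S.card) ≤ ε :=
    fun i => hε ▸ sum_exp_le_kappaNorm VF κ₁ i
  have hnn : ∀ S, 0 ≤ ∑ s, opNorm (VF S s) := fun S =>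
    Finset.sum_nonneg fun s _ => opNorm_nonneg _
  have hN := sum_detectors_le hC hrow (by omega) hqH hf hf0 hfinv hfinvf hffinv hsound hds0
    (min_le_right _ _) hκ hε0 (fun R => hsummable (κ₁ / 4) (by positivity) R)
    (g := fun S => if (S.card : ℝ) < ds then ∑ s, opNorm (VF S s) else 0)
    (fun S => by
      split_ifs
      · exact hnn S
      · exact le_rfl)
    (fun i => (Finset.sum_le_sum fun S _ => by
      refine mul_le_mul_of_nonneg_right ?_ (Real.exp_pos _).le
      split_ifs
      · exact le_rfl
      · exact hnn S).trans (hVε i))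
    (fun S hS => by
      by_contra hlt
      exact hS (if_neg hlt))
  rw [← hB] at hN
  have hsmall : ε + 2 * ((1 + B) * ε) * ρ₀ ≤ ρ₀ / 8 := by
    have h1 : ε ≤ ρ₀ / (8 * (1 + 2 * (1 + B) * ρ₀)) := hεε₀.trans (min_le_left _ _)
    rw [le_div_iff₀ (by positivity)] at h1
    linarith
  have hδ : (1 + B) * ε ≤ 1 / 32 := by
    have h1 : ε ≤ 1 / (32 * (1 + B)) := hεε₀.trans ((min_le_right _ _).trans (min_le_left _ _))
    rw [le_div_iff₀ (by positivity)] at h1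
    linarith
  have hstar : c₂ * n * ε * Real.exp (-(κ₁ * ds / 2)) ≤ 1 / 8 := by
    have h1 : ε ≤ 1 / (8 * c₂) := hεε₀.trans ((min_le_right _ _).trans (min_le_right _ _))
    rw [le_div_iff₀ (by positivity)] at h1
    have h2 : 0 ≤ c₂ * ε := by positivity
    nlinarith
  have hqρ : 64 * (q : ℝ) * ρ₀ ≤ 1 := by
    have h1 : ρ₀ ≤ 1 / (64 * q) := min_le_right _ _
    rw [le_div_iff₀ (by positivity)] at h1
    linarith
  have hηη' : n * (2 * (ε + 2 * ((1 + B) * ε) * ρ₀)) * Real.exp (-(κ₁ * ds / 2)) +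
      n * ε * Real.exp (-(κ₁ * ds / 2)) = c₂ * n * ε * Real.exp (-(κ₁ * ds / 2)) := by
    rw [hc₂]
    ring
  obtain ⟨cstar, hH, h1, h2⟩ := eigenvalues_code_perturbation hC hqH hds0 hdu
    (fun j => (hlam j).1) (hVdef ▸ hVH) hVS hsymm hκ hε0 (by positivity) hVε hN hρ₀0
    (min_le_left _ _) hqρ hsmall hδ le_rfl le_rfl (by linarith)
  rw [hηη', ← hk] at h2
  subst hVdef hH₀
  refine ⟨cstar, hH, fun x => ?_, h2⟩
  rcases h1 x with h | h
  · left
    rwa [hηη'] at h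
  · right
    rw [Set.mem_Ici]
    linarith
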